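/- arXiv:1601.00856 — 3 statements merged into one kernel-verified Lean document; each statement's English description precedes it below -/
import Mathlib

section
/- Let α ∈ [1,2] and δ ∈ (0,1). There is a constant C = C(α,δ) > 0 such that for every dyadic number N ≥ 2, every dyadic number M ≥ 1, every t ≠ 0 and every (x,y) ∈ ℝ², the oscillatory integral I_t^{N,M}(x,y) = ∫_{ℝ²} e^{i(tω(ξ,μ)+xξ+yμ)} φ_N(ξ) φ_{≤M}(μ) ρ_δ(B − μ²/|ξ|^α) dξ dμ satisfies |I_t^{N,M}(x,y)| ≤ C N^{−α/2} |t|^{−1} (uniformly in M, x and y). -/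
open MeasureTheory Set

noncomputable section

lemma arctan_piece (ψ1 ψ2 : ℝ → ℝ) (l a b : ℝ) (hl : 0 < l) (hab : a ≤ b)
    (h1 : ∀ u ∈ Icc a b, HasDerivAt ψ1 (ψ2 u) u) (hc : ContinuousOn ψ2 (Icc a b))
    (hs : (∀ u ∈ Icc a b, 0 ≤ ψ2 u) ∨ (∀ u ∈ Icc a b, ψ2 u ≤ 0)) :
    ∫ u in a..b, |ψ2 u| / (ψ1 u ^ 2 + l) ≤ Real.pi / √l := by
  have hsl : 0 < √l := Real.sqrt_pos.2 hl
  have hsq : √l ^ 2 = l := Real.sq_sqrt hl.le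
  have hd : ∀ u ∈ uIcc a b, HasDerivAt (fun u => Real.arctan (ψ1 u / √l) / √l)
      (ψ2 u / (ψ1 u ^ 2 + l)) u := by
    intro u hu
    rw [uIcc_of_le hab] at hu
    have := (((h1 u hu).div_const (√l)).arctan).div_const (√l)
    refine this.congr_deriv (Eq.symm ?_)
    have : (1 + (ψ1 u / √l) ^ 2) = (ψ1 u ^ 2 + l) / l := by
      rw [div_pow, hsq]; field_simp; ring
    rw [this]
    have h3 : ψ1 u ^ 2 + l ≠ 0 := by positivity
    field_simp
    rw [hsq]
  have hc1 : ContinuousOn ψ1 (Icc a b) := fun u hu => (h1 u hu).continuousAt.continuousWithinAt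
  have hi : IntervalIntegrable (fun u => ψ2 u / (ψ1 u ^ 2 + l)) volume a b := by
    apply ContinuousOn.intervalIntegrable
    rw [uIcc_of_le hab]
    apply hc.div (by fun_prop)
    intro u _; positivity
  have key := intervalIntegral.integral_eq_sub_of_hasDerivAt hd hi
  have b1 := Real.arctan_lt_pi_div_two (ψ1 b / √l)
  have b2 := Real.neg_pi_div_two_lt_arctan (ψ1 b / √l)
  have b3 := Real.arctan_lt_pi_div_two (ψ1 a / √l)
  have b4 := Real.neg_pi_div_two_lt_arctan (ψ1 a / √l)
  rcases hs with hs | hs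
  · have : ∫ u in a..b, |ψ2 u| / (ψ1 u ^ 2 + l) = ∫ u in a..b, ψ2 u / (ψ1 u ^ 2 + l) := by
      apply intervalIntegral.integral_congr
      intro u hu
      rw [uIcc_of_le hab] at hu
      simp only [abs_of_nonneg (hs u hu)]
    rw [this, key, ← sub_div]
    gcongr; linarith
  · have : ∫ u in a..b, |ψ2 u| / (ψ1 u ^ 2 + l) = -∫ u in a..b, ψ2 u / (ψ1 u ^ 2 + l) := by
      rw [← intervalIntegral.integral_neg]
      apply intervalIntegral.integral_congr
      intro u hu
      rw [uIcc_of_le hab] at hu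
      simp only [abs_of_nonpos (hs u hu), neg_div]
    rw [this, key, ← sub_div, ← neg_div]
    gcongr; linarith

lemma vdc (ψ ψ1 ψ2 : ℝ → ℝ) (b b' : ℝ → ℂ) (l z C : ℝ) (hl : 0 < l) (hz : z ∈ Icc (1/2:ℝ) 2)
    (h0 : ∀ u ∈ Icc (1/2:ℝ) 2, HasDerivAt ψ (ψ1 u) u)
    (h1 : ∀ u ∈ Icc (1/2:ℝ) 2, HasDerivAt ψ1 (ψ2 u) u) (hc : ContinuousOn ψ2 (Icc (1/2:ℝ) 2))
    (hs1 : (∀ u ∈ Icc (1/2) z, 0 ≤ ψ2 u) ∨ (∀ u ∈ Icc (1/2) z, ψ2 u ≤ 0))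
    (hs2 : (∀ u ∈ Icc z 2, 0 ≤ ψ2 u) ∨ (∀ u ∈ Icc z 2, ψ2 u ≤ 0))
    (hb : ∀ u ∈ Icc (1/2:ℝ) 2, HasDerivAt b (b' u) u) (hbc : ContinuousOn b' (Icc (1/2:ℝ) 2))
    (hbC : ∀ u ∈ Icc (1/2:ℝ) 2, ‖b u‖ ≤ C) (hbC' : ∀ u ∈ Icc (1/2:ℝ) 2, ‖b' u‖ ≤ C)
    (hbl : ∀ u ∈ Icc (1/2:ℝ) 2, b u ≠ 0 → l ≤ |ψ2 u|) :
    ‖∫ u in (1/2:ℝ)..2, Complex.exp (Complex.I * (ψ u : ℂ)) * b u‖ ≤ 20 * C / √l := by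
  have hsl : 0 < √l := Real.sqrt_pos.2 hl
  have hsq : √l ^ 2 = l := Real.sq_sqrt hl.le
  have hC : 0 ≤ C := (norm_nonneg _).trans (hbC 1 (by norm_num))
  have hI : uIcc (1/2:ℝ) 2 = Icc (1/2) 2 := uIcc_of_le (by norm_num)
  have hpos : ∀ u, 0 < ψ1 u ^ 2 + l := fun u => by positivity
  set w : ℝ → ℝ := fun u => ψ1 u / (ψ1 u ^ 2 + l) with hw
  set w' : ℝ → ℝ := fun u => ψ2 u * (l - ψ1 u ^ 2) / (ψ1 u ^ 2 + l) ^ 2 with hw'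
  have hwd : ∀ u ∈ Icc (1/2:ℝ) 2, HasDerivAt w (w' u) u := by
    intro u hu
    have := (h1 u hu).div (((h1 u hu).pow 2).add_const l) (hpos u).ne'
    refine this.congr_deriv (Eq.symm ?_)
    simp only [hw', Pi.pow_apply]
    congr 1
    push_cast
    ring
  have hwb : ∀ u, |w u| ≤ 1 / (2 * √l) := by
    intro u
    simp only [hw]
    rw [abs_div, abs_of_pos (hpos u), div_le_div_iff₀ (hpos u) (by positivity)]
    nlinarith [sq_nonneg (|ψ1 u| - √l), sq_abs (ψ1 u)]
  have hwb' : ∀ u, |w' u| ≤ |ψ2 u| / (ψ1 u ^ 2 + l) := by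
    intro u
    simp only [hw']
    rw [abs_div, abs_mul, abs_of_pos (pow_pos (hpos u) 2), div_le_div_iff₀ (pow_pos (hpos u) 2) (hpos u)]
    have : |l - ψ1 u ^ 2| ≤ ψ1 u ^ 2 + l := by
      rw [abs_le]; constructor <;> nlinarith [sq_nonneg (ψ1 u)]
    have h2 := hpos u
    calc |ψ2 u| * |l - ψ1 u ^ 2| * (ψ1 u ^ 2 + l) ≤ |ψ2 u| * (ψ1 u ^ 2 + l) * (ψ1 u ^ 2 + l) := by gcongr
      _ = _ := by ring
  set F : ℝ → ℂ := fun u => Complex.exp (Complex.I * (ψ u : ℂ)) * (-Complex.I * (w u : ℂ)) * b u with hF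
  set E : ℝ → ℂ := fun u => Complex.exp (Complex.I * (ψ u : ℂ)) *
    (-Complex.I * (w' u : ℂ) * b u - Complex.I * (w u : ℂ) * b' u - ((l / (ψ1 u ^ 2 + l) : ℝ) : ℂ) * b u) with hE
  have hFd : ∀ u ∈ Icc (1/2:ℝ) 2, HasDerivAt F (Complex.exp (Complex.I * (ψ u : ℂ)) * b u + E u) u := by
    intro u hu
    have e1 := (((h0 u hu).ofReal_comp).const_mul Complex.I).cexp
    have e2 := ((hwd u hu).ofReal_comp).const_mul (-Complex.I)
    have := (e1.mul e2).mul (hb u hu)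
    refine this.congr_deriv (Eq.symm ?_)
    simp only [hE, hw, Pi.mul_apply]
    have h3 : ((ψ1 u : ℂ) ^ 2 + (l:ℂ)) ≠ 0 := by exact_mod_cast (hpos u).ne'
    push_cast
    field_simp
    ring_nf
    simp only [Complex.I_sq]
    ring
  have cψ : ContinuousOn ψ (Icc (1/2:ℝ) 2) := fun u hu => (h0 u hu).continuousAt.continuousWithinAt
  have cψ1 : ContinuousOn ψ1 (Icc (1/2:ℝ) 2) := fun u hu => (h1 u hu).continuousAt.continuousWithinAt
  have cb : ContinuousOn b (Icc (1/2:ℝ) 2) := fun u hu => (hb u hu).continuousAt.continuousWithinAt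
  have cw : ContinuousOn w (Icc (1/2:ℝ) 2) := fun u hu => (hwd u hu).continuousAt.continuousWithinAt
  have cw' : ContinuousOn w' (Icc (1/2:ℝ) 2) := by
    apply ContinuousOn.div (by fun_prop) (by fun_prop)
    intro u _; exact (pow_pos (hpos u) 2).ne'
  have cl : ContinuousOn (fun u => l / (ψ1 u ^ 2 + l)) (Icc (1/2:ℝ) 2) := by
    apply ContinuousOn.div (by fun_prop) (by fun_prop)
    intro u _; exact (hpos u).ne'
  have cE0 : ContinuousOn (fun u => Complex.exp (Complex.I * (ψ u : ℂ)) * b u) (Icc (1/2:ℝ) 2) := by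
    fun_prop
  have cE : ContinuousOn E (Icc (1/2:ℝ) 2) := by
    simp only [hE]
    have := Complex.continuous_ofReal.comp_continuousOn cl
    simp only [Function.comp_def] at this
    fun_prop
  have iE0 : IntervalIntegrable (fun u => Complex.exp (Complex.I * (ψ u : ℂ)) * b u) volume (1/2) 2 :=
    ContinuousOn.intervalIntegrable (by rwa [hI])
  have iE : IntervalIntegrable E volume (1/2) 2 :=
    ContinuousOn.intervalIntegrable (by rwa [hI])
  have key := intervalIntegral.integral_eq_sub_of_hasDerivAt (f := F) (by rw [hI]; exact hFd) (iE0.add iE)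
  rw [intervalIntegral.integral_add iE0 iE] at key
  have nexp : ∀ r : ℝ, ‖Complex.exp (Complex.I * (r : ℂ))‖ = 1 := by
    intro r; rw [mul_comm]; exact Complex.norm_exp_ofReal_mul_I r
  have nF : ∀ u ∈ Icc (1/2:ℝ) 2, ‖F u‖ ≤ C / (2 * √l) := by
    intro u hu
    simp only [hF, norm_mul, nexp, norm_neg, Complex.norm_I, Complex.norm_real, Real.norm_eq_abs]
    calc 1 * (1 * |w u|) * ‖b u‖ ≤ 1 * (1 * (1 / (2 * √l))) * C := by gcongr; exact hwb u; exact hbC u hu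
      _ = _ := by ring
  have cM : ContinuousOn (fun u => |ψ2 u| / (ψ1 u ^ 2 + l)) (Icc (1/2:ℝ) 2) := by
    apply ContinuousOn.div (by fun_prop) (by fun_prop)
    intro u _; exact (hpos u).ne'
  have nE : ∀ u ∈ Icc (1/2:ℝ) 2, ‖E u‖ ≤ 2 * C * (|ψ2 u| / (ψ1 u ^ 2 + l)) + C / (2 * √l) := by
    intro u hu
    simp only [hE, norm_mul, nexp, one_mul]
    have t1 : ‖-Complex.I * (w' u : ℂ) * b u‖ ≤ C * (|ψ2 u| / (ψ1 u ^ 2 + l)) := by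
      simp only [norm_mul, norm_neg, Complex.norm_I, Complex.norm_real, Real.norm_eq_abs, one_mul]
      rw [mul_comm]; gcongr; exact hbC u hu; exact hwb' u
    have t2 : ‖Complex.I * (w u : ℂ) * b' u‖ ≤ C / (2 * √l) := by
      simp only [norm_mul, norm_neg, Complex.norm_I, Complex.norm_real, Real.norm_eq_abs, one_mul]
      calc |w u| * ‖b' u‖ ≤ (1 / (2 * √l)) * C := by gcongr; exact hwb u; exact hbC' u hu
        _ = _ := by ring
    have t3 : ‖((l / (ψ1 u ^ 2 + l) : ℝ) : ℂ) * b u‖ ≤ C * (|ψ2 u| / (ψ1 u ^ 2 + l)) := by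
      simp only [norm_mul, Complex.norm_real, Real.norm_eq_abs]
      by_cases hb0 : b u = 0
      · rw [hb0, norm_zero, mul_zero]; have := hpos u; positivity
      · rw [abs_of_pos (div_pos hl (hpos u)), mul_comm]
        have := hpos u
        gcongr
        · exact hbC u hu
        · exact hbl u hu hb0
    calc _ ≤ ‖-Complex.I * (w' u : ℂ) * b u‖ + ‖Complex.I * (w u : ℂ) * b' u‖ + ‖((l / (ψ1 u ^ 2 + l) : ℝ) : ℂ) * b u‖ :=
          (norm_sub_le _ _).trans (by gcongr; exact norm_sub_le _ _)
      _ ≤ _ := by linarith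
  have iM : IntervalIntegrable (fun u => |ψ2 u| / (ψ1 u ^ 2 + l)) volume (1/2) 2 :=
    ContinuousOn.intervalIntegrable (by rwa [hI])
  have m1 : ∫ u in (1/2:ℝ)..2, |ψ2 u| / (ψ1 u ^ 2 + l) ≤ 2 * (Real.pi / √l) := by
    have s1 : Icc (1/2:ℝ) z ⊆ Icc (1/2:ℝ) 2 := Icc_subset_Icc_right hz.2
    have s2 : Icc z 2 ⊆ Icc (1/2:ℝ) 2 := Icc_subset_Icc_left hz.1
    have a1 := arctan_piece ψ1 ψ2 l (1/2) z hl hz.1 (fun u hu => h1 u (s1 hu)) (hc.mono s1) hs1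
    have a2 := arctan_piece ψ1 ψ2 l z 2 hl hz.2 (fun u hu => h1 u (s2 hu)) (hc.mono s2) hs2
    rw [← intervalIntegral.integral_add_adjacent_intervals (b := z)]
    · linarith
    · exact (cM.mono s1).intervalIntegrable_of_Icc hz.1
    · exact (cM.mono s2).intervalIntegrable_of_Icc hz.2
  have nIE : ‖∫ u in (1/2:ℝ)..2, E u‖ ≤ 2 * C * (2 * (Real.pi / √l)) + 3 / 2 * (C / (2 * √l)) := by
    have i3 : IntervalIntegrable (fun u => 2 * C * (|ψ2 u| / (ψ1 u ^ 2 + l)) + C / (2 * √l)) volume (1/2) 2 :=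
      (iM.const_mul _).add intervalIntegrable_const
    calc _ ≤ ∫ u in (1/2:ℝ)..2, ‖E u‖ := intervalIntegral.norm_integral_le_integral_norm (by norm_num)
      _ ≤ ∫ u in (1/2:ℝ)..2, (2 * C * (|ψ2 u| / (ψ1 u ^ 2 + l)) + C / (2 * √l)) :=
          intervalIntegral.integral_mono_on (by norm_num) iE.norm i3 nE
      _ = 2 * C * (∫ u in (1/2:ℝ)..2, |ψ2 u| / (ψ1 u ^ 2 + l)) + 3 / 2 * (C / (2 * √l)) := by
          rw [intervalIntegral.integral_add (iM.const_mul _) intervalIntegrable_const,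
            intervalIntegral.integral_const_mul, intervalIntegral.integral_const]
          norm_num
      _ ≤ _ := by gcongr
  have fin : ∫ u in (1/2:ℝ)..2, Complex.exp (Complex.I * (ψ u : ℂ)) * b u
      = F 2 - F (1/2) - ∫ u in (1/2:ℝ)..2, E u := by rw [← key]; ring
  rw [fin]
  have hpi := Real.pi_lt_d2
  calc _ ≤ ‖F 2‖ + ‖F (1/2)‖ + ‖∫ u in (1/2:ℝ)..2, E u‖ :=
        (norm_sub_le _ _).trans (by gcongr; exact norm_sub_le _ _)
    _ ≤ C / (2 * √l) + C / (2 * √l) + (2 * C * (2 * (Real.pi / √l)) + 3 / 2 * (C / (2 * √l))) := by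
        gcongr
        · exact nF _ (by norm_num)
        · exact nF _ (by norm_num)
    _ = (C / √l) * (4 * Real.pi + 7 / 4) := by field_simp; ring
    _ ≤ (C / √l) * 20 := by gcongr; linarith
    _ = _ := by ring

def SymB (f : ℝ → ℂ) (C : ℝ) : Prop :=
  ∃ f' : ℝ → ℂ, (∀ u ∈ Icc (1/2:ℝ) 2, HasDerivAt f (f' u) u ∧ ‖f u‖ ≤ C ∧ ‖f' u‖ ≤ C) ∧
    ContinuousOn f' (Icc (1/2:ℝ) 2)

lemma SymB.nonneg {f : ℝ → ℂ} {C : ℝ} (h : SymB f C) : 0 ≤ C := by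
  obtain ⟨f', h, -⟩ := h
  exact (norm_nonneg _).trans (h 1 (by norm_num)).2.1

lemma SymB.cont {f : ℝ → ℂ} {C : ℝ} (h : SymB f C) : ContinuousOn f (Icc (1/2:ℝ) 2) := by
  obtain ⟨f', h, -⟩ := h
  exact fun u hu => (h u hu).1.continuousAt.continuousWithinAt

lemma SymB.mono {f : ℝ → ℂ} {C D : ℝ} (h : SymB f C) (hCD : C ≤ D) : SymB f D := by
  obtain ⟨f', h, hc⟩ := h
  exact ⟨f', fun u hu => ⟨(h u hu).1, (h u hu).2.1.trans hCD, (h u hu).2.2.trans hCD⟩, hc⟩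

lemma SymB.mul {f g : ℝ → ℂ} {C D : ℝ} (hf : SymB f C) (hg : SymB g D) :
    SymB (fun u => f u * g u) (2 * C * D) := by
  have cf := hf.cont
  have cg := hg.cont
  have nC := hf.nonneg
  have nD := hg.nonneg
  obtain ⟨f', hf, hcf⟩ := hf
  obtain ⟨g', hg, hcg⟩ := hg
  refine ⟨fun u => f' u * g u + f u * g' u, fun u hu => ⟨(hf u hu).1.mul (hg u hu).1, ?_, ?_⟩, by fun_prop⟩
  · rw [norm_mul]
    calc _ ≤ C * D := by gcongr; exacts [(hf u hu).2.1, (hg u hu).2.1]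
      _ ≤ _ := by nlinarith [mul_nonneg nC nD]
  · calc _ ≤ ‖f' u‖ * ‖g u‖ + ‖f u‖ * ‖g' u‖ := by
          rw [← norm_mul, ← norm_mul]; exact norm_add_le _ _
      _ ≤ C * D + C * D := by
          gcongr; exacts [(hf u hu).2.2, (hg u hu).2.1, (hf u hu).2.1, (hg u hu).2.2]
      _ = _ := by ring

lemma SymB.sub {f g : ℝ → ℂ} {C D : ℝ} (hf : SymB f C) (hg : SymB g D) :
    SymB (fun u => f u - g u) (C + D) := by
  obtain ⟨f', hf, hcf⟩ := hf
  obtain ⟨g', hg, hcg⟩ := hg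
  refine ⟨fun u => f' u - g' u, fun u hu => ⟨(hf u hu).1.sub (hg u hu).1, ?_, ?_⟩, by fun_prop⟩
  · exact (norm_sub_le _ _).trans (add_le_add (hf u hu).2.1 (hg u hu).2.1)
  · exact (norm_sub_le _ _).trans (add_le_add (hf u hu).2.2 (hg u hu).2.2)

lemma SymB.add {f g : ℝ → ℂ} {C D : ℝ} (hf : SymB f C) (hg : SymB g D) :
    SymB (fun u => f u + g u) (C + D) := by
  obtain ⟨f', hf, hcf⟩ := hf
  obtain ⟨g', hg, hcg⟩ := hg
  refine ⟨fun u => f' u + g' u, fun u hu => ⟨(hf u hu).1.add (hg u hu).1, ?_, ?_⟩, by fun_prop⟩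
  · exact (norm_add_le _ _).trans (add_le_add (hf u hu).2.1 (hg u hu).2.1)
  · exact (norm_add_le _ _).trans (add_le_add (hf u hu).2.2 (hg u hu).2.2)

lemma SymB.const (c : ℂ) : SymB (fun _ => c) ‖c‖ :=
  ⟨fun _ => 0, fun u _ => ⟨hasDerivAt_const u c, le_rfl, by simp⟩, continuousOn_const⟩

/-- symbols from real functions -/
lemma SymB.ofReal {f f' : ℝ → ℝ} {C : ℝ} (h : ∀ u ∈ Icc (1/2:ℝ) 2, HasDerivAt f (f' u) u)
    (h0 : ∀ u ∈ Icc (1/2:ℝ) 2, |f u| ≤ C) (h1 : ∀ u ∈ Icc (1/2:ℝ) 2, |f' u| ≤ C)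
    (hc : ContinuousOn f' (Icc (1/2:ℝ) 2)) : SymB (fun u => (f u : ℂ)) C :=
  ⟨fun u => (f' u : ℂ), fun u hu => ⟨(h u hu).ofReal_comp, by simpa using h0 u hu,
    by simpa using h1 u hu⟩, by fun_prop⟩

/-- a bounded `C¹` real function with bounds -/
lemma SymB.ofContDiff {f : ℝ → ℝ} (hf : ContDiff ℝ 1 f) : ∃ C, SymB (fun u => (f u : ℂ)) C := by
  have hd := hf.continuous_deriv le_rfl
  obtain ⟨C, hC⟩ := isCompact_Icc.exists_bound_of_continuousOn (s := Icc (1/2:ℝ) 2) hf.continuous.continuousOn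
  obtain ⟨D, hD⟩ := isCompact_Icc.exists_bound_of_continuousOn (s := Icc (1/2:ℝ) 2) hd.continuousOn
  refine ⟨max C D, SymB.ofReal (f' := deriv f) (fun u _ => (hf.differentiable one_ne_zero u).hasDerivAt) ?_ ?_ hd.continuousOn⟩
  · exact fun u hu => (hC u hu).trans (le_max_left _ _)
  · exact fun u hu => (hD u hu).trans (le_max_right _ _)

def qq (T s u : ℝ) : ℂ := 1 / (1 + 2 * Complex.I * ((T * s ^ 2 * u : ℝ) : ℂ))

lemma qq_ne (r : ℝ) : (1 + 2 * Complex.I * ((r : ℝ) : ℂ)) ≠ 0 := by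
  intro h
  have := congrArg Complex.re h
  simp at this

lemma qq_norm_ge (r : ℝ) : 1 ≤ ‖(1 + 2 * Complex.I * ((r : ℝ) : ℂ))‖ ∧
    2 * |r| ≤ ‖(1 + 2 * Complex.I * ((r : ℝ) : ℂ))‖ := by
  constructor
  · have := Complex.abs_re_le_norm (1 + 2 * Complex.I * ((r : ℝ) : ℂ))
    simpa using this
  · have := Complex.abs_im_le_norm (1 + 2 * Complex.I * ((r : ℝ) : ℂ))
    simpa [abs_mul] using this

lemma qq_norm_le_one (T s u : ℝ) : ‖qq T s u‖ ≤ 1 := by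
  rw [qq, norm_div, norm_one]
  exact (div_le_one (by linarith [(qq_norm_ge (T * s ^ 2 * u)).1])).2 (qq_norm_ge _).1

lemma qq_norm_le {T s u : ℝ} (hu : 1/2 ≤ u) : ‖qq T s u‖ * (|T| * s ^ 2) ≤ 1 := by
  have h := qq_norm_ge (T * s ^ 2 * u)
  rw [qq, norm_div, norm_one, div_mul_eq_mul_div, one_mul, div_le_one (by linarith [h.1])]
  refine le_trans ?_ h.2
  rw [abs_mul, abs_mul, abs_of_nonneg (sq_nonneg s), abs_of_nonneg (by linarith : 0 ≤ u)]
  have : 0 ≤ |T| * s ^ 2 := by positivity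
  nlinarith

lemma qq_norm_le' {T s u : ℝ} (hu : 1/2 ≤ u) : ‖qq T s u‖ ≤ 2 / (1 + |T| * s ^ 2) := by
  rw [le_div_iff₀ (by positivity)]
  linarith [qq_norm_le (T := T) (s := s) hu, qq_norm_le_one T s u]

lemma sym_qq (T s : ℝ) : SymB (fun u => qq T s u) (8 / (1 + |T| * s ^ 2)) := by
  have hp : 0 < 1 + |T| * s ^ 2 := by positivity
  have hcq : Continuous (fun u => qq T s u) := by
    unfold qq
    exact Continuous.div (by fun_prop) (by fun_prop) (fun u => qq_ne _)
  refine ⟨fun u => -(2 * Complex.I * ((T * s ^ 2 : ℝ) : ℂ)) * (qq T s u) ^ 2, fun u hu => ⟨?_, ?_, ?_⟩, by fun_prop⟩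
  · have h1 : HasDerivAt (fun u : ℝ => T * s ^ 2 * u) (T * s ^ 2) u := by
      simpa using (hasDerivAt_id u).const_mul (T * s ^ 2)
    have h2 := ((h1.ofReal_comp.const_mul (2 * Complex.I)).const_add 1)
    have := h2.inv (qq_ne _)
    refine (this.congr_deriv ?_).congr_of_eventuallyEq (Filter.Eventually.of_forall fun v => ?_)
    · simp only [qq]
      have := qq_ne (T * s ^ 2 * u)
      field_simp
    · simp [qq]
  · refine (qq_norm_le' hu.1).trans ?_
    gcongr; norm_num
  · simp only [norm_mul, norm_neg, norm_pow, Complex.norm_I, Complex.norm_real, Real.norm_eq_abs]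
    have a := qq_norm_le' (T := T) (s := s) hu.1
    have b := qq_norm_le (T := T) (s := s) hu.1
    rw [sq_abs]
    norm_num
    have h0 := norm_nonneg (qq T s u)
    calc 2 * (|T| * s ^ 2) * ‖qq T s u‖ ^ 2 = 2 * (‖qq T s u‖ * (|T| * s ^ 2)) * ‖qq T s u‖ := by ring
      _ ≤ 2 * 1 * (2 / (1 + |T| * s ^ 2)) := by gcongr
      _ ≤ _ := by rw [mul_div_assoc']; gcongr; norm_num

/-- Cutoff composed with the moving centre. -/
lemma sym_cut {β β' : ℝ → ℝ} {D s Y R : ℝ} (hβ : ∀ x, HasDerivAt β (β' x) x) (hc : Continuous β')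
    (hb : ∀ x, |β x| ≤ D) (hb' : ∀ x, |β' x| ≤ D) (hs : ∀ x, 5/3 < |x| → β' x = 0)
    (hsle : |s| ≤ 1) (hR : 1 ≤ R) :
    SymB (fun u => ((β ((s - Y / u) / R) : ℝ) : ℂ)) (6 * D) := by
  have hD : 0 ≤ D := (abs_nonneg _).trans (hb 0)
  have hR0 : 0 < R := by linarith
  refine SymB.ofReal (f' := fun u => β' ((s - Y / u) / R) * ((Y / u ^ 2) / R)) ?_ ?_ ?_ ?_
  · intro u hu
    have hu0 : u ≠ 0 := by have := hu.1; linarith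
    have h1 : HasDerivAt (fun u : ℝ => (s - Y / u) / R) ((Y / u ^ 2) / R) u := by
      have := (((hasDerivAt_inv hu0).const_mul Y).const_sub s).div_const R
      simp only [← div_eq_mul_inv] at this
      exact this.congr_deriv (by field_simp)
    exact (hβ _).comp u h1
  · intro u hu; linarith [hb ((s - Y / u) / R)]
  · intro u hu
    have hu0 : 0 < u := by have := hu.1; linarith
    by_cases h : 5/3 < |(s - Y / u) / R|
    · rw [hs _ h]; simp; positivity
    · push Not at h
      rw [abs_div, abs_of_pos hR0, div_le_iff₀ hR0] at h
      have h2 : |Y / u| ≤ 3 * R := by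
        have := abs_sub_abs_le_abs_sub (Y / u) s
        rw [abs_sub_comm] at this
        linarith
      have h3 : |Y / u ^ 2 / R| ≤ 6 := by
        have e : Y / u ^ 2 / R = (Y / u) * (1 / u) / R := by field_simp
        rw [e, abs_div, abs_of_pos hR0, div_le_iff₀ hR0, abs_mul]
        have : |1 / u| ≤ 2 := by
          rw [abs_of_pos (by positivity), div_le_iff₀ hu0]; linarith [hu.1]
        calc _ ≤ 3 * R * 2 := by gcongr
          _ = _ := by ring
      rw [abs_mul, mul_comm]
      gcongr
      exact hb' _
  · apply ContinuousOn.mul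
    · apply hc.comp_continuousOn
      exact ContinuousOn.div_const (continuousOn_const.sub (continuousOn_const.div continuousOn_id
        (fun u hu => by have := hu.1; simp only [id]; linarith))) _
    · exact ContinuousOn.div_const (continuousOn_const.div (by fun_prop)
        (fun u hu => by have := hu.1; positivity)) _

def PP (α Y s u : ℝ) : ℝ := α * (α + 1) / 2 - (s - Y / u) ^ 2 / u ^ α

def PPu (α Y s u : ℝ) : ℝ :=
  -(2 * (s - Y / u) * (Y / u ^ 2) / u ^ α - (s - Y / u) ^ 2 * (α / (u * u ^ α)))

lemma rpow_bds {α u : ℝ} (hα : α ∈ Icc (1:ℝ) 2) (hu : u ∈ Icc (1/2:ℝ) 2) :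
    1/4 ≤ u ^ α ∧ u ^ α ≤ 4 := by
  have hu0 : 0 < u := by linarith [hu.1]
  constructor
  · calc (1/4:ℝ) = (1/2:ℝ) ^ (2:ℝ) := by norm_num
      _ ≤ (1/2:ℝ) ^ α := Real.rpow_le_rpow_of_exponent_ge (by norm_num) (by norm_num) hα.2
      _ ≤ u ^ α := Real.rpow_le_rpow (by norm_num) hu.1 (by linarith [hα.1])
  · calc u ^ α ≤ 2 ^ α := Real.rpow_le_rpow hu0.le hu.2 (by linarith [hα.1])
      _ ≤ 2 ^ (2:ℝ) := Real.rpow_le_rpow_of_exponent_le (by norm_num) hα.2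
      _ = 4 := by norm_num

lemma B_bds {α : ℝ} (hα : α ∈ Icc (1:ℝ) 2) : 1 ≤ α * (α + 1) / 2 ∧ α * (α + 1) / 2 ≤ 3 := by
  obtain ⟨h1, h2⟩ := hα
  constructor <;> nlinarith

lemma PP_mu {α Y s u : ℝ} (hα : α ∈ Icc (1:ℝ) 2) (hu : u ∈ Icc (1/2:ℝ) 2)
    (h : |PP α Y s u| ≤ 1) : |s - Y / u| ≤ 4 := by
  have hv := rpow_bds hα hu
  have hB := B_bds hα
  unfold PP at h
  have h1 := (abs_le.1 h).1
  have h2 : (s - Y / u) ^ 2 / u ^ α ≤ 4 := by linarith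
  rw [div_le_iff₀ (by linarith)] at h2
  apply abs_le_of_sq_le_sq _ (by norm_num)
  linarith

lemma inv_u {u : ℝ} (hu : u ∈ Icc (1/2:ℝ) 2) : |1 / u| ≤ 2 := by
  have hu0 : 0 < u := by linarith [hu.1]
  rw [abs_of_pos (by positivity), div_le_iff₀ hu0]; linarith [hu.1]

lemma inv_v {α u : ℝ} (hα : α ∈ Icc (1:ℝ) 2) (hu : u ∈ Icc (1/2:ℝ) 2) : |1 / u ^ α| ≤ 4 := by
  have hv := rpow_bds hα hu
  rw [abs_of_pos (by apply div_pos <;> linarith), div_le_iff₀ (by linarith)]; linarith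

lemma PP_Y {Y s u : ℝ} (hu : u ∈ Icc (1/2:ℝ) 2) (hs : |s| ≤ 1)
    (h : |s - Y / u| ≤ 4) : |Y / u ^ 2| ≤ 10 := by
  have hu0 : 0 < u := by linarith [hu.1]
  have h2 : |Y / u| ≤ 5 := by
    have := abs_sub_abs_le_abs_sub (Y / u) s
    rw [abs_sub_comm] at this
    linarith
  have e : Y / u ^ 2 = (Y / u) * (1 / u) := by field_simp
  rw [e, abs_mul]
  calc _ ≤ (5:ℝ) * 2 := by gcongr; exact inv_u hu
    _ = _ := by norm_num

lemma PPu_bd {α Y s u : ℝ} (hα : α ∈ Icc (1:ℝ) 2) (hu : u ∈ Icc (1/2:ℝ) 2) (hs : |s| ≤ 1)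
    (h : |PP α Y s u| ≤ 1) : |PPu α Y s u| ≤ 600 := by
  have hm := PP_mu hα hu h
  have hY := PP_Y hu hs hm
  have hu1 := inv_u hu
  have hv1 := inv_v hα hu
  have hu0 : 0 < u := by linarith [hu.1]
  have hv0 : 0 < u ^ α := Real.rpow_pos_of_pos hu0 _
  have ha : |α| ≤ 2 := by rw [abs_le]; constructor <;> linarith [hα.1, hα.2]
  have e : PPu α Y s u = -(2 * (s - Y / u) * (Y / u ^ 2) * (1 / u ^ α) -
      (s - Y / u) ^ 2 * (α * (1 / u) * (1 / u ^ α))) := by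
    unfold PPu; congr 1; field_simp
  rw [e, abs_neg]
  calc _ ≤ |2 * (s - Y / u) * (Y / u ^ 2) * (1 / u ^ α)| + |(s - Y / u) ^ 2 * (α * (1 / u) * (1 / u ^ α))| :=
        abs_sub _ _
    _ = 2 * |s - Y / u| * |Y / u ^ 2| * |1 / u ^ α| + |s - Y / u| ^ 2 * (|α| * |1 / u| * |1 / u ^ α|) := by
        simp only [abs_mul, abs_pow]; norm_num
    _ ≤ 2 * 4 * 10 * 4 + 4 ^ 2 * (2 * 2 * 4) := by gcongr
    _ ≤ _ := by norm_num

lemma mu_deriv {Y s u : ℝ} (hu0 : u ≠ 0) : HasDerivAt (fun u : ℝ => (s - Y / u)) (Y / u ^ 2) u := by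
  have := (((hasDerivAt_inv hu0).const_mul Y).const_sub s)
  simp only [← div_eq_mul_inv] at this
  exact this.congr_deriv (by field_simp)

lemma PP_deriv {α Y s u : ℝ} (hu0 : 0 < u) : HasDerivAt (fun u : ℝ => PP α Y s u) (PPu α Y s u) u := by
  have hv0 : 0 < u ^ α := Real.rpow_pos_of_pos hu0 _
  have h1 := ((mu_deriv (Y := Y) (s := s) hu0.ne').pow 2).div
    (Real.hasDerivAt_rpow_const (p := α) (Or.inl hu0.ne')) hv0.ne'
  refine (h1.const_sub (α * (α + 1) / 2)).congr_deriv ?_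
  rw [Real.rpow_sub_one hu0.ne']
  simp only [PPu, Pi.pow_apply]
  push_cast
  field_simp

lemma W_deriv {α Y s u δ : ℝ} (hu0 : 0 < u) :
    HasDerivAt (fun u : ℝ => -2 * (s - Y / u) / u ^ α / δ)
      (-2 * ((Y / u ^ 2) * (1 / u ^ α) - (s - Y / u) * (α * (1 / u) * (1 / u ^ α))) / δ) u := by
  have hv0 : 0 < u ^ α := Real.rpow_pos_of_pos hu0 _
  have h1 := (((mu_deriv (Y := Y) (s := s) hu0.ne').const_mul (-2)).div
    (Real.hasDerivAt_rpow_const (p := α) (Or.inl hu0.ne')) hv0.ne').div_const δ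
  refine h1.congr_deriv ?_
  rw [Real.rpow_sub_one hu0.ne']
  congr 1
  field_simp
  ring

lemma cont_mu (Y s : ℝ) : ContinuousOn (fun u : ℝ => (s - Y / u)) (Icc (1/2:ℝ) 2) :=
  fun u hu => (mu_deriv (by linarith [hu.1])).continuousAt.continuousWithinAt

lemma cont_PP (α Y s : ℝ) : ContinuousOn (fun u : ℝ => PP α Y s u) (Icc (1/2:ℝ) 2) :=
  fun u hu => (PP_deriv (by linarith [hu.1])).continuousAt.continuousWithinAt

lemma cont_v (α : ℝ) : ContinuousOn (fun u : ℝ => u ^ α) (Icc (1/2:ℝ) 2) :=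
  fun u hu => (Real.hasDerivAt_rpow_const (p := α) (Or.inl (by linarith [hu.1]))).continuousAt.continuousWithinAt

lemma cont_PPu (α Y s : ℝ) : ContinuousOn (fun u : ℝ => PPu α Y s u) (Icc (1/2:ℝ) 2) := by
  have h1 := cont_mu Y s
  have h2 := cont_v α
  have h3 : ∀ u ∈ Icc (1/2:ℝ) 2, u ≠ 0 := fun u hu => by linarith [hu.1]
  have h4 : ∀ u ∈ Icc (1/2:ℝ) 2, u ^ α ≠ 0 := fun u hu =>
    (Real.rpow_pos_of_pos (by linarith [hu.1]) _).ne'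
  unfold PPu
  refine ContinuousOn.neg (ContinuousOn.sub (ContinuousOn.div (ContinuousOn.mul (by fun_prop) ?_) h2 h4)
    (ContinuousOn.mul (by fun_prop) (ContinuousOn.div (by fun_prop) (by fun_prop) ?_)))
  · exact ContinuousOn.div (by fun_prop) (by fun_prop) fun u hu => pow_ne_zero _ (h3 u hu)
  · exact fun u hu => mul_ne_zero (h3 u hu) (h4 u hu)

lemma sym_rho {α δ : ℝ} {β β' : ℝ → ℝ} {D s Y : ℝ} (hα : α ∈ Icc (1:ℝ) 2) (hδ : δ ∈ Ioo (0:ℝ) 1)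
    (hβ : ∀ x, HasDerivAt β (β' x) x) (hc : Continuous β')
    (hb : ∀ x, |β x| ≤ D) (hb' : ∀ x, |β' x| ≤ D) (hs : ∀ x, 1 < |x| → β' x = 0)
    (hsle : |s| ≤ 1) :
    SymB (fun u => ((β (PP α Y s u / δ) : ℝ) : ℂ)) (600 * D / δ) := by
  have hD : 0 ≤ D := (abs_nonneg _).trans (hb 0)
  obtain ⟨hδ0, hδ1⟩ := hδ
  refine SymB.ofReal (f' := fun u => β' (PP α Y s u / δ) * (PPu α Y s u / δ)) ?_ ?_ ?_ ?_
  · intro u hu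
    exact (hβ _).comp u ((PP_deriv (by linarith [hu.1])).div_const δ)
  · intro u hu
    refine (hb _).trans ?_
    rw [le_div_iff₀ hδ0]; nlinarith
  · intro u hu
    by_cases h : 1 < |PP α Y s u / δ|
    · rw [hs _ h]; simp; positivity
    · push Not at h
      rw [abs_div, abs_of_pos hδ0, div_le_iff₀ hδ0] at h
      have := PPu_bd hα hu hsle (by linarith)
      rw [abs_mul, abs_div, abs_of_pos hδ0]
      calc _ ≤ D * (600 / δ) := by gcongr; exact hb' _
        _ = _ := by ring
  · exact (hc.comp_continuousOn ((cont_PP α Y s).div_const δ)).mul ((cont_PPu α Y s).div_const δ)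

lemma sym_rho2 {α δ : ℝ} {β β' : ℝ → ℝ} {D s Y : ℝ} (hα : α ∈ Icc (1:ℝ) 2) (hδ : δ ∈ Ioo (0:ℝ) 1)
    (hβ : ∀ x, HasDerivAt β (β' x) x) (hc : Continuous β')
    (hb : ∀ x, |β x| ≤ D) (hb' : ∀ x, |β' x| ≤ D) (hs0 : ∀ x, 1 < |x| → β x = 0)
    (hs : ∀ x, 1 < |x| → β' x = 0) (hsle : |s| ≤ 1) :
    SymB (fun u => ((β (PP α Y s u / δ) * (-2 * (s - Y / u) / u ^ α / δ) : ℝ) : ℂ)) (20000 * D / δ ^ 2) := by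
  have hD : 0 ≤ D := (abs_nonneg _).trans (hb 0)
  obtain ⟨hδ0, hδ1⟩ := hδ
  have ha : |α| ≤ 2 := by rw [abs_le]; constructor <;> linarith [hα.1, hα.2]
  have hdd : 1 / δ ≤ 1 / δ ^ 2 := by
    apply one_div_le_one_div_of_le (by positivity); nlinarith
  have hW : ∀ u ∈ Icc (1/2:ℝ) 2, |PP α Y s u / δ| ≤ 1 → |-2 * (s - Y / u) / u ^ α / δ| ≤ 32 * (1 / δ) := by
    intro u hu h
    rw [abs_div, abs_of_pos hδ0, div_le_iff₀ hδ0] at h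
    have hm := PP_mu hα hu (by linarith : |PP α Y s u| ≤ 1)
    have hv1 := inv_v hα hu
    have e : -2 * (s - Y / u) / u ^ α / δ = -2 * (s - Y / u) * (1 / u ^ α) * (1 / δ) := by ring
    rw [e, abs_mul, abs_mul, abs_mul, abs_of_pos (one_div_pos.2 hδ0)]
    calc _ ≤ |(-2:ℝ)| * 4 * 4 * (1 / δ) := by gcongr
      _ = _ := by norm_num
  refine SymB.ofReal (f' := fun u => β' (PP α Y s u / δ) * (PPu α Y s u / δ) * (-2 * (s - Y / u) / u ^ α / δ)
     + β (PP α Y s u / δ) * (-2 * ((Y / u ^ 2) * (1 / u ^ α) - (s - Y / u) * (α * (1 / u) * (1 / u ^ α))) / δ)) ?_ ?_ ?_ ?_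
  · intro u hu
    have hu0 : 0 < u := by linarith [hu.1]
    exact ((hβ _).comp u ((PP_deriv hu0).div_const δ)).mul (W_deriv hu0)
  · intro u hu
    by_cases h : 1 < |PP α Y s u / δ|
    · rw [hs0 _ h]; simp; positivity
    · push Not at h
      have := hW u hu h
      rw [abs_mul]
      calc _ ≤ D * (32 * (1 / δ)) := by gcongr; exact hb _
        _ ≤ D * (20000 * (1 / δ ^ 2)) := by gcongr; norm_num
        _ = _ := by ring
  · intro u hu
    by_cases h : 1 < |PP α Y s u / δ|
    · rw [hs _ h, hs0 _ h]; simp; positivity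
    · push Not at h
      have h1 := hW u hu h
      rw [abs_div, abs_of_pos hδ0, div_le_iff₀ hδ0] at h
      have h' : |PP α Y s u| ≤ 1 := by linarith
      have hP := PPu_bd hα hu hsle h'
      have hm := PP_mu hα hu h'
      have hY := PP_Y hu hsle hm
      have hu1 := inv_u hu
      have hv1 := inv_v hα hu
      have h2 : |-2 * ((Y / u ^ 2) * (1 / u ^ α) - (s - Y / u) * (α * (1 / u) * (1 / u ^ α))) / δ| ≤ 208 * (1 / δ) := by
        rw [abs_div, abs_of_pos hδ0, abs_mul, div_eq_mul_one_div]
        gcongr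
        calc _ ≤ |(-2:ℝ)| * (|(Y / u ^ 2) * (1 / u ^ α)| + |(s - Y / u) * (α * (1 / u) * (1 / u ^ α))|) := by
              gcongr; exact abs_sub _ _
          _ = |(-2:ℝ)| * (|(Y / u ^ 2)| * |(1 / u ^ α)| + |(s - Y / u)| * (|α| * |1 / u| * |1 / u ^ α|)) := by
              simp only [abs_mul]
          _ ≤ |(-2:ℝ)| * (10 * 4 + 4 * (2 * 2 * 4)) := by gcongr
          _ ≤ 208 := by norm_num
      calc _ ≤ |β' (PP α Y s u / δ)| * (|PPu α Y s u| * (1 / δ)) * |-2 * (s - Y / u) / u ^ α / δ| +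
            |β (PP α Y s u / δ)| * |-2 * ((Y / u ^ 2) * (1 / u ^ α) - (s - Y / u) * (α * (1 / u) * (1 / u ^ α))) / δ| := by
            refine (abs_add_le _ _).trans (le_of_eq ?_)
            rw [abs_mul, abs_mul, abs_mul (β (PP α Y s u / δ)), abs_div (PPu α Y s u), abs_of_pos hδ0, div_eq_mul_one_div |PPu α Y s u|]
        _ ≤ D * (600 * (1 / δ)) * (32 * (1 / δ)) + D * (208 * (1 / δ)) := by
            gcongr
            · exact hb' _
            · exact hb _
        _ ≤ D * (600 * (1 / δ)) * (32 * (1 / δ)) + D * (208 * (1 / δ ^ 2)) := by gcongr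
        _ = 19408 * D * (1 / δ ^ 2) := by ring
        _ ≤ 20000 * D * (1 / δ ^ 2) := by gcongr; norm_num
        _ = _ := by ring
  · have h3 : ∀ u ∈ Icc (1/2:ℝ) 2, u ≠ 0 := fun u hu => by linarith [hu.1]
    have h4 : ∀ u ∈ Icc (1/2:ℝ) 2, u ^ α ≠ 0 := fun u hu =>
      (Real.rpow_pos_of_pos (by linarith [hu.1]) _).ne'
    have c1 := cont_mu Y s
    have c2 := cont_v α
    have c3 : ContinuousOn (fun u : ℝ => 1 / u ^ α) (Icc (1/2:ℝ) 2) := continuousOn_const.div c2 h4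
    have c4 : ContinuousOn (fun u : ℝ => 1 / u) (Icc (1/2:ℝ) 2) := continuousOn_const.div continuousOn_id h3
    have c5 : ContinuousOn (fun u : ℝ => Y / u ^ 2) (Icc (1/2:ℝ) 2) := continuousOn_const.div (by fun_prop)
      (fun u hu => pow_ne_zero 2 (h3 u hu))
    have cb : Continuous β := continuous_iff_continuousAt.2 fun x => (hβ x).continuousAt
    have c6 := hc.comp_continuousOn ((cont_PP α Y s).div_const δ)
    have c7 := cb.comp_continuousOn ((cont_PP α Y s).div_const δ)
    have c8 := (cont_PPu α Y s).div_const δ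
    have c9 : ContinuousOn (fun u : ℝ => -2 * (s - Y / u) / u ^ α) (Icc (1/2:ℝ) 2) :=
      ContinuousOn.div (by fun_prop) c2 h4
    refine ((c6.mul c8).mul (c9.div_const δ)).add (c7.mul (ContinuousOn.div_const (ContinuousOn.mul (by fun_prop) ?_) δ))
    exact (c5.mul c3).sub (c1.mul ((continuousOn_const.mul c4).mul c3))

structure Dat (κ ρ : ℝ → ℝ) (D : ℝ) : Prop where
  k1 : ∀ x, HasDerivAt κ (deriv κ x) x
  k2 : ∀ x, HasDerivAt (deriv κ) (deriv (deriv κ) x) x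
  kc : Continuous (deriv (deriv κ))
  kb0 : ∀ x, |κ x| ≤ D
  kb1 : ∀ x, |deriv κ x| ≤ D
  kb2 : ∀ x, |deriv (deriv κ) x| ≤ D
  ks0 : ∀ x, 5/3 < |x| → κ x = 0
  ks1 : ∀ x, 5/3 < |x| → deriv κ x = 0
  ks2 : ∀ x, 5/3 < |x| → deriv (deriv κ) x = 0
  r1 : ∀ x, HasDerivAt ρ (deriv ρ x) x
  r2 : ∀ x, HasDerivAt (deriv ρ) (deriv (deriv ρ) x) x
  rc : Continuous (deriv (deriv ρ))
  rb0 : ∀ x, |ρ x| ≤ D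
  rb1 : ∀ x, |deriv ρ x| ≤ D
  rb2 : ∀ x, |deriv (deriv ρ) x| ≤ D
  rs1 : ∀ x, 1 < |x| → deriv ρ x = 0
  rs2 : ∀ x, 1 < |x| → deriv (deriv ρ) x = 0
  rz : ∀ x, |x| < 1/2 → ρ x = 0
  rz1 : ∀ x, |x| < 1/2 → deriv ρ x = 0

def GG (α δ : ℝ) (κ ρ : ℝ → ℝ) (Y R s u : ℝ) : ℝ := κ ((s - Y / u) / R) * ρ (PP α Y s u / δ)

def GS (α δ : ℝ) (κ ρ : ℝ → ℝ) (Y R s u : ℝ) : ℝ :=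
  deriv κ ((s - Y / u) / R) * (1 / R) * ρ (PP α Y s u / δ) +
    κ ((s - Y / u) / R) * (deriv ρ (PP α Y s u / δ) * (-2 * (s - Y / u) / u ^ α / δ))

def AA (α δ : ℝ) (κ ρ : ℝ → ℝ) (T Y R s u : ℝ) : ℂ :=
  qq T s u * (2 * (1 - qq T s u) * (GG α δ κ ρ Y R s u : ℂ) - (s : ℂ) * (GS α δ κ ρ Y R s u : ℂ))

def ph (α T x Y s u : ℝ) : ℝ := T * (u * u ^ α) + x * u - T * Y ^ 2 / u + T * u * s ^ 2

lemma sym_AA {α δ D : ℝ} {κ ρ : ℝ → ℝ} (hα : α ∈ Icc (1:ℝ) 2) (hδ : δ ∈ Ioo (0:ℝ) 1)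
    (h : Dat κ ρ D) : ∃ K > 0, ∀ T Y R s : ℝ, 1 ≤ R → |s| ≤ 1 →
      SymB (fun u => AA α δ κ ρ T Y R s u) (K / (1 + |T| * s ^ 2)) := by
  have hD : 0 ≤ D := (abs_nonneg _).trans (h.kb0 0)
  have hδ0 := hδ.1
  set KG : ℝ := 2 * (6 * D) * (600 * D / δ) with hKG
  set KS : ℝ := 2 * (2 * (6 * D) * 1) * (600 * D / δ) + 2 * (6 * D) * (20000 * D / δ ^ 2) with hKS
  set KI : ℝ := 2 * (2 * 2 * 9) * KG + 2 * 1 * KS with hKI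
  have hKI0 : 0 ≤ KI := by positivity
  refine ⟨2 * 8 * KI + 1, by positivity, fun T Y R s hR hs => ?_⟩
  have cR : SymB (fun _ => ((1 / R : ℝ) : ℂ)) 1 := (SymB.const _).mono (by
    rw [Complex.norm_real, Real.norm_eq_abs, abs_of_pos (by positivity), div_le_one (by linarith)]; exact hR)
  have cs : SymB (fun _ => (s : ℂ)) 1 := (SymB.const _).mono (by simpa using hs)
  have c2 : SymB (fun _ => (2 : ℂ)) 2 := (SymB.const _).mono (by simp)
  have c1 : SymB (fun _ => (1 : ℂ)) 1 := (SymB.const _).mono (by simp)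
  have k0 := sym_cut (Y := Y) (β := κ) h.k1 (continuous_iff_continuousAt.2 fun x => (h.k2 x).continuousAt) h.kb0 h.kb1 h.ks1 hs hR
  have k1 := sym_cut (Y := Y) (β := deriv κ) h.k2 h.kc h.kb1 h.kb2 h.ks2 hs hR
  have r0 := sym_rho (Y := Y) hα hδ h.r1 (continuous_iff_continuousAt.2 fun x => (h.r2 x).continuousAt) h.rb0 h.rb1 h.rs1 hs
  have r1 := sym_rho2 (Y := Y) hα hδ h.r2 h.rc h.rb1 h.rb2 h.rs1 h.rs2 hs
  have hG : SymB (fun u => (GG α δ κ ρ Y R s u : ℂ)) KG := by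
    have := k0.mul r0
    simpa only [GG, Complex.ofReal_mul] using this
  have hS : SymB (fun u => (GS α δ κ ρ Y R s u : ℂ)) KS := by
    have := ((k1.mul cR).mul r0).add (k0.mul r1)
    simpa only [GS, Complex.ofReal_mul, Complex.ofReal_add] using this
  have hq := sym_qq T s
  have hp : 0 ≤ |T| * s ^ 2 := by positivity
  have h1q := (c1.sub hq).mono (show 1 + 8 / (1 + |T| * s ^ 2) ≤ 9 by
    have : 8 / (1 + |T| * s ^ 2) ≤ 8 := div_le_self (by norm_num) (by linarith)
    linarith)
  have hI := ((c2.mul h1q).mul hG).sub (cs.mul hS)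
  refine (hq.mul hI).mono ?_
  rw [mul_div_assoc', div_mul_eq_mul_div]
  gcongr
  linarith

lemma AA_ne {α δ D : ℝ} {κ ρ : ℝ → ℝ} (hδ : δ ∈ Ioo (0:ℝ) 1)
    (h : Dat κ ρ D) {T Y R s u : ℝ} (hA : AA α δ κ ρ T Y R s u ≠ 0) : δ / 2 ≤ |PP α Y s u| := by
  by_contra hc
  push Not at hc
  have : |PP α Y s u / δ| < 1/2 := by
    rw [abs_div, abs_of_pos hδ.1, div_lt_iff₀ hδ.1]; linarith
  apply hA
  simp [AA, GG, GS, h.rz _ this, h.rz1 _ this]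

lemma low_bd {α δ : ℝ} (hα : α ∈ Icc (1:ℝ) 2) (hδ : δ ∈ Ioo (0:ℝ) 1) {Y s u : ℝ}
    (hs : |s| ≤ δ / 400) (hu : u ∈ Icc (1/2:ℝ) 2) (hP : δ / 2 ≤ |PP α Y s u|) :
    δ / 16 ≤ |α * (α + 1) / 2 * u ^ α - (Y / u) ^ 2| := by
  obtain ⟨hv1, hv2⟩ := rpow_bds hα hu
  obtain ⟨hB1, hB2⟩ := B_bds hα
  obtain ⟨hδ0, hδ1⟩ := hδ
  unfold PP at hP
  set m := s - Y / u with hm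
  have hY : Y / u = s - m := by rw [hm]; ring
  rw [hY]
  set v := u ^ α
  set B := α * (α + 1) / 2
  have hX : δ / 8 ≤ |B * v - m ^ 2| := by
    have e : B * v - m ^ 2 = (B - m ^ 2 / v) * v := by field_simp
    rw [e, abs_mul, abs_of_pos (by linarith : 0 < v)]
    calc δ / 8 = δ / 2 * (1 / 4) := by ring
      _ ≤ _ := by gcongr
  by_cases hm10 : |m| ≤ 10
  · have e : B * v - (s - m) ^ 2 = (B * v - m ^ 2) - s * (s - 2 * m) := by ring
    have h1 : |s * (s - 2 * m)| ≤ δ / 400 * 21 := by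
      rw [abs_mul]
      gcongr
      calc _ ≤ |s| + |2 * m| := abs_sub _ _
        _ ≤ 1 + 2 * 10 := by rw [abs_mul]; norm_num; linarith
        _ = 21 := by norm_num
    rw [e]
    have := abs_sub_abs_le_abs_sub (B * v - m ^ 2) (s * (s - 2 * m))
    linarith
  · push Not at hm10
    have h9 : 9 ≤ |s - m| := by
      have := abs_sub_abs_le_abs_sub m s
      rw [abs_sub_comm m s] at this
      linarith
    have h81 : 81 ≤ (s - m) ^ 2 := by rw [← sq_abs]; nlinarith
    have : B * v ≤ 12 := by nlinarith
    rw [abs_of_nonpos (by linarith)]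
    linarith

lemma sign_split (h : ℝ → ℝ) (hm : MonotoneOn h (Icc (1/2:ℝ) 2)) (hc : ContinuousOn h (Icc (1/2:ℝ) 2)) :
    ∃ z ∈ Icc (1/2:ℝ) 2, ((∀ u ∈ Icc (1/2) z, 0 ≤ h u) ∨ (∀ u ∈ Icc (1/2) z, h u ≤ 0)) ∧
      ((∀ u ∈ Icc z 2, 0 ≤ h u) ∨ (∀ u ∈ Icc z 2, h u ≤ 0)) := by
  have l : (1/2:ℝ) ∈ Icc (1/2:ℝ) 2 := by norm_num
  have r : (2:ℝ) ∈ Icc (1/2:ℝ) 2 := by norm_num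
  by_cases h1 : 0 ≤ h (1/2)
  · refine ⟨1/2, l, Or.inl fun u hu => ?_, Or.inl fun u hu => h1.trans (hm l hu hu.1)⟩
    have : u = 1/2 := le_antisymm hu.2 hu.1
    rwa [this]
  by_cases h2 : h 2 ≤ 0
  · refine ⟨2, r, Or.inr fun u hu => (hm hu r hu.2).trans h2, Or.inr fun u hu => ?_⟩
    have : u = 2 := le_antisymm hu.2 hu.1
    rwa [this]
  push Not at h1 h2
  obtain ⟨z, hz, hz0⟩ := intermediate_value_Icc (by norm_num : (1/2:ℝ) ≤ 2) hc ⟨h1.le, h2.le⟩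
  refine ⟨z, hz, Or.inr fun u hu => ?_, Or.inl fun u hu => ?_⟩
  · rw [← hz0]; exact hm ⟨hu.1, hu.2.trans hz.2⟩ hz hu.2
  · rw [← hz0]; exact hm hz ⟨hz.1.trans hu.1, hu.2⟩ hu.1

lemma small_s {α δ D Kf : ℝ} {κ ρ : ℝ → ℝ} {f : ℝ → ℂ} (hα : α ∈ Icc (1:ℝ) 2) (hδ : δ ∈ Ioo (0:ℝ) 1)
    (h : Dat κ ρ D) (hf : SymB f Kf) : ∃ K > 0, ∀ T x Y R s : ℝ, T ≠ 0 → 1 ≤ R → |s| ≤ δ / 400 →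
      ‖∫ u in (1/2:ℝ)..2, Complex.exp (Complex.I * (ph α T x Y s u : ℂ)) * (AA α δ κ ρ T Y R s u * f u)‖
        ≤ K / √|T| * (1 / (1 + |T| * s ^ 2)) := by
  obtain ⟨K, hK, hA⟩ := sym_AA hα hδ h
  have hKf := hf.nonneg
  have hδ0 := hδ.1
  have hδ1 := hδ.2
  refine ⟨20 * (2 * K * Kf) / √(δ / 16) + 1, by positivity, fun T x Y R s hT hR hs => ?_⟩
  obtain ⟨b', hb, hbc⟩ := (hA T Y R s hR (by linarith)).mul hf
  have hT0 : 0 < |T| := abs_pos.2 hT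
  set hh : ℝ → ℝ := fun u => α * (α + 1) / 2 * u ^ α - (Y / u) ^ 2 with hhh
  have u0 : ∀ u ∈ Icc (1/2:ℝ) 2, 0 < u := fun u hu => by linarith [hu.1]
  have c2 := cont_v α
  have c4 : ContinuousOn (fun u : ℝ => Y / u) (Icc (1/2:ℝ) 2) :=
    continuousOn_const.div continuousOn_id (fun u hu => (u0 u hu).ne')
  have c5 : ContinuousOn (fun u : ℝ => 2 * T / u) (Icc (1/2:ℝ) 2) :=
    continuousOn_const.div continuousOn_id (fun u hu => (u0 u hu).ne')
  have chh : ContinuousOn hh (Icc (1/2:ℝ) 2) := by fun_prop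
  have mhh : MonotoneOn hh (Icc (1/2:ℝ) 2) := by
    intro a ha b hb hab
    have ha0 := u0 a ha
    have hb0 := u0 b hb
    have e1 : a ^ α ≤ b ^ α := Real.rpow_le_rpow ha0.le hab (by linarith [hα.1])
    have e2 : (Y / b) ^ 2 ≤ (Y / a) ^ 2 := by
      rw [div_pow, div_pow]
      gcongr
    have := (B_bds hα).1
    simp only [hhh]
    gcongr
  obtain ⟨z, hz, hz1, hz2⟩ := sign_split hh mhh chh
  have trans : ∀ a b : ℝ, Icc a b ⊆ Icc (1/2:ℝ) 2 → ((∀ u ∈ Icc a b, 0 ≤ hh u) ∨ (∀ u ∈ Icc a b, hh u ≤ 0)) →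
      ((∀ u ∈ Icc a b, 0 ≤ 2 * T / u * hh u) ∨ (∀ u ∈ Icc a b, 2 * T / u * hh u ≤ 0)) := by
    intro a b hab hor
    rcases lt_or_gt_of_ne hT with hT | hT
    · have n : ∀ u ∈ Icc a b, 2 * T / u ≤ 0 := fun u hu =>
        div_nonpos_of_nonpos_of_nonneg (by linarith) (u0 u (hab hu)).le
      rcases hor with hor | hor
      · exact Or.inr fun u hu => mul_nonpos_of_nonpos_of_nonneg (n u hu) (hor u hu)
      · exact Or.inl fun u hu => mul_nonneg_of_nonpos_of_nonpos (n u hu) (hor u hu)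
    · have n : ∀ u ∈ Icc a b, 0 ≤ 2 * T / u := fun u hu =>
        div_nonneg (by linarith) (u0 u (hab hu)).le
      rcases hor with hor | hor
      · exact Or.inl fun u hu => mul_nonneg (n u hu) (hor u hu)
      · exact Or.inr fun u hu => mul_nonpos_of_nonneg_of_nonpos (n u hu) (hor u hu)
  have main := vdc (fun u => ph α T x Y s u)
    (fun u => T * (α + 1) * u ^ α + x + T * Y ^ 2 / u ^ 2 + T * s ^ 2)
    (fun u => 2 * T / u * hh u) (fun u => AA α δ κ ρ T Y R s u * f u) b' (|T| * (δ / 16)) z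
    (2 * (K / (1 + |T| * s ^ 2)) * Kf) (by positivity) hz ?_ ?_ (c5.mul chh)
    (trans _ _ (Icc_subset_Icc_right hz.2) hz1) (trans _ _ (Icc_subset_Icc_left hz.1) hz2)
    (fun u hu => (hb u hu).1) hbc (fun u hu => (hb u hu).2.1) (fun u hu => (hb u hu).2.2) ?_
  · refine main.trans ?_
    rw [Real.sqrt_mul hT0.le]
    have : 0 < √|T| := Real.sqrt_pos.2 hT0
    have : 0 < √(δ / 16) := Real.sqrt_pos.2 (by linarith)
    calc _ = (20 * (2 * K * Kf) / √(δ / 16)) / √|T| * (1 / (1 + |T| * s ^ 2)) := by field_simp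
      _ ≤ _ := by gcongr; linarith
  · intro u hu
    have hu0 := u0 u hu
    have d1 := Real.hasDerivAt_rpow_const (x := u) (p := α) (Or.inl hu0.ne')
    have d2 := ((hasDerivAt_id u).mul d1).const_mul T
    have d3 := (hasDerivAt_id u).const_mul x
    have d4 := (hasDerivAt_inv hu0.ne').const_mul (T * Y ^ 2)
    have d5 := ((hasDerivAt_id u).const_mul T).mul_const (s ^ 2)
    have d6 := ((d2.add d3).sub d4).add d5
    refine (d6.congr_deriv ?_).congr_of_eventuallyEq (Filter.Eventually.of_forall fun v => ?_)
    · rw [Real.rpow_sub_one hu0.ne']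
      simp only [id]
      field_simp
      ring
    · simp [ph, div_eq_mul_inv]
  · intro u hu
    have hu0 := u0 u hu
    have d1 := (Real.hasDerivAt_rpow_const (x := u) (p := α) (Or.inl hu0.ne')).const_mul (T * (α + 1))
    have d4 := ((hasDerivAt_pow 2 u).inv (pow_ne_zero 2 hu0.ne')).const_mul (T * Y ^ 2)
    have d6 := ((d1.add_const x).add d4).add_const (T * s ^ 2)
    refine (d6.congr_deriv ?_).congr_of_eventuallyEq (Filter.Eventually.of_forall fun v => ?_)
    · rw [Real.rpow_sub_one hu0.ne']
      simp only [hhh]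
      push_cast
      field_simp
      ring
    · simp [div_eq_mul_inv]
  · intro u hu hne
    have hu0 := u0 u hu
    have := low_bd hα hδ hs hu (AA_ne hδ h (left_ne_zero_of_mul hne))
    simp only [abs_mul, abs_div]
    rw [abs_of_pos hu0, abs_of_pos (by norm_num : (0:ℝ) < 2)]
    have h2 : |T| ≤ 2 * |T| / u := by
      rw [le_div_iff₀ hu0]; nlinarith [hu.2]
    gcongr

lemma nexp (r : ℝ) : ‖Complex.exp (Complex.I * (r : ℂ))‖ = 1 := by
  rw [mul_comm]; exact Complex.norm_exp_ofReal_mul_I r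

lemma qq_deriv_s (T u s : ℝ) : HasDerivAt (fun s => qq T s u)
    (-(4 * Complex.I * ((T * u * s : ℝ) : ℂ)) * (qq T s u) ^ 2) s := by
  have h1 : HasDerivAt (fun s : ℝ => T * s ^ 2 * u) (T * (2 * s) * u) s := by
    simpa using ((hasDerivAt_pow 2 s).const_mul T).mul_const u
  have h2 := ((h1.ofReal_comp.const_mul (2 * Complex.I)).const_add 1)
  have := h2.inv (qq_ne _)
  refine (this.congr_deriv ?_).congr_of_eventuallyEq (Filter.Eventually.of_forall fun v => ?_)
  · simp only [qq]
    have := qq_ne (T * s ^ 2 * u)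
    push_cast at this ⊢
    field_simp
    ring
  · simp [qq]

lemma GG_deriv_s {α δ D : ℝ} {κ ρ : ℝ → ℝ} (h : Dat κ ρ D) (Y R s u : ℝ) :
    HasDerivAt (fun s => GG α δ κ ρ Y R s u) (GS α δ κ ρ Y R s u) s := by
  have h1 : HasDerivAt (fun s : ℝ => (s - Y / u) / R) (1 / R) s :=
    ((hasDerivAt_id s).sub_const _).div_const R
  have h2 : HasDerivAt (fun s : ℝ => PP α Y s u / δ) (-2 * (s - Y / u) / u ^ α / δ) s := by
    have := ((((((hasDerivAt_id s).sub_const (Y / u)).pow 2).div_const (u ^ α)).const_sub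
      (α * (α + 1) / 2)).div_const δ)
    refine this.congr_deriv ?_
    simp only [id]
    ring
  exact ((h.k1 _).comp s h1).mul ((h.r1 _).comp s h2)

lemma cont_GG {α δ D : ℝ} {κ ρ : ℝ → ℝ} (h : Dat κ ρ D) (Y R u : ℝ) :
    Continuous (fun s => GG α δ κ ρ Y R s u) :=
  continuous_iff_continuousAt.2 fun s => (GG_deriv_s h Y R s u).continuousAt

lemma cont_qq (T u : ℝ) : Continuous (fun s => qq T s u) :=
  continuous_iff_continuousAt.2 fun s => (qq_deriv_s T u s).continuousAt

lemma Dat.ck {D : ℝ} {κ ρ : ℝ → ℝ} (h : Dat κ ρ D) : Continuous κ :=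
  continuous_iff_continuousAt.2 fun s => (h.k1 s).continuousAt
lemma Dat.ck' {D : ℝ} {κ ρ : ℝ → ℝ} (h : Dat κ ρ D) : Continuous (deriv κ) :=
  continuous_iff_continuousAt.2 fun s => (h.k2 s).continuousAt
lemma Dat.cr {D : ℝ} {κ ρ : ℝ → ℝ} (h : Dat κ ρ D) : Continuous ρ :=
  continuous_iff_continuousAt.2 fun s => (h.r1 s).continuousAt
lemma Dat.cr' {D : ℝ} {κ ρ : ℝ → ℝ} (h : Dat κ ρ D) : Continuous (deriv ρ) :=
  continuous_iff_continuousAt.2 fun s => (h.r2 s).continuousAt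

lemma cont_GS {α δ D : ℝ} {κ ρ : ℝ → ℝ} (h : Dat κ ρ D) (Y R u : ℝ) :
    Continuous (fun s => GS α δ κ ρ Y R s u) := by
  have a := h.ck
  have b := h.ck'
  have c := h.cr
  have d := h.cr'
  unfold GS PP
  fun_prop

lemma cont_AA {α δ D : ℝ} {κ ρ : ℝ → ℝ} (h : Dat κ ρ D) (T Y R u : ℝ) :
    Continuous (fun s => AA α δ κ ρ T Y R s u) := by
  have a := cont_GG (α := α) (δ := δ) h Y R u
  have b := cont_GS (α := α) (δ := δ) h Y R u
  have c := cont_qq T u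
  unfold AA
  fun_prop

lemma cut_zero {R s c : ℝ} (hR : 1 ≤ R) (hs : s ∉ Icc (c - 5/3 * R) (c + 5/3 * R)) :
    5/3 < |(s - c) / R| := by
  have hR0 : 0 < R := by linarith
  rw [abs_div, abs_of_pos hR0, lt_div_iff₀ hR0]
  by_contra hc
  push Not at hc
  rw [abs_le] at hc
  exact hs ⟨by linarith [hc.1], by linarith [hc.2]⟩

lemma GG_zero {α δ D : ℝ} {κ ρ : ℝ → ℝ} (h : Dat κ ρ D) {Y R s u : ℝ} (hR : 1 ≤ R)
    (hs : s ∉ Icc (Y / u - 5/3 * R) (Y / u + 5/3 * R)) :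
    GG α δ κ ρ Y R s u = 0 ∧ GS α δ κ ρ Y R s u = 0 := by
  have := cut_zero hR hs
  simp [GG, GS, h.ks0 _ this, h.ks1 _ this]

lemma AA_zero {α δ D : ℝ} {κ ρ : ℝ → ℝ} (h : Dat κ ρ D) {T Y R s u : ℝ} (hR : 1 ≤ R)
    (hs : s ∉ Icc (Y / u - 5/3 * R) (Y / u + 5/3 * R)) : AA α δ κ ρ T Y R s u = 0 := by
  have := GG_zero (α := α) (δ := δ) h hR hs
  simp [AA, this.1, this.2]

lemma int_cs {g : ℝ → ℂ} (hg : Continuous g) {a b : ℝ} (h : ∀ s, s ∉ Icc a b → g s = 0) :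
    Integrable g :=
  hg.integrable_of_hasCompactSupport (HasCompactSupport.intro isCompact_Icc h)

lemma int_AA {α δ D : ℝ} {κ ρ : ℝ → ℝ} (h : Dat κ ρ D) {T x Y R u : ℝ} (hR : 1 ≤ R) :
    Integrable (fun s => Complex.exp (Complex.I * (ph α T x Y s u : ℂ)) * AA α δ κ ρ T Y R s u) := by
  have c := cont_AA (α := α) (δ := δ) h T Y R u
  apply int_cs (a := Y / u - 5/3 * R) (b := Y / u + 5/3 * R)
  · unfold ph; fun_prop
  · intro s hs; rw [AA_zero h hR hs, mul_zero]

lemma ibp {α δ D : ℝ} {κ ρ : ℝ → ℝ} (h : Dat κ ρ D) {T x Y R u : ℝ} (hR : 1 ≤ R) :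
    ∫ s, Complex.exp (Complex.I * (ph α T x Y s u : ℂ)) * (GG α δ κ ρ Y R s u : ℂ) =
    ∫ s, Complex.exp (Complex.I * (ph α T x Y s u : ℂ)) * AA α δ κ ρ T Y R s u := by
  have cG := cont_GG (α := α) (δ := δ) h Y R u
  have cA := cont_AA (α := α) (δ := δ) h T Y R u
  have cq := cont_qq T u
  have i1 : Integrable (fun s => Complex.exp (Complex.I * (ph α T x Y s u : ℂ)) * (GG α δ κ ρ Y R s u : ℂ)) := by
    apply int_cs (a := Y / u - 5/3 * R) (b := Y / u + 5/3 * R)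
    · unfold ph; fun_prop
    · intro s hs; rw [(GG_zero h hR hs).1]; simp
  have i2 := int_AA (α := α) (δ := δ) (T := T) (x := x) (Y := Y) (u := u) h hR
  have i3 : Integrable (fun s => Complex.exp (Complex.I * (ph α T x Y s u : ℂ)) * ((s : ℂ) * qq T s u * (GG α δ κ ρ Y R s u : ℂ))) := by
    apply int_cs (a := Y / u - 5/3 * R) (b := Y / u + 5/3 * R)
    · unfold ph; fun_prop
    · intro s hs; rw [(GG_zero h hR hs).1]; simp
  have hd : ∀ s, HasDerivAt (fun s => Complex.exp (Complex.I * (ph α T x Y s u : ℂ)) * ((s : ℂ) * qq T s u * (GG α δ κ ρ Y R s u : ℂ)))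
      (Complex.exp (Complex.I * (ph α T x Y s u : ℂ)) * (GG α δ κ ρ Y R s u : ℂ) -
        Complex.exp (Complex.I * (ph α T x Y s u : ℂ)) * AA α δ κ ρ T Y R s u) s := by
    intro s
    have d0 : HasDerivAt (fun s => ph α T x Y s u) (T * u * (2 * s)) s := by
      unfold ph
      simpa using ((hasDerivAt_pow 2 s).const_mul (T * u)).const_add (T * (u * u ^ α) + x * u - T * Y ^ 2 / u)
    have d1 := (d0.ofReal_comp.const_mul Complex.I).cexp
    have d2 := (((hasDerivAt_id s).ofReal_comp).mul (qq_deriv_s T u s)).mul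
      (GG_deriv_s (α := α) (δ := δ) h Y R s u).ofReal_comp
    refine (d1.mul d2).congr_deriv ?_
    simp only [AA, Pi.mul_apply, id]
    have e : (1 + 2 * Complex.I * ((T * s ^ 2 * u : ℝ) : ℂ)) * qq T s u = 1 := by
      unfold qq; have := qq_ne (T * s ^ 2 * u); field_simp
    push_cast at e ⊢
    set q := qq T s u
    set G := (GG α δ κ ρ Y R s u : ℂ)
    set E := Complex.exp (Complex.I * (ph α T x Y s u : ℂ))
    linear_combination (E * G * (1 - 2 * q)) * e
  have := integral_eq_zero_of_hasDerivAt_of_integrable hd (i1.sub i2) i3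
  rw [integral_sub i1 i2] at this
  exact sub_eq_zero.1 this

def EE (α δ : ℝ) (κ ρ : ℝ → ℝ) (T x y R u m : ℝ) : ℂ :=
  Complex.exp (Complex.I * ((T * (u * (u ^ α + m ^ 2)) + x * u + y * m : ℝ) : ℂ)) *
    ((κ (m / R) * ρ ((α * (α + 1) / 2 - m ^ 2 / u ^ α) / δ) : ℝ) : ℂ)

lemma inner_eq {α δ D : ℝ} {κ ρ : ℝ → ℝ} (h : Dat κ ρ D) {T x y R u : ℝ} (hT : T ≠ 0) (hR : 1 ≤ R)
    (hu : u ≠ 0) :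
    ∫ m, EE α δ κ ρ T x y R u m =
    ∫ s, Complex.exp (Complex.I * (ph α T x (y / (2 * T)) s u : ℂ)) * AA α δ κ ρ T (y / (2 * T)) R s u := by
  rw [← ibp h hR, ← integral_sub_right_eq_self (μ := volume) _ (y / (2 * T) / u)]
  congr 1
  ext s
  unfold EE GG PP ph
  congr 4
  field_simp
  ring

lemma GS_bd {α δ D : ℝ} {κ ρ : ℝ → ℝ} (hα : α ∈ Icc (1:ℝ) 2) (hδ : δ ∈ Ioo (0:ℝ) 1)
    (h : Dat κ ρ D) {Y R u : ℝ} (hR : 1 ≤ R) (hu : u ∈ Icc (1/2:ℝ) 2) (s : ℝ) :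
    |GS α δ κ ρ Y R s u| ≤ (Icc (Y / u - 5/3 * R) (Y / u + 5/3 * R)).indicator (fun _ => D ^ 2 / R) s +
      (Icc (Y / u - 4) (Y / u + 4)).indicator (fun _ => 32 * D ^ 2 / δ) s := by
  have hD : 0 ≤ D := (abs_nonneg _).trans (h.kb0 0)
  obtain ⟨hδ0, hδ1⟩ := hδ
  have hR0 : 0 < R := by linarith
  unfold GS
  refine (abs_add_le _ _).trans (add_le_add ?_ ?_)
  · by_cases hs : s ∈ Icc (Y / u - 5/3 * R) (Y / u + 5/3 * R)
    · rw [indicator_of_mem hs, abs_mul, abs_mul, abs_of_pos (one_div_pos.2 hR0)]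
      calc _ ≤ D * (1 / R) * D := by gcongr; exacts [h.kb1 _, h.rb0 _]
        _ = _ := by ring
    · rw [indicator_of_notMem hs, h.ks1 _ (cut_zero hR hs)]; simp
  · by_cases hP : 1 < |PP α Y s u / δ|
    · rw [h.rs1 _ hP]
      simp only [zero_mul, mul_zero, abs_zero]
      exact indicator_nonneg (fun _ _ => by positivity) _
    · push Not at hP
      rw [abs_div, abs_of_pos hδ0, div_le_iff₀ hδ0] at hP
      have hm := PP_mu hα hu (by linarith : |PP α Y s u| ≤ 1)
      have hv1 := inv_v hα hu
      have hs : s ∈ Icc (Y / u - 4) (Y / u + 4) := by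
        rw [abs_le] at hm; exact ⟨by linarith [hm.1], by linarith [hm.2]⟩
      rw [indicator_of_mem hs]
      have e : -2 * (s - Y / u) / u ^ α / δ = -2 * (s - Y / u) * (1 / u ^ α) * (1 / δ) := by ring
      rw [abs_mul, abs_mul, e, abs_mul, abs_mul, abs_mul, abs_of_pos (one_div_pos.2 hδ0)]
      calc _ ≤ D * (D * (|(-2:ℝ)| * 4 * 4 * (1 / δ))) := by gcongr; exacts [h.kb0 _, h.rb1 _]
        _ = _ := by norm_num; ring

lemma large_s {α δ D : ℝ} {κ ρ : ℝ → ℝ} (hα : α ∈ Icc (1:ℝ) 2) (hδ : δ ∈ Ioo (0:ℝ) 1)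
    (h : Dat κ ρ D) (ε : ℝ) (hε : 0 < ε) : ∃ K > 0, ∀ T x Y R u : ℝ, T ≠ 0 → 1 ≤ R → u ∈ Icc (1/2:ℝ) 2 →
      ‖∫ s in (Icc (-ε) ε)ᶜ, Complex.exp (Complex.I * (ph α T x Y s u : ℂ)) * AA α δ κ ρ T Y R s u‖
        ≤ K / |T| := by
  have hD : 0 ≤ D := (abs_nonneg _).trans (h.kb0 0)
  have hδ0 := hδ.1
  refine ⟨4 * D ^ 2 * (1 / ε ^ 2 + 1) * Real.pi + (1 / ε) * (D ^ 2 * (10 / 3) + 256 * D ^ 2 / δ) + 1,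
    by positivity, fun T x Y R u hT hR hu => ?_⟩
  have hT0 : 0 < |T| := abs_pos.2 hT
  have hR0 : 0 < R := by linarith
  set i1 : ℝ → ℝ := (Icc (Y / u - 5/3 * R) (Y / u + 5/3 * R)).indicator (fun _ => D ^ 2 / R) with hi1
  set i2 : ℝ → ℝ := (Icc (Y / u - 4) (Y / u + 4)).indicator (fun _ => 32 * D ^ 2 / δ) with hi2
  have n1 : ∀ s, 0 ≤ i1 s := fun s => indicator_nonneg (fun _ _ => by positivity) _
  have n2 : ∀ s, 0 ≤ i2 s := fun s => indicator_nonneg (fun _ _ => by positivity) _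
  have I1 : Integrable i1 := (integrable_indicator_iff measurableSet_Icc).2 (by
    exact integrableOn_const (by simp))
  have I2 : Integrable i2 := (integrable_indicator_iff measurableSet_Icc).2 (by
    exact integrableOn_const (by simp))
  have v1 : ∫ s, i1 s = D ^ 2 * (10 / 3) := by
    rw [hi1, integral_indicator measurableSet_Icc, setIntegral_const]
    simp only [Measure.real, Real.volume_Icc, smul_eq_mul]
    rw [ENNReal.toReal_ofReal (by linarith)]
    field_simp; ring
  have v2 : ∫ s, i2 s = 256 * D ^ 2 / δ := by
    rw [hi2, integral_indicator measurableSet_Icc, setIntegral_const]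
    simp only [Measure.real, Real.volume_Icc, smul_eq_mul]
    rw [ENNReal.toReal_ofReal (by linarith)]
    field_simp; ring
  set Φ : ℝ → ℝ := fun s => (1 / |T|) * (4 * D ^ 2 * (1 / ε ^ 2 + 1) * (1 + s ^ 2)⁻¹ + (1 / ε) * (i1 s + i2 s)) with hΦ
  have IA := (integrable_inv_one_add_sq.const_mul (4 * D ^ 2 * (1 / ε ^ 2 + 1)))
  have IB : Integrable (fun s => (1 / ε) * (i1 s + i2 s)) := (I1.add I2).const_mul (1 / ε)
  have IΦ : Integrable Φ := (IA.add IB).const_mul (1 / |T|)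
  have vΦ : ∫ s, Φ s = (1 / |T|) * (4 * D ^ 2 * (1 / ε ^ 2 + 1) * Real.pi + (1 / ε) * (D ^ 2 * (10 / 3) + 256 * D ^ 2 / δ)) := by
    rw [hΦ, integral_const_mul]
    congr 1
    rw [integral_add IA IB, integral_const_mul, integral_const_mul, integral_univ_inv_one_add_sq]
    congr 2
    rw [← v1, ← v2]
    exact integral_add I1 I2
  have nΦ : ∀ s, 0 ≤ Φ s := fun s => by
    have := n1 s
    have := n2 s
    simp only [hΦ]; positivity
  have bd : ∀ s ∈ (Icc (-ε) ε)ᶜ, ‖Complex.exp (Complex.I * (ph α T x Y s u : ℂ)) * AA α δ κ ρ T Y R s u‖ ≤ Φ s := by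
    intro s hs
    have hs1 : ε < |s| := by
      by_contra hc
      push Not at hc
      exact hs (abs_le.1 hc)
    have hs0 : 0 < |s| := hε.trans hs1
    have hss : s ^ 2 = |s| ^ 2 := (sq_abs s).symm
    rw [norm_mul, nexp, one_mul, AA, norm_mul]
    have hq1 := qq_norm_le_one T s u
    have hq := qq_norm_le (T := T) (s := s) hu.1
    have hg : ‖(GG α δ κ ρ Y R s u : ℂ)‖ ≤ D ^ 2 := by
      rw [Complex.norm_real, Real.norm_eq_abs, GG, abs_mul, sq]
      gcongr; exacts [h.kb0 _, h.rb0 _]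
    have hgs := GS_bd hα hδ h (Y := Y) hR hu s
    have hs2 : 0 < s ^ 2 := by rw [hss]; positivity
    have hq2 : ‖qq T s u‖ ≤ (1 / |T|) * (1 / s ^ 2) := by
      rw [one_div_mul_one_div, le_div_iff₀ (by positivity)]; exact hq
    have hqm : ‖1 - qq T s u‖ ≤ 2 := by
      refine (norm_sub_le _ _).trans ?_
      rw [norm_one]; linarith
    have e1 : 1 / s ^ 2 ≤ (1 / ε ^ 2 + 1) * (1 + s ^ 2)⁻¹ := by
      have h1 : 1 ≤ s ^ 2 / ε ^ 2 := by
        rw [le_div_iff₀ (by positivity), hss, one_mul]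
        gcongr
      rw [← div_eq_mul_inv, div_le_div_iff₀ hs2 (by positivity)]
      have : (1 / ε ^ 2 + 1) * s ^ 2 = s ^ 2 / ε ^ 2 + s ^ 2 := by ring
      linarith
    have e2 : (1 / s ^ 2) * (|s| * |GS α δ κ ρ Y R s u|) ≤ (1 / ε) * (i1 s + i2 s) := by
      have : (1 / s ^ 2) * (|s| * |GS α δ κ ρ Y R s u|) = (1 / |s|) * |GS α δ κ ρ Y R s u| := by
        rw [hss]; field_simp
      rw [this]
      gcongr
    have e3 : ‖2 * (1 - qq T s u) * (GG α δ κ ρ Y R s u : ℂ) - (s : ℂ) * (GS α δ κ ρ Y R s u : ℂ)‖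
        ≤ 4 * D ^ 2 + |s| * |GS α δ κ ρ Y R s u| := by
      refine (norm_sub_le _ _).trans ?_
      rw [norm_mul, norm_mul, norm_mul, Complex.norm_ofNat]
      rw [Complex.norm_real s, Complex.norm_real (GS α δ κ ρ Y R s u), Real.norm_eq_abs, Real.norm_eq_abs]
      have : 2 * ‖1 - qq T s u‖ * ‖(GG α δ κ ρ Y R s u : ℂ)‖ ≤ 2 * 2 * D ^ 2 := by gcongr
      linarith
    calc _ ≤ ((1 / |T|) * (1 / s ^ 2)) * (4 * D ^ 2 + |s| * |GS α δ κ ρ Y R s u|) := by gcongr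
      _ = (1 / |T|) * (4 * D ^ 2 * (1 / s ^ 2) + (1 / s ^ 2) * (|s| * |GS α δ κ ρ Y R s u|)) := by ring
      _ ≤ (1 / |T|) * (4 * D ^ 2 * ((1 / ε ^ 2 + 1) * (1 + s ^ 2)⁻¹) + (1 / ε) * (i1 s + i2 s)) := by gcongr
      _ = _ := by simp only [hΦ]; ring
  calc _ ≤ ∫ s in (Icc (-ε) ε)ᶜ, Φ s := by
        apply norm_integral_le_of_norm_le IΦ.integrableOn
        exact (ae_restrict_iff' measurableSet_Icc.compl).2 (Filter.Eventually.of_forall bd)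
    _ ≤ ∫ s, Φ s := setIntegral_le_integral IΦ (Filter.Eventually.of_forall nΦ)
    _ ≤ _ := by
        rw [vΦ, one_div_mul_eq_div]
        exact div_le_div_of_nonneg_right (by linarith) hT0.le

lemma EE_int {α δ D Kf : ℝ} {κ ρ : ℝ → ℝ} {f : ℝ → ℂ} (h : Dat κ ρ D) (hf : SymB f Kf)
    {T x y R : ℝ} (hR : 1 ≤ R) :
    Integrable (fun z : ℝ × ℝ => EE α δ κ ρ T x y R z.1 z.2 * f z.1)
      ((volume.restrict (Icc (1/2:ℝ) 2)).prod volume) := by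
  have hR0 : 0 < R := by linarith
  have e1 : (volume.restrict (Icc (1/2:ℝ) 2)).prod (volume : Measure ℝ) =
      (volume : Measure (ℝ × ℝ)).restrict (Icc (1/2:ℝ) 2 ×ˢ univ) := by
    rw [Measure.volume_eq_prod, ← Measure.prod_restrict, Measure.restrict_univ]
  rw [e1]
  have c1 : ContinuousOn (fun z : ℝ × ℝ => EE α δ κ ρ T x y R z.1 z.2 * f z.1)
      (Icc (1/2:ℝ) 2 ×ˢ Icc (-(2 * R)) (2 * R)) := by
    have ck := h.ck
    have cr := h.cr
    have p1 : ∀ z ∈ (Icc (1/2:ℝ) 2 ×ˢ Icc (-(2 * R)) (2 * R)), 0 < z.1 := fun z hz => by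
      have := hz.1.1
      linarith
    have cu : ContinuousOn (fun z : ℝ × ℝ => z.1 ^ α) (Icc (1/2:ℝ) 2 ×ˢ Icc (-(2 * R)) (2 * R)) :=
      continuousOn_fst.rpow_const fun z hz => Or.inl (p1 z hz).ne'
    have cd : ContinuousOn (fun z : ℝ × ℝ => z.2 ^ 2 / z.1 ^ α) (Icc (1/2:ℝ) 2 ×ˢ Icc (-(2 * R)) (2 * R)) :=
      (continuousOn_snd.pow 2).div cu fun z hz => (Real.rpow_pos_of_pos (p1 z hz) _).ne'
    have cf : ContinuousOn (fun z : ℝ × ℝ => f z.1) (Icc (1/2:ℝ) 2 ×ˢ Icc (-(2 * R)) (2 * R)) :=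
      hf.cont.comp continuousOn_fst fun z hz => hz.1
    have ce : ContinuousOn (fun z : ℝ × ℝ => ρ ((α * (α + 1) / 2 - z.2 ^ 2 / z.1 ^ α) / δ))
        (Icc (1/2:ℝ) 2 ×ˢ Icc (-(2 * R)) (2 * R)) :=
      cr.comp_continuousOn ((continuousOn_const.sub cd).div_const _)
    have ch := ck.comp_continuousOn ((continuousOn_snd (s := (Icc (1/2:ℝ) 2 ×ˢ Icc (-(2 * R)) (2 * R)))).div_const R)
    have cp : ContinuousOn (fun z : ℝ × ℝ => T * (z.1 * (z.1 ^ α + z.2 ^ 2)) + x * z.1 + y * z.2)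
        (Icc (1/2:ℝ) 2 ×ˢ Icc (-(2 * R)) (2 * R)) := by fun_prop
    unfold EE
    exact (((continuousOn_const.mul (Complex.continuous_ofReal.comp_continuousOn cp)).cexp).mul
      (Complex.continuous_ofReal.comp_continuousOn (ch.mul ce))).mul cf
  have i1 := c1.integrableOn_compact (μ := volume) (isCompact_Icc.prod isCompact_Icc)
  refine i1.of_forall_sdiff_eq_zero (measurableSet_Icc.prod MeasurableSet.univ) ?_
  rintro ⟨u, m⟩ ⟨hz, hz'⟩
  have : κ (m / R) = 0 := by
    apply h.ks0
    rw [abs_div, abs_of_pos hR0, lt_div_iff₀ hR0]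
    by_contra hc
    push Not at hc
    rw [abs_le] at hc
    exact hz' ⟨hz.1, by constructor <;> linarith⟩
  simp [EE, this]

lemma AA_int {α δ D Kf : ℝ} {κ ρ : ℝ → ℝ} {f : ℝ → ℂ} (h : Dat κ ρ D) (hf : SymB f Kf)
    {T x Y R ε : ℝ} :
    Integrable (fun z : ℝ × ℝ => Complex.exp (Complex.I * (ph α T x Y z.2 z.1 : ℂ)) *
        (AA α δ κ ρ T Y R z.2 z.1 * f z.1))
      ((volume.restrict (Icc (1/2:ℝ) 2)).prod (volume.restrict (Icc (-ε) ε))) := by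
  rw [Measure.prod_restrict, ← Measure.volume_eq_prod]
  refine ContinuousOn.integrableOn_compact (isCompact_Icc.prod isCompact_Icc) ?_
  have ck := h.ck
  have cr := h.cr
  have ck' := h.ck'
  have cr' := h.cr'
  set S := (Icc (1/2:ℝ) 2 ×ˢ Icc (-ε) ε) with hS
  have p1 : ∀ z ∈ S, 0 < z.1 := fun z hz => by
    have := hz.1.1
    linarith
  have cu : ContinuousOn (fun z : ℝ × ℝ => z.1 ^ α) S :=
    continuousOn_fst.rpow_const fun z hz => Or.inl (p1 z hz).ne'
  have pu : ∀ z ∈ S, z.1 ^ α ≠ 0 := fun z hz => (Real.rpow_pos_of_pos (p1 z hz) _).ne'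
  have cy : ContinuousOn (fun z : ℝ × ℝ => Y / z.1) S :=
    continuousOn_const.div continuousOn_fst fun z hz => (p1 z hz).ne'
  have cs : ContinuousOn (fun z : ℝ × ℝ => (z.2 - Y / z.1)) S := continuousOn_snd.sub cy
  have cP : ContinuousOn (fun z : ℝ × ℝ => PP α Y z.2 z.1 / δ) S := by
    unfold PP
    exact (continuousOn_const.sub ((cs.pow 2).div cu pu)).div_const _
  have a1 := ck.comp_continuousOn (cs.div_const R)
  have a2 := ck'.comp_continuousOn (cs.div_const R)
  have a3 := cr.comp_continuousOn cP
  have a4 := cr'.comp_continuousOn cP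
  have cf : ContinuousOn (fun z : ℝ × ℝ => f z.1) S :=
    hf.cont.comp continuousOn_fst fun z hz => hz.1
  have cG : ContinuousOn (fun z : ℝ × ℝ => GG α δ κ ρ Y R z.2 z.1) S := a1.mul a3
  have cGS : ContinuousOn (fun z : ℝ × ℝ => GS α δ κ ρ Y R z.2 z.1) S := by
    unfold GS
    exact ((a2.mul continuousOn_const).mul a3).add (a1.mul (a4.mul
      (((continuousOn_const.mul cs).div cu pu).div_const _)))
  have cq : ContinuousOn (fun z : ℝ × ℝ => qq T z.2 z.1) S := by
    unfold qq
    refine ContinuousOn.div continuousOn_const (by fun_prop) fun z _ => qq_ne _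
  have cph : ContinuousOn (fun z : ℝ × ℝ => ph α T x Y z.2 z.1) S := by
    unfold ph
    have : ContinuousOn (fun z : ℝ × ℝ => T * Y ^ 2 / z.1) S :=
      continuousOn_const.div continuousOn_fst fun z hz => (p1 z hz).ne'
    fun_prop
  have cG' := Complex.continuous_ofReal.comp_continuousOn cG
  have cGS' := Complex.continuous_ofReal.comp_continuousOn cGS
  have cph' := Complex.continuous_ofReal.comp_continuousOn cph
  have c2 := Complex.continuous_ofReal.comp_continuousOn (continuousOn_snd (s := S))
  unfold AA
  exact ((continuousOn_const.mul cph').cexp).mul ((cq.mul (((continuousOn_const.mul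
    (continuousOn_const.sub cq)).mul cG').sub (c2.mul cGS'))).mul cf)

lemma int_decay {a ε : ℝ} (ha : 0 < a) : ∫ s in Icc (-ε) ε, 1 / (1 + a * s ^ 2) ≤ Real.pi / √a ∧
    IntegrableOn (fun s : ℝ => 1 / (1 + a * s ^ 2)) (Icc (-ε) ε) := by
  have hs : 0 < √a := Real.sqrt_pos.2 ha
  have e : ∀ s : ℝ, 1 / (1 + a * s ^ 2) = (1 + (√a * s) ^ 2)⁻¹ := fun s => by
    rw [mul_pow, Real.sq_sqrt ha.le, one_div]
  have i : Integrable (fun s : ℝ => (1 + (√a * s) ^ 2)⁻¹) :=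
    integrable_inv_one_add_sq.comp_mul_left' hs.ne'
  simp_rw [e]
  refine ⟨?_, i.integrableOn⟩
  refine (setIntegral_le_integral i (Filter.Eventually.of_forall fun s => ?_)).trans ?_
  · dsimp; positivity
  · rw [Measure.integral_comp_mul_left (fun s : ℝ => (1 + s ^ 2)⁻¹), integral_univ_inv_one_add_sq,
      abs_of_pos (by positivity), smul_eq_mul]
    apply le_of_eq; field_simp

lemma core {α δ D Kf : ℝ} {κ ρ : ℝ → ℝ} {f : ℝ → ℂ} (hα : α ∈ Icc (1:ℝ) 2) (hδ : δ ∈ Ioo (0:ℝ) 1)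
    (h : Dat κ ρ D) (hf : SymB f Kf) : ∃ K > 0, ∀ T x y R : ℝ, T ≠ 0 → 1 ≤ R →
      ‖∫ z, EE α δ κ ρ T x y R z.1 z.2 * f z.1 ∂((volume.restrict (Icc (1/2:ℝ) 2)).prod volume)‖
        ≤ K / |T| := by
  obtain ⟨K1, hK1, H1⟩ := small_s hα hδ h hf
  have hε : 0 < δ / 400 := by have := hδ.1; positivity
  obtain ⟨K2, hK2, H2⟩ := large_s hα hδ h (δ / 400) hε
  set ε := δ / 400 with hεd
  have hKf := hf.nonneg
  have hpi := Real.pi_pos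
  refine ⟨K1 * Real.pi + K2 * Kf * 2, by positivity, fun T x y R hT hR => ?_⟩
  have hT0 : 0 < |T| := abs_pos.2 hT
  have hsT : 0 < √|T| := Real.sqrt_pos.2 hT0
  have I1 := EE_int (α := α) (δ := δ) h hf (T := T) (x := x) (y := y) hR
  set Y := y / (2 * T) with hY
  have I2 := AA_int (α := α) (δ := δ) h hf (T := T) (x := x) (Y := Y) (R := R) (ε := ε)
  rw [integral_prod _ I1]
  have J1 := I1.integral_prod_left
  have J2 := I2.integral_prod_left
  dsimp only at J1 J2 ⊢
  set A : ℝ → ℂ := fun u => ∫ s in Icc (-ε) ε, Complex.exp (Complex.I * (ph α T x Y s u : ℂ)) *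
        (AA α δ κ ρ T Y R s u * f u) with hA
  set W : ℝ → ℂ := fun u => ∫ m, EE α δ κ ρ T x y R u m * f u with hW
  have split : ∀ u ∈ Icc (1/2:ℝ) 2, W u - A u = (∫ s in (Icc (-ε) ε)ᶜ,
      Complex.exp (Complex.I * (ph α T x Y s u : ℂ)) * AA α δ κ ρ T Y R s u) * f u := by
    intro u hu
    have hu0 : u ≠ 0 := by have := hu.1; intro h; subst h; norm_num at this
    simp only [hW, hA]
    simp_rw [← mul_assoc]
    rw [integral_mul_const, integral_mul_const, inner_eq h hT hR hu0, ← hY,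
      ← integral_add_compl (measurableSet_Icc (a := -ε) (b := ε)) (int_AA h hR)]
    ring
  have B2 : ‖∫ u in Icc (1/2:ℝ) 2, (W u - A u)‖ ≤ (K2 / |T| * Kf) * (3/2) := by
    have := norm_setIntegral_le_of_norm_le_const (μ := volume) (s := Icc (1/2:ℝ) 2) (f := fun u => W u - A u)
      (C := K2 / |T| * Kf) (by simp) (fun u hu => ?_)
    · refine this.trans (le_of_eq ?_)
      simp only [Measure.real, Real.volume_Icc]
      rw [ENNReal.toReal_ofReal (by norm_num)]; norm_num
    · rw [split u hu, norm_mul]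
      gcongr
      · exact H2 T x Y R u hT hR hu
      · obtain ⟨f', hf1, -⟩ := hf
        exact (hf1 u hu).2.1
  have B1 : ‖∫ u in Icc (1/2:ℝ) 2, A u‖ ≤ K1 * Real.pi / |T| := by
    simp only [hA]
    rw [integral_integral_swap I2]
    obtain ⟨d1, d2⟩ := int_decay (ε := ε) hT0
    have := norm_integral_le_of_norm_le (μ := volume.restrict (Icc (-ε) ε))
      (f := fun s => ∫ u in Icc (1/2:ℝ) 2, Complex.exp (Complex.I * (ph α T x Y s u : ℂ)) *
        (AA α δ κ ρ T Y R s u * f u)) (d2.const_mul (K1 / √|T|))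
      ((ae_restrict_iff' measurableSet_Icc).2 (Filter.Eventually.of_forall fun s hs => ?_))
    · refine this.trans ?_
      rw [integral_const_mul]
      calc _ ≤ K1 / √|T| * (Real.pi / √|T|) := by gcongr
        _ = K1 * Real.pi / |T| := by
          rw [div_mul_div_comm, Real.mul_self_sqrt hT0.le]
    · have := H1 T x Y R s hT hR (abs_le.2 hs)
      rw [intervalIntegral.integral_of_le (by norm_num), ← integral_Icc_eq_integral_Ioc] at this
      exact this
  have e : ∫ u in Icc (1/2:ℝ) 2, W u = (∫ u in Icc (1/2:ℝ) 2, A u) + ∫ u in Icc (1/2:ℝ) 2, (W u - A u) := by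
    rw [integral_sub J1 J2]; ring
  rw [e]
  refine (norm_add_le _ _).trans ((add_le_add B1 B2).trans ?_)
  have : 0 ≤ K2 * Kf / |T| := by positivity
  calc _ = K1 * Real.pi / |T| + K2 * Kf / |T| * (3/2) := by ring
    _ ≤ K1 * Real.pi / |T| + K2 * Kf / |T| * 2 := by linarith
    _ = _ := by ring

open FourierTransform in
lemma fourier_rep {χ : ℝ → ℝ} (hχs : ContDiff ℝ (⊤ : ℕ∞) χ) (hχ0 : ∀ x, 5/3 < |x| → χ x = 0) :
    ∃ g : ℝ → ℂ, Integrable g ∧ ∀ a : ℝ, (χ a : ℂ) =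
      ∫ v : ℝ, Complex.exp (Complex.I * ((2 * Real.pi * v * a : ℝ) : ℂ)) * g v := by
  have hc : HasCompactSupport (fun x => (χ x : ℂ)) := by
    refine HasCompactSupport.intro (isCompact_Icc (a := (-(5/3):ℝ)) (b := 5/3)) fun x hx => ?_
    rw [hχ0, Complex.ofReal_zero]
    by_contra hc
    push Not at hc
    exact hx (abs_le.1 hc)
  have hs : ContDiff ℝ (⊤ : ℕ∞) (fun x => (χ x : ℂ)) := Complex.ofRealCLM.contDiff.comp hχs
  set G := hc.toSchwartzMap hs with hG
  refine ⟨𝓕 (G : ℝ → ℂ), ?_, fun a => ?_⟩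
  · rw [← SchwartzMap.fourier_coe]; exact (𝓕 G).integrable
  · have h1 : 𝓕⁻ (𝓕 (G : ℝ → ℂ)) = (G : ℝ → ℂ) := by
      apply G.continuous.fourierInv_fourier_eq G.integrable
      rw [← SchwartzMap.fourier_coe]; exact (𝓕 G).integrable
    have h2 := congrFun h1 a
    rw [Real.fourierInv_eq'] at h2
    have h3 : G a = (χ a : ℂ) := rfl
    rw [← h3, ← h2]
    congr 1
    ext v
    rw [smul_eq_mul]
    congr 2
    rw [mul_comm]
    congr 2
    simp
    ring

lemma four {χ : ℝ → ℝ} (hχs : ContDiff ℝ (⊤ : ℕ∞) χ) (hχ0 : ∀ x, 5/3 < |x| → χ x = 0) :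
    ∃ C ≥ (0:ℝ), ∀ (μ : Measure (ℝ × ℝ)) [SFinite μ] (H : ℝ × ℝ → ℂ) (K m : ℝ), Integrable H μ →
      (∀ y : ℝ, ‖∫ z, Complex.exp (Complex.I * ((y * z.2 : ℝ) : ℂ)) * H z ∂μ‖ ≤ K) →
      ‖∫ z, (χ (z.2 / m) : ℂ) * H z ∂μ‖ ≤ C * K := by
  obtain ⟨g, gi, hg⟩ := fourier_rep hχs hχ0
  refine ⟨∫ v, ‖g v‖, integral_nonneg fun _ => norm_nonneg _, fun μ _ H K m hH hb => ?_⟩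
  have i1 : Integrable (fun p : (ℝ × ℝ) × ℝ => Complex.exp (Complex.I * ((2 * Real.pi * p.2 * (p.1.2 / m) : ℝ) : ℂ)) *
      (H p.1 * g p.2)) (μ.prod volume) := by
    refine (hH.mul_prod gi).bdd_mul (c := 1) ?_ (Filter.Eventually.of_forall fun p => ?_)
    · apply Continuous.aestronglyMeasurable
      fun_prop
    · rw [nexp]
  have e1 : ∀ z : ℝ × ℝ, (χ (z.2 / m) : ℂ) * H z = ∫ v : ℝ, Complex.exp (Complex.I * ((2 * Real.pi * v * (z.2 / m) : ℝ) : ℂ)) * (H z * g v) := by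
    intro z
    rw [hg, ← integral_mul_const]
    congr 1; ext v; ring
  simp_rw [e1]
  rw [integral_integral_swap i1]
  rw [← integral_mul_const]
  refine norm_integral_le_of_norm_le (gi.norm.mul_const K) (Filter.Eventually.of_forall fun v => ?_)
  have := hb (2 * Real.pi * v / m)
  have e2 : ∫ z, Complex.exp (Complex.I * ((2 * Real.pi * v * (z.2 / m) : ℝ) : ℂ)) * (H z * g v) ∂μ =
      (∫ z, Complex.exp (Complex.I * ((2 * Real.pi * v / m * z.2 : ℝ) : ℂ)) * H z ∂μ) * g v := by
    rw [← integral_mul_const]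
    congr 1; ext z
    have e3 : 2 * Real.pi * v * (z.2 / m) = 2 * Real.pi * v / m * z.2 := by ring
    rw [e3]
    ring
  rw [e2, norm_mul, mul_comm]
  gcongr

lemma abs_nbhd {a : ℝ} (x : ℝ) (h : a < |x|) : ∀ᶠ z in nhds x, a < |z| :=
  continuous_abs.continuousAt.eventually (lt_mem_nhds h)

lemma deriv_zero_of {f : ℝ → ℝ} {a c : ℝ} (h : ∀ x, a < |x| → f x = c) (x : ℝ) (hx : a < |x|) :
    deriv f x = 0 := by
  have : f =ᶠ[nhds x] fun _ => c := (abs_nbhd x hx).mono fun z hz => h z hz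
  rw [this.deriv_eq]; simp

lemma bdd_of {f : ℝ → ℝ} {a : ℝ} (hf : Continuous f) (h : ∀ x, a < |x| → f x = 0) :
    ∃ C, ∀ x, |f x| ≤ C := by
  have hc : HasCompactSupport f := by
    refine HasCompactSupport.intro (isCompact_Icc (a := -a) (b := a)) fun x hx => ?_
    rw [h]
    by_contra hc
    push Not at hc
    exact hx (abs_le.1 hc)
  exact hc.exists_bound_of_continuous hf

lemma mkDat {χ ρ : ℝ → ℝ}
    (hχs : ContDiff ℝ (⊤ : ℕ∞) χ)
    (hχ0 : ∀ x, 5/3 < |x| → χ x = 0)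
    (hρs : ContDiff ℝ (⊤ : ℕ∞) ρ)
    (hρ01 : ∀ x, ρ x ∈ Icc (0:ℝ) 1)
    (hρ0 : ∀ x, |x| ≤ 1/2 → ρ x = 0)
    (hρ1 : ∀ x, 1 ≤ |x| → ρ x = 1) : ∃ D, Dat χ ρ D := by
  have key : ∀ f : ℝ → ℝ, ContDiff ℝ (⊤ : ℕ∞) f → (∀ x, HasDerivAt f (deriv f x) x) ∧ ContDiff ℝ (⊤ : ℕ∞) (deriv f) := by
    intro f hf
    have := (contDiff_infty_iff_deriv).1 hf
    exact ⟨fun x => (this.1 x).hasDerivAt, this.2⟩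
  obtain ⟨a1, a2⟩ := key χ hχs
  obtain ⟨a3, a4⟩ := key _ a2
  obtain ⟨b1, b2⟩ := key ρ hρs
  obtain ⟨b3, b4⟩ := key _ b2
  have s1 := deriv_zero_of hχ0
  have s2 := deriv_zero_of s1
  have r1 := deriv_zero_of (f := ρ) (a := 1) (c := 1) fun x hx => hρ1 x hx.le
  have r2 := deriv_zero_of r1
  obtain ⟨C0, h0⟩ := bdd_of hχs.continuous hχ0
  obtain ⟨C1, h1⟩ := bdd_of a2.continuous s1
  obtain ⟨C2, h2⟩ := bdd_of a4.continuous s2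
  obtain ⟨C3, h3⟩ := bdd_of b2.continuous r1
  obtain ⟨C4, h4⟩ := bdd_of b4.continuous r2
  have n0 := (abs_nonneg _).trans (h0 0)
  have n1 := (abs_nonneg _).trans (h1 0)
  have n2 := (abs_nonneg _).trans (h2 0)
  have n3 := (abs_nonneg _).trans (h3 0)
  have n4 := (abs_nonneg _).trans (h4 0)
  refine ⟨C0 + C1 + C2 + C3 + C4 + 1, a1, a3, a4.continuous, fun x => ?_, fun x => ?_, fun x => ?_, hχ0, s1, s2,
    b1, b3, b4.continuous, fun x => ?_, fun x => ?_, fun x => ?_, r1, r2, fun x hx => hρ0 x hx.le, fun x hx => ?_⟩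
  · linarith [h0 x]
  · linarith [h1 x]
  · linarith [h2 x]
  · rw [abs_of_nonneg (hρ01 x).1]; linarith [(hρ01 x).2]
  · linarith [h3 x]
  · linarith [h4 x]
  · have : ρ =ᶠ[nhds x] fun _ => 0 :=
      (continuous_abs.continuousAt.eventually (gt_mem_nhds hx)).mono fun z hz => hρ0 z (le_of_lt hz)
    rw [this.deriv_eq]; simp

def QQ (α δ : ℝ) (χ ρ : ℝ → ℝ) (f : ℝ → ℂ) (T x y m : ℝ) (z : ℝ × ℝ) : ℂ :=
  Complex.exp (Complex.I * ((T * (z.1 * (z.1 ^ α + z.2 ^ 2)) + x * z.1 + y * z.2 : ℝ) : ℂ)) * f z.1 *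
    (χ (z.2 / m) : ℂ) * (ρ ((α * (α + 1) / 2 - z.2 ^ 2 / z.1 ^ α) / δ) : ℂ)

lemma QQ_eq {α δ D Kf : ℝ} {χ ρ : ℝ → ℝ} {f : ℝ → ℂ}
    (h : Dat χ ρ D) (hχ1 : ∀ x, |x| ≤ 4/3 → χ x = 1) {T x y m R : ℝ} (hm : 0 < m) (hR : 1 ≤ R) (hR2 : 2 * m ≤ R)
    (z : ℝ × ℝ) :
    QQ α δ χ ρ f T x y m z = (χ (z.2 / m) : ℂ) * (EE α δ χ ρ T x y R z.1 z.2 * f z.1) := by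
  have hR0 : 0 < R := by linarith
  unfold QQ EE
  by_cases hc : χ (z.2 / m) = 0
  · simp [hc]
  · have h1 : |z.2 / m| ≤ 5/3 := by
      by_contra h2
      exact hc (h.ks0 _ (not_le.1 h2))
    rw [abs_div, abs_of_pos hm, div_le_iff₀ hm] at h1
    have h3 : χ (z.2 / R) = 1 := by
      apply hχ1
      rw [abs_div, abs_of_pos hR0, div_le_iff₀ hR0]
      linarith
    rw [h3, one_mul]
    ring

lemma piece {α δ D Kf : ℝ} {χ ρ : ℝ → ℝ} {f : ℝ → ℂ} (hα : α ∈ Icc (1:ℝ) 2) (hδ : δ ∈ Ioo (0:ℝ) 1)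
    (hχs : ContDiff ℝ (⊤ : ℕ∞) χ) (hχ1 : ∀ x, |x| ≤ 4/3 → χ x = 1)
    (h : Dat χ ρ D) (hf : SymB f Kf) : ∃ K > 0, ∀ T x y m : ℝ, T ≠ 0 → 0 < m →
      Integrable (QQ α δ χ ρ f T x y m) ((volume.restrict (Icc (1/2:ℝ) 2)).prod volume) ∧
      ‖∫ z, QQ α δ χ ρ f T x y m z ∂((volume.restrict (Icc (1/2:ℝ) 2)).prod volume)‖ ≤ K / |T| := by
  obtain ⟨K, hK, H⟩ := core hα hδ h hf
  obtain ⟨C, hC, HC⟩ := four hχs h.ks0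
  refine ⟨C * K + 1, by positivity, fun T x y m hT hm => ?_⟩
  have hT0 : 0 < |T| := abs_pos.2 hT
  set R := max 1 (2 * m) with hR
  have hR1 : 1 ≤ R := le_max_left _ _
  have hR2 : 2 * m ≤ R := le_max_right _ _
  have I1 := EE_int (α := α) (δ := δ) h hf (T := T) (x := x) (y := y) hR1
  have e : QQ α δ χ ρ f T x y m = fun z => (χ (z.2 / m) : ℂ) * (EE α δ χ ρ T x y R z.1 z.2 * f z.1) :=
    funext fun z => QQ_eq (Kf := Kf) h hχ1 hm hR1 hR2 z
  rw [e]
  constructor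
  · refine I1.bdd_mul (c := D) ?_ (Filter.Eventually.of_forall fun z => ?_)
    · apply Continuous.aestronglyMeasurable
      have := h.ck
      fun_prop
    · rw [Complex.norm_real]; exact h.kb0 _
  · have := HC ((volume.restrict (Icc (1/2:ℝ) 2)).prod volume) (fun z => EE α δ χ ρ T x y R z.1 z.2 * f z.1)
      (K / |T|) m I1 (fun y' => ?_)
    · refine this.trans ?_
      rw [← mul_div_assoc]
      exact div_le_div_of_nonneg_right (by linarith) hT0.le
    · refine le_trans (le_of_eq ?_) (H T x (y + y') R hT hR1)
      congr 2
      ext z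
      unfold EE
      rw [← mul_assoc, ← mul_assoc, ← Complex.exp_add]
      congr 3
      push_cast
      ring

lemma map_scale {a b : ℝ} (ha : a ≠ 0) (hb : b ≠ 0) :
    Measure.map (fun z : ℝ × ℝ => (a * z.1, b * z.2)) volume =
      ENNReal.ofReal (|a⁻¹| * |b⁻¹|) • (volume : Measure (ℝ × ℝ)) := by
  have := Measure.map_prod_map (volume : Measure ℝ) (volume : Measure ℝ) (f := fun x => a * x) (g := fun x => b * x)
    (by fun_prop) (by fun_prop)
  rw [Real.map_volume_mul_left ha, Real.map_volume_mul_left hb, Measure.prod_smul_left, Measure.prod_smul_right,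
    smul_smul, ← ENNReal.ofReal_mul (abs_nonneg _), ← Measure.volume_eq_prod] at this
  rw [this]
  rfl

lemma emb_scale {a b : ℝ} (ha : a ≠ 0) (hb : b ≠ 0) :
    MeasurableEmbedding (fun z : ℝ × ℝ => (a * z.1, b * z.2)) :=
  (measurableEmbedding_mulLeft₀ ha).prodMap (measurableEmbedding_mulLeft₀ hb)

lemma int_scale {a b : ℝ} (ha : a ≠ 0) (hb : b ≠ 0) (F : ℝ × ℝ → ℂ) :
    ∫ z, F z = (|a| * |b| : ℝ) • ∫ z : ℝ × ℝ, F (a * z.1, b * z.2) := by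
  have := (emb_scale ha hb).integral_map (μ := volume) F
  rw [← this, map_scale ha hb, integral_smul_measure, ENNReal.toReal_ofReal (by positivity), smul_smul, abs_inv, abs_inv]
  have : |a| * |b| * (|a|⁻¹ * |b|⁻¹) = 1 := by
    have := abs_pos.2 ha
    have := abs_pos.2 hb
    field_simp
  rw [this, one_smul]

lemma integrable_scale {a b : ℝ} (ha : a ≠ 0) (hb : b ≠ 0) (F : ℝ × ℝ → ℂ)
    (h : Integrable (fun z : ℝ × ℝ => F (a * z.1, b * z.2))) : Integrable F := by
  have := ((emb_scale ha hb).integrable_map_iff (μ := volume) (g := F)).2 h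
  rw [map_scale ha hb] at this
  rwa [integrable_smul_measure] at this
  · have := abs_pos.2 (inv_ne_zero ha)
    have := abs_pos.2 (inv_ne_zero hb)
    simp [*]
  · exact ENNReal.ofReal_ne_top

def FF (α δ : ℝ) (χ ρ : ℝ → ℝ) (N M t x y : ℝ) (ζ : ℝ × ℝ) : ℂ :=
  Complex.exp (Complex.I *
              ((t * (ζ.1 * (|ζ.1| ^ α + ζ.2 ^ 2)) + x * ζ.1 + y * ζ.2 : ℝ) : ℂ))
            * ((χ (ζ.1 / N) - χ (2 * ζ.1 / N) : ℝ) : ℂ)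
            * ((χ (ζ.2 / M) : ℝ) : ℂ)
            * (if ζ.1 = 0 then (0:ℂ)
               else ((ρ ((α * (α + 1) / 2 - ζ.2 ^ 2 / |ζ.1| ^ α) / δ) : ℝ) : ℂ))

def SS (σ N : ℝ) : Set (ℝ × ℝ) := {z | σ * z.1 / N ∈ Icc (1/2:ℝ) 2}

lemma half {α δ D : ℝ} {χ ρ : ℝ → ℝ} (hα : α ∈ Icc (1:ℝ) 2) (hδ : δ ∈ Ioo (0:ℝ) 1)
    (hχs : ContDiff ℝ (⊤ : ℕ∞) χ) (hχ1 : ∀ x, |x| ≤ 4/3 → χ x = 1)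
    (h : Dat χ ρ D) (σ : ℝ) (hσ : |σ| = 1) : ∃ K > 0, ∀ N M t x y : ℝ, 0 < N → 0 < M → t ≠ 0 →
      Integrable ((SS σ N).indicator (FF α δ χ ρ N M t x y)) ∧
      ‖∫ z, (SS σ N).indicator (FF α δ χ ρ N M t x y) z‖ ≤ K * N ^ (-(α / 2)) * |t|⁻¹ := by
  have hf0 : ContDiff ℝ 1 (fun u : ℝ => (χ (σ * u) - χ (2 * (σ * u)))) := by
    have c1 : ContDiff ℝ 1 χ := hχs.of_le (by exact_mod_cast le_top)
    exact (c1.comp (by fun_prop)).sub (c1.comp (by fun_prop))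
  obtain ⟨Kf, hf⟩ := SymB.ofContDiff hf0
  obtain ⟨K, hK, H⟩ := piece hα hδ hχs hχ1 h hf
  refine ⟨K, hK, fun N M t x y hN hM ht => ?_⟩
  have ht0 : 0 < |t| := abs_pos.2 ht
  have hσ0 : σ ≠ 0 := by intro h0; simp [h0] at hσ
  have hσ2 : σ * σ = 1 := by rw [← abs_mul_abs_self, hσ]; norm_num
  set b := N ^ (α / 2) with hb
  have hb0 : 0 < b := Real.rpow_pos_of_pos hN _
  have hb2 : b ^ 2 = N ^ α := by
    rw [hb, ← Real.rpow_natCast, ← Real.rpow_mul hN.le]; congr 1; push_cast; ring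
  have hNα : 0 < N ^ α := Real.rpow_pos_of_pos hN _
  have ha : σ * N ≠ 0 := mul_ne_zero hσ0 hN.ne'
  set T := σ * t * (N * N ^ α) with hT
  have hT0 : T ≠ 0 := by rw [hT]; exact mul_ne_zero (mul_ne_zero hσ0 ht) (by positivity)
  have hTa : |T| = |t| * (N * b ^ 2) := by
    rw [hT, abs_mul, abs_mul, hσ, one_mul, hb2, abs_of_pos (by positivity : 0 < N * N ^ α)]
  obtain ⟨J1, J2⟩ := H T (σ * x * N) (y * b) (M / b) hT0 (by positivity)
  have e1 : (volume.restrict (Icc (1/2:ℝ) 2)).prod (volume : Measure ℝ) =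
      (volume : Measure (ℝ × ℝ)).restrict (Icc (1/2:ℝ) 2 ×ˢ univ) := by
    rw [Measure.volume_eq_prod, ← Measure.prod_restrict, Measure.restrict_univ]
  have ms : MeasurableSet (Icc (1/2:ℝ) 2 ×ˢ (univ : Set ℝ)) := measurableSet_Icc.prod MeasurableSet.univ
  rw [e1] at J1 J2
  rw [← integral_indicator ms] at J2
  have e2 : (fun z : ℝ × ℝ => (SS σ N).indicator (FF α δ χ ρ N M t x y) ((σ * N) * z.1, b * z.2)) =
      (Icc (1/2:ℝ) 2 ×ˢ univ).indicator (QQ α δ χ ρ (fun u : ℝ => ((χ (σ * u) - χ (2 * (σ * u)) : ℝ) : ℂ))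
        T (σ * x * N) (y * b) (M / b)) := by
    ext ⟨u, v⟩
    have k0 : σ * (σ * N * u) / N = u := by
      rw [← mul_assoc, ← mul_assoc, hσ2]; field_simp
    by_cases hu : u ∈ Icc (1/2:ℝ) 2
    · have hu0 : 0 < u := by have := hu.1; linarith
      rw [indicator_of_mem (by simpa [SS, k0] using hu), indicator_of_mem (by simpa using hu)]
      simp only [FF, QQ]
      have k1 : |σ * N * u| ^ α = N ^ α * u ^ α := by
        rw [abs_mul, abs_mul, hσ, one_mul, abs_of_pos hN, abs_of_pos hu0, Real.mul_rpow hN.le hu0.le]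
      have k2 : σ * N * u / N = σ * u := by field_simp
      have k3 : 2 * (σ * N * u) / N = 2 * (σ * u) := by field_simp
      have k4 : b * v / M = v / (M / b) := by field_simp
      have k5 : (b * v) ^ 2 = N ^ α * v ^ 2 := by rw [mul_pow, hb2]
      have k6 : N ^ α * v ^ 2 / (N ^ α * u ^ α) = v ^ 2 / u ^ α := mul_div_mul_left _ _ hNα.ne'
      rw [if_neg (mul_ne_zero ha hu0.ne'), k1, k2, k3, k4, k5, k6]
      congr 6
      rw [hT]
      ring
    · rw [indicator_of_notMem (by simpa [SS, k0] using hu), indicator_of_notMem (by simpa using hu)]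
  refine ⟨integrable_scale ha hb0.ne' _ ?_, ?_⟩
  · rw [e2]; exact (integrable_indicator_iff ms).2 J1
  · rw [int_scale ha hb0.ne', e2, norm_smul, Real.norm_eq_abs, abs_mul, abs_abs, abs_abs, abs_mul, hσ, one_mul,
      abs_of_pos hN, abs_of_pos hb0]
    calc _ ≤ N * b * (K / |T|) := by gcongr
      _ = K * b⁻¹ * |t|⁻¹ := by rw [hTa]; field_simp
      _ = _ := by rw [Real.rpow_neg hN.le]

theorem stmt0 (α : ℝ) (hα : α ∈ Icc (1:ℝ) 2) (δ : ℝ) (hδ : δ ∈ Ioo (0:ℝ) 1)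
    (χ ρ : ℝ → ℝ)
    (hχs : ContDiff ℝ (⊤ : ℕ∞) χ)
    (hχ01 : ∀ x, χ x ∈ Icc (0:ℝ) 1)
    (hχ1 : ∀ x, |x| ≤ 4/3 → χ x = 1)
    (hχ0 : ∀ x, 5/3 < |x| → χ x = 0)
    (hρs : ContDiff ℝ (⊤ : ℕ∞) ρ)
    (hρ01 : ∀ x, ρ x ∈ Icc (0:ℝ) 1)
    (hρ0 : ∀ x, |x| ≤ 1/2 → ρ x = 0)
    (hρ1 : ∀ x, 1 ≤ |x| → ρ x = 1) :
    ∃ C > (0:ℝ), ∀ N M : ℝ, (∃ k : ℕ, N = 2 ^ k) → 2 ≤ N → (∃ k : ℕ, M = 2 ^ k) →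
      ∀ t : ℝ, t ≠ 0 → ∀ x y : ℝ,
      ‖∫ ζ : ℝ × ℝ,
          Complex.exp (Complex.I *
              ((t * (ζ.1 * (|ζ.1| ^ α + ζ.2 ^ 2)) + x * ζ.1 + y * ζ.2 : ℝ) : ℂ))
            * ((χ (ζ.1 / N) - χ (2 * ζ.1 / N) : ℝ) : ℂ)
            * ((χ (ζ.2 / M) : ℝ) : ℂ)
            * (if ζ.1 = 0 then (0:ℂ)
               else ((ρ ((α * (α + 1) / 2 - ζ.2 ^ 2 / |ζ.1| ^ α) / δ) : ℝ) : ℂ))‖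
        ≤ C * N ^ (-(α / 2)) * |t|⁻¹ := by
  obtain ⟨D, h⟩ := mkDat hχs hχ0 hρs hρ01 hρ0 hρ1
  obtain ⟨K1, hK1, H1⟩ := half hα hδ hχs hχ1 h 1 (by norm_num)
  obtain ⟨K2, hK2, H2⟩ := half hα hδ hχs hχ1 h (-1) (by norm_num)
  refine ⟨K1 + K2, by positivity, fun N M _ hN2 hM t ht x y => ?_⟩
  have hN : 0 < N := by linarith
  have hM0 : 0 < M := by obtain ⟨k, rfl⟩ := hM; positivity
  obtain ⟨a1, a2⟩ := H1 N M t x y hN hM0 ht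
  obtain ⟨b1, b2⟩ := H2 N M t x y hN hM0 ht
  have e : ∀ z, FF α δ χ ρ N M t x y z = (SS 1 N).indicator (FF α δ χ ρ N M t x y) z +
      (SS (-1) N).indicator (FF α δ χ ρ N M t x y) z := by
    intro z
    by_cases c1 : z ∈ SS 1 N
    · have c2 : z ∉ SS (-1) N := by
        intro c2
        have p1 := c1.1
        have p2 := c2.1
        have : -1 * z.1 / N = - (1 * z.1 / N) := by ring
        rw [this] at p2
        linarith
      rw [indicator_of_mem c1, indicator_of_notMem c2, add_zero]
    · by_cases c2 : z ∈ SS (-1) N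
      · rw [indicator_of_notMem c1, indicator_of_mem c2, zero_add]
      · rw [indicator_of_notMem c1, indicator_of_notMem c2, add_zero]
        have q : χ (z.1 / N) - χ (2 * z.1 / N) = 0 := by
          have q1 : 2 * z.1 / N = 2 * (z.1 / N) := by ring
          have q2 : -1 * z.1 / N = - (z.1 / N) := by ring
          simp only [SS, mem_ofPred_eq, one_mul, mem_Icc, q2] at c1 c2
          rw [q1]
          set w := z.1 / N
          rcases le_or_gt |w| (1/2) with hw | hw
          · rw [hχ1 w (by linarith), hχ1 (2 * w) (by rw [abs_mul, abs_two]; linarith), sub_self]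
          · have hw2 : 2 < |w| := by
              by_contra hc
              push Not at hc
              rcases abs_cases w with ⟨h1, h2⟩ | ⟨h1, h2⟩
              · exact c1 ⟨by linarith, by linarith⟩
              · exact c2 ⟨by linarith, by linarith⟩
            rw [hχ0 w (by linarith), hχ0 (2 * w) (by rw [abs_mul, abs_two]; linarith), sub_self]
        simp [FF, q]
  change ‖∫ ζ, FF α δ χ ρ N M t x y ζ‖ ≤ _
  rw [integral_congr_ae (Filter.Eventually.of_forall e), integral_add a1 b1]
  refine (norm_add_le _ _).trans ((add_le_add a2 b2).trans (le_of_eq ?_))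
  ring
end
end

section
/- Let α ∈ [1,2] and δ ∈ (0,1). There is a constant C = C(α,δ) > 0 such that for every dyadic number N ≥ 2, every dyadic number M ≥ 1, every t ≠ 0 and every (x,y) ∈ ℝ², the oscillatory integral I_t^{N,M}(x,y) = ∫_{ℝ²} e^{i(tω(ξ,μ)+xξ+yμ)} φ_N(ξ) φ_{≤M}(μ) ρ_δ(B − μ²/|ξ|^α) dξ dμ satisfies |I_t^{N,M}(x,y)| ≤ C N^{1/2} |t|^{−1/2} (uniformly in M, x and y). -/
open MeasureTheory Set
noncomputable section

def fres (σ T : ℝ) : ℂ := ∫ s in (0:ℝ)..T, Complex.exp (Complex.I * ((σ * s ^ 2 : ℝ) : ℂ))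

lemma fres_norm_one (u : ℝ) : ‖Complex.exp (Complex.I * (u : ℂ))‖ = 1 := by
  rw [mul_comm]; exact Complex.norm_exp_ofReal_mul_I u

lemma fres_cont (σ : ℝ) : Continuous fun s : ℝ => Complex.exp (Complex.I * ((σ * s ^ 2 : ℝ) : ℂ)) := by
  fun_prop

lemma fres_deriv (σ T : ℝ) :
    HasDerivAt (fres σ) (Complex.exp (Complex.I * ((σ * T ^ 2 : ℝ) : ℂ))) T :=
  intervalIntegral.integral_hasDerivAt_right ((fres_cont σ).intervalIntegrable _ _)
    ((fres_cont σ).stronglyMeasurableAtFilter _ _) (fres_cont σ).continuousAt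

lemma fres_small (σ T : ℝ) (h0 : 0 ≤ T) (h1 : T ≤ 1) : ‖fres σ T‖ ≤ 1 := by
  have := intervalIntegral.norm_integral_le_of_norm_le_const (a := 0) (b := T) (C := 1)
    (f := fun s : ℝ => Complex.exp (Complex.I * ((σ * s ^ 2 : ℝ) : ℂ)))
    (fun s _ => (fres_norm_one _).le)
  rw [sub_zero, abs_of_nonneg h0, one_mul] at this
  exact this.trans h1

lemma fres_large (σ T : ℝ) (hσ : |σ| = 1) (h1 : 1 ≤ T) : ‖fres σ T‖ ≤ 3 := by
  have hσ0 : (σ : ℂ) ≠ 0 := by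
    rw [Ne, Complex.ofReal_eq_zero]; rintro rfl; simp at hσ
  have hnσ : ‖(σ : ℂ)‖ = 1 := by rw [Complex.norm_real]; exact hσ
  set E : ℝ → ℂ := fun s : ℝ => Complex.exp (Complex.I * ((σ * s ^ 2 : ℝ) : ℂ)) with hE
  set H : ℝ → ℂ := fun s => E s * (2 * Complex.I * σ * s)⁻¹ with hH
  have hEd : ∀ s, HasDerivAt E (E s * (Complex.I * (σ * (2 * s)))) s := by
    intro s
    have h2 : HasDerivAt (fun s : ℝ => ((σ * s ^ 2 : ℝ) : ℂ)) ((σ * (2 * s) : ℝ) : ℂ) s := by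
      apply HasDerivAt.ofReal_comp
      have := (hasDerivAt_pow 2 s).const_mul σ
      simpa using this
    have := (h2.const_mul Complex.I).cexp
    simpa [hE] using this
  have hHn : ∀ s, 1 ≤ s → ‖H s‖ ≤ 1/2 := by
    intro s hs
    simp only [hH, norm_mul, norm_inv, hE, fres_norm_one, hnσ, Complex.norm_I, Complex.norm_real,
      Complex.norm_ofNat, Real.norm_eq_abs]
    rw [abs_of_pos (by linarith), one_mul, ← one_div]
    apply one_div_le_one_div_of_le <;> linarith
  have hHd : ∀ s, 1 ≤ s → HasDerivAt H (E s - E s * (2 * Complex.I * σ * s ^ 2)⁻¹) s := by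
    intro s hs
    have hs0 : (s : ℂ) ≠ 0 := by
      rw [Ne, Complex.ofReal_eq_zero]; linarith
    have h3 : HasDerivAt (fun s : ℝ => (2 * Complex.I * σ * s : ℂ)) (2 * Complex.I * σ) s := by
      simpa using (HasDerivAt.ofReal_comp (hasDerivAt_id s)).const_mul (2 * Complex.I * σ)
    have h4 := (hEd s).mul (h3.inv (by simp [hσ0, hs0]))
    refine h4.congr_deriv ?_
    simp only [Pi.inv_apply]
    field_simp
    ring
  have key := image_norm_le_of_norm_deriv_right_le_deriv_boundary' (a := 1) (b := T)
    (f := fun s => fres σ s - H s - (fres σ 1 - H 1))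
    (f' := fun s => E s * (2 * Complex.I * σ * s ^ 2)⁻¹)
    (B := fun s => 1/2 - (2 * s)⁻¹) (B' := fun s => (2 * s ^ 2)⁻¹)
  have hd : ∀ s, 1 ≤ s → HasDerivAt (fun s => fres σ s - H s - (fres σ 1 - H 1))
      (E s * (2 * Complex.I * σ * s ^ 2)⁻¹) s := by
    intro s hs
    have := ((fres_deriv σ s).sub (hHd s hs)).sub_const (fres σ 1 - H 1)
    refine this.congr_deriv ?_
    simp [hE]
  have hBd : ∀ s : ℝ, 1 ≤ s → HasDerivAt (fun s : ℝ => 1/2 - (2 * s)⁻¹) ((2 * s ^ 2)⁻¹) s := by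
    intro s hs
    have hs0 : s ≠ 0 := by linarith
    have := (((hasDerivAt_id s).const_mul 2).inv (by simpa using hs0)).const_sub (1/2)
    refine this.congr_deriv ?_
    simp only [id]
    field_simp
  have := key (fun s hs => (hd s hs.1).continuousAt.continuousWithinAt)
    (fun s hs => (hd s hs.1).hasDerivWithinAt) (by norm_num)
    (fun s hs => (hBd s hs.1).continuousAt.continuousWithinAt)
    (fun s hs => (hBd s hs.1).hasDerivWithinAt)
    (by
      intro s hs
      have : 0 < s := by linarith [hs.1]
      simp only [norm_mul, norm_inv, norm_pow, hE, fres_norm_one, hnσ, Complex.norm_I,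
        Complex.norm_real, Complex.norm_ofNat, Real.norm_eq_abs, abs_of_pos this]
      simp) ⟨h1, le_rfl⟩
  have hB : (1/2 : ℝ) - (2 * T)⁻¹ ≤ 1/2 := by
    have : 0 ≤ (2 * T)⁻¹ := by positivity
    linarith
  calc ‖fres σ T‖ = ‖(fres σ T - H T - (fres σ 1 - H 1)) + H T + fres σ 1 - H 1‖ := by
        congr 1; ring
    _ ≤ ‖fres σ T - H T - (fres σ 1 - H 1)‖ + ‖H T‖ + ‖fres σ 1‖ + ‖H 1‖ :=
        by
          refine (norm_sub_le _ _).trans ?_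
          gcongr
          exact norm_add₃_le
    _ ≤ 3 := by
        linarith [hHn T h1, hHn 1 le_rfl, fres_small σ 1 zero_le_one le_rfl, this.trans hB]

lemma fres_neg (σ T : ℝ) : fres σ (-T) = - fres σ T := by
  unfold fres
  have := intervalIntegral.integral_comp_neg (a := 0) (b := T)
    (fun s : ℝ => Complex.exp (Complex.I * ((σ * s ^ 2 : ℝ) : ℂ)))
  simp only [neg_zero, neg_sq] at this
  rw [this, intervalIntegral.integral_symm]

lemma fres_bound (σ T : ℝ) (hσ : |σ| = 1) : ‖fres σ T‖ ≤ 3 := by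
  have pos : ∀ T, 0 ≤ T → ‖fres σ T‖ ≤ 3 := by
    intro T hT
    rcases le_total T 1 with h | h
    · linarith [fres_small σ T hT h]
    · exact fres_large σ T hσ h
  rcases le_total 0 T with h | h
  · exact pos T h
  · have := pos (-T) (by linarith)
    rwa [fres_neg, norm_neg] at this

/-- One-dimensional van der Corput estimate for quadratic phases. -/
lemma vdc_s1 (a a' : ℝ → ℝ) (ha : ∀ s, HasDerivAt a (a' s) s) (hai : Integrable a)
    (hai' : Integrable a') (l y : ℝ) (hl : l ≠ 0) :
    ‖∫ s : ℝ, Complex.exp (Complex.I * ((l * s ^ 2 + y * s : ℝ) : ℂ)) * (a s : ℂ)‖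
      ≤ 3 / √|l| * ∫ s, |a' s| := by
  have hl' : 0 < |l| := abs_pos.2 hl
  set r := √|l| with hr
  have hr0 : 0 < r := Real.sqrt_pos.2 hl'
  have hr2 : r ^ 2 = |l| := Real.sq_sqrt hl'.le
  set σ := l / |l| with hσd
  have hσ : |σ| = 1 := by rw [hσd, abs_div, abs_abs, div_self hl'.ne']
  have hσl : σ * r ^ 2 = l := by rw [hr2, hσd, div_mul_cancel₀ _ hl'.ne']
  set c := y / (2 * l) with hc
  set k : ℂ := Complex.exp (Complex.I * ((-(l * c ^ 2) : ℝ) : ℂ)) with hk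
  set F : ℝ → ℂ := fun s => k * ((r : ℂ)⁻¹ * fres σ (r * (s + c))) with hF
  have hFd : ∀ s, HasDerivAt F (Complex.exp (Complex.I * ((l * s ^ 2 + y * s : ℝ) : ℂ))) s := by
    intro s
    have h1 : HasDerivAt (fun s => r * (s + c)) r s := by
      simpa using ((hasDerivAt_id s).add_const c).const_mul r
    have h2 := (((fres_deriv σ (r * (s + c))).scomp s h1).const_mul (r : ℂ)⁻¹).const_mul k
    refine h2.congr_deriv ?_
    have hrc : (r : ℂ) ≠ 0 := by exact_mod_cast hr0.ne'
    rw [Complex.real_smul, inv_mul_cancel_left₀ hrc, hk, ← Complex.exp_add, ← mul_add,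
      ← Complex.ofReal_add]
    congr 3
    have : σ * (r * (s + c)) ^ 2 = l * (s + c) ^ 2 := by rw [mul_pow, ← mul_assoc, hσl]
    rw [this, hc]
    field_simp
    ring
  have hFn : ∀ s, ‖F s‖ ≤ 3 / r := by
    intro s
    simp only [hF, norm_mul, hk, fres_norm_one, norm_inv, Complex.norm_real, Real.norm_eq_abs,
      abs_of_pos hr0, one_mul]
    rw [div_eq_inv_mul]
    gcongr
    exact fres_bound _ _ hσ
  have hFc : Continuous F := continuous_iff_continuousAt.2 fun s => (hFd s).continuousAt
  have hEc : Continuous fun s : ℝ => Complex.exp (Complex.I * ((l * s ^ 2 + y * s : ℝ) : ℂ)) := by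
    fun_prop
  have i1 : Integrable fun s => F s * ((a' s : ℝ) : ℂ) :=
    hai'.ofReal.bdd_mul hFc.aestronglyMeasurable (Filter.Eventually.of_forall hFn)
  have i2 : Integrable fun s =>
      Complex.exp (Complex.I * ((l * s ^ 2 + y * s : ℝ) : ℂ)) * (a s : ℂ) :=
    hai.ofReal.bdd_mul hEc.aestronglyMeasurable
      (Filter.Eventually.of_forall fun s => (fres_norm_one _).le)
  have i3 : Integrable fun s => F s * ((a s : ℝ) : ℂ) :=
    hai.ofReal.bdd_mul hFc.aestronglyMeasurable (Filter.Eventually.of_forall hFn)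
  have ibp := integral_mul_deriv_eq_deriv_mul_of_integrable (u := F) (v := fun s => (a s : ℂ))
    (fun s _ => hFd s) (fun s _ => (ha s).ofReal_comp) i1 i2 i3
  have : ∫ s : ℝ, Complex.exp (Complex.I * ((l * s ^ 2 + y * s : ℝ) : ℂ)) * (a s : ℂ)
      = - ∫ s, F s * ((a' s : ℝ) : ℂ) := by rw [ibp, neg_neg]
  rw [this, norm_neg, ← integral_const_mul]
  refine norm_integral_le_of_norm_le (hai'.abs.const_mul _) (Filter.Eventually.of_forall ?_)
  intro s
  rw [norm_mul, Complex.norm_real, Real.norm_eq_abs]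
  exact mul_le_mul_of_nonneg_right (hFn s) (abs_nonneg _)

lemma amp (f g : ℝ → ℝ) (hf : ContDiff ℝ 1 f) (hg : ContDiff ℝ 1 g) (hfc : HasCompactSupport f)
    (hf1 : ∀ s, |f s| ≤ 1) (hg1 : ∀ s, |g s| ≤ 1)
    (hg' : Integrable (deriv g)) (M r : ℝ) (hM : 0 < M) (hr : 0 < r) (l y : ℝ) (hl : l ≠ 0) :
    ‖∫ s : ℝ, Complex.exp (Complex.I * ((l * s ^ 2 + y * s : ℝ) : ℂ))
        * ((f (s / M) * g (s / r) : ℝ) : ℂ)‖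
      ≤ 3 / √|l| * ((∫ s, |deriv f s|) + ∫ s, |deriv g s|) := by
  have hf' : Integrable (deriv f) :=
    (hf.continuous_deriv le_rfl).integrable_of_hasCompactSupport hfc.deriv
  have hd : ∀ (h : ℝ → ℝ), ContDiff ℝ 1 h → ∀ R s : ℝ,
      HasDerivAt (fun s => h (s / R)) (deriv h (s / R) * (1 / R)) s := by
    intro h hh R s
    exact ((hh.differentiable one_ne_zero (s / R)).hasDerivAt).comp s
      ((hasDerivAt_id s).div_const R)
  have hi : ∀ (h : ℝ → ℝ), Integrable h → ∀ R : ℝ, 0 < R →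
      Integrable (fun s => |h (s / R)| * (1 / R)) ∧
      ∫ s, |h (s / R)| * (1 / R) = ∫ s, |h s| := by
    intro h hh R hR
    refine ⟨((hh.comp_div hR.ne').abs).mul_const _, ?_⟩
    rw [integral_mul_const, Measure.integral_comp_div (fun s => |h s|) R, abs_of_pos hR,
      smul_eq_mul]
    field_simp
  have fc : Continuous fun s => f (s / M) := hf.continuous.comp (continuous_id.div_const M)
  have gc : Continuous fun s => g (s / r) := hg.continuous.comp (continuous_id.div_const r)
  have hfi : Integrable f := hf.continuous.integrable_of_hasCompactSupport hfc
  have ia : Integrable fun s => f (s / M) * g (s / r) :=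
    (hfi.comp_div hM.ne').mul_bdd gc.aestronglyMeasurable
      (Filter.Eventually.of_forall fun s => hg1 _)
  have j1 := hi _ hf' M hM
  have j2 := hi _ hg' r hr
  have hpt : ∀ s, |deriv f (s / M) * (1 / M) * g (s / r) + f (s / M) * (deriv g (s / r) * (1 / r))|
      ≤ |deriv f (s / M)| * (1 / M) + |deriv g (s / r)| * (1 / r) := by
    intro s
    refine (abs_add_le _ _).trans (add_le_add ?_ ?_)
    · rw [abs_mul, abs_mul, abs_of_pos (one_div_pos.2 hM)]
      exact mul_le_of_le_one_right (by positivity) (hg1 _)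
    · rw [abs_mul, abs_mul, abs_of_pos (one_div_pos.2 hr)]
      exact mul_le_of_le_one_left (by positivity) (hf1 _)
  have dfc := (hf.continuous_deriv le_rfl).comp (continuous_id.div_const M)
  have dgc := (hg.continuous_deriv le_rfl).comp (continuous_id.div_const r)
  have ia' : Integrable fun s =>
      deriv f (s / M) * (1 / M) * g (s / r) + f (s / M) * (deriv g (s / r) * (1 / r)) := by
    refine (j1.1.add j2.1).mono' ?_ (Filter.Eventually.of_forall hpt)
    exact (((dfc.mul continuous_const).mul gc).add
      (fc.mul (dgc.mul continuous_const))).aestronglyMeasurable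
  refine (vdc_s1 _ _ (fun s => (hd f hf M s).mul (hd g hg r s)) ia ia' l y hl).trans ?_
  refine mul_le_mul_of_nonneg_left ?_ (by positivity)
  rw [← j1.2, ← j2.2, ← integral_add j1.1 j2.1]
  exact integral_mono ia'.abs (j1.1.add j2.1) hpt

theorem stmt1 (α : ℝ) (hα : α ∈ Icc (1:ℝ) 2) (δ : ℝ) (hδ : δ ∈ Ioo (0:ℝ) 1)
    (χ ρ : ℝ → ℝ)
    (hχs : ContDiff ℝ (⊤ : ℕ∞) χ)
    (hχ01 : ∀ x, χ x ∈ Icc (0:ℝ) 1)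
    (hχ1 : ∀ x, |x| ≤ 4/3 → χ x = 1)
    (hχ0 : ∀ x, 5/3 < |x| → χ x = 0)
    (hρs : ContDiff ℝ (⊤ : ℕ∞) ρ)
    (hρ01 : ∀ x, ρ x ∈ Icc (0:ℝ) 1)
    (hρ0 : ∀ x, |x| ≤ 1/2 → ρ x = 0)
    (hρ1 : ∀ x, 1 ≤ |x| → ρ x = 1) :
    ∃ C > (0:ℝ), ∀ N M : ℝ, (∃ k : ℕ, N = 2 ^ k) → 2 ≤ N → (∃ k : ℕ, M = 2 ^ k) →
      ∀ t : ℝ, t ≠ 0 → ∀ x y : ℝ,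
      ‖∫ ζ : ℝ × ℝ,
          Complex.exp (Complex.I *
              ((t * (ζ.1 * (|ζ.1| ^ α + ζ.2 ^ 2)) + x * ζ.1 + y * ζ.2 : ℝ) : ℂ))
            * ((χ (ζ.1 / N) - χ (2 * ζ.1 / N) : ℝ) : ℂ)
            * ((χ (ζ.2 / M) : ℝ) : ℂ)
            * (if ζ.1 = 0 then (0:ℂ)
               else ((ρ ((α * (α + 1) / 2 - ζ.2 ^ 2 / |ζ.1| ^ α) / δ) : ℝ) : ℂ))‖
        ≤ C * N ^ ((1:ℝ)/2) * |t| ^ (-(1:ℝ)/2) := by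
  set b := α * (α + 1) / 2 with hb
  set g : ℝ → ℝ := fun s => ρ ((b - s ^ 2) / δ) with hg
  have hχs1 : ContDiff ℝ 1 χ := hχs.of_le (by exact_mod_cast le_top)
  have hρs1 : ContDiff ℝ 1 ρ := hρs.of_le (by exact_mod_cast le_top)
  have hgs : ContDiff ℝ 1 g := by
    apply hρs1.comp
    fun_prop
  have habs : ∀ u : ℝ, u ∈ Icc (0:ℝ) 1 → |u| ≤ 1 := fun u hu =>
    abs_le.2 ⟨by linarith [hu.1], hu.2⟩
  have hχc : HasCompactSupport χ := by
    refine HasCompactSupport.intro (isCompact_Icc (a := -(5/3 : ℝ)) (b := 5/3)) ?_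
    intro s hs
    apply hχ0
    by_contra h
    exact hs (abs_le.1 (not_lt.1 h))
  have hb0 : 0 < b := by
    have := hα.1
    have : 0 < α := by linarith
    positivity
  have hgc : HasCompactSupport (fun s => g s - 1) := by
    refine HasCompactSupport.intro (isCompact_Icc (a := -(b + 1)) (b := b + 1)) ?_
    intro s hs
    have h1 : b + 1 < |s| := by
      by_contra h
      exact hs (abs_le.1 (not_lt.1 h))
    have h2 : b + 1 ≤ s ^ 2 := by
      rw [← sq_abs]; nlinarith
    simp only [hg]
    rw [hρ1, sub_self]
    rw [abs_div, abs_of_pos hδ.1, le_div_iff₀ hδ.1, abs_of_neg (by linarith)]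
    linarith [hδ.2]
  have hgi : Integrable (deriv g) := by
    have h1 := hgc.deriv
    have h2 : deriv (fun s => g s - 1) = deriv g := by
      funext s; exact deriv_sub_const _
    rw [h2] at h1
    exact (hgs.continuous_deriv le_rfl).integrable_of_hasCompactSupport h1
  set L := (∫ s, |deriv χ s|) + ∫ s, |deriv g s| with hL
  have hL0 : 0 ≤ L := by positivity
  refine ⟨20 * L + 1, by positivity, ?_⟩
  rintro N M - hN ⟨k, rfl⟩ t ht x y
  have hM : (0:ℝ) < 2 ^ k := by positivity
  have hN0 : 0 < N := by linarith
  have ht0 : 0 < |t| := abs_pos.2 ht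
  set M : ℝ := 2 ^ k
  have hR : (20 * L + 1) * N ^ ((1:ℝ)/2) * |t| ^ (-(1:ℝ)/2)
      = (20 * L + 1) * √N / √|t| := by
    rw [neg_div, Real.rpow_neg ht0.le, ← Real.sqrt_eq_rpow, ← Real.sqrt_eq_rpow, div_eq_mul_inv]
  rw [hR]
  have hsN : 0 < √N := Real.sqrt_pos.2 hN0
  have hst : 0 < √|t| := Real.sqrt_pos.2 ht0
  set Φ : ℝ × ℝ → ℂ := fun ζ => Complex.exp (Complex.I *
              ((t * (ζ.1 * (|ζ.1| ^ α + ζ.2 ^ 2)) + x * ζ.1 + y * ζ.2 : ℝ) : ℂ))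
            * ((χ (ζ.1 / N) - χ (2 * ζ.1 / N) : ℝ) : ℂ)
            * ((χ (ζ.2 / M) : ℝ) : ℂ)
            * (if ζ.1 = 0 then (0:ℂ)
               else ((ρ ((b - ζ.2 ^ 2 / |ζ.1| ^ α) / δ) : ℝ) : ℂ)) with hΦ
  change ‖∫ ζ : ℝ × ℝ, Φ ζ‖ ≤ _
  by_cases hΦi : Integrable Φ
  swap
  · rw [integral_undef hΦi, norm_zero]; positivity
  rw [Measure.volume_eq_prod] at hΦi ⊢
  rw [integral_prod _ hΦi]
  set D : ℝ := 6 / (√|t| * √N) * L with hD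
  have hD0 : 0 ≤ D := by positivity
  have hin : ∀ ξ : ℝ, ‖∫ μ, Φ (ξ, μ)‖ ≤ (Icc (-(5 * N / 3)) (5 * N / 3)).indicator (fun _ => D) ξ := by
    intro ξ
    by_cases h1 : |ξ| ≤ 2 * N / 3
    · have e1 : χ (ξ / N) = 1 := by
        apply hχ1
        rw [abs_div, abs_of_pos hN0, div_le_iff₀ hN0]; linarith
      have e2 : χ (2 * ξ / N) = 1 := by
        apply hχ1
        rw [abs_div, abs_mul, abs_two, abs_of_pos hN0, div_le_iff₀ hN0]; linarith
      simp only [hΦ, e1, e2, sub_self, Complex.ofReal_zero, mul_zero, zero_mul, integral_zero,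
        norm_zero]
      exact indicator_nonneg (fun _ _ => hD0) _
    by_cases h2 : |ξ| ≤ 5 * N / 3
    swap
    · have e1 : χ (ξ / N) = 0 := by
        apply hχ0
        rw [abs_div, abs_of_pos hN0, lt_div_iff₀ hN0]; linarith
      have e2 : χ (2 * ξ / N) = 0 := by
        apply hχ0
        rw [abs_div, abs_mul, abs_two, abs_of_pos hN0, lt_div_iff₀ hN0]; linarith
      simp only [hΦ, e1, e2, sub_self, Complex.ofReal_zero, mul_zero, zero_mul, integral_zero,
        norm_zero]
      exact indicator_nonneg (fun _ _ => hD0) _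
    rw [indicator_of_mem (show ξ ∈ Icc (-(5 * N / 3)) (5 * N / 3) from abs_le.1 h2)]
    push Not at h1
    have hξa : 0 < |ξ| := by linarith
    have hξ0 : ξ ≠ 0 := abs_pos.1 hξa
    have hq : 0 < |ξ| ^ α := Real.rpow_pos_of_pos hξa α
    set q := |ξ| ^ α with hqd
    have hl : t * ξ ≠ 0 := mul_ne_zero ht hξ0
    have key := amp χ g hχs1 hgs hχc (fun s => habs _ (hχ01 s)) (fun s => habs _ (hρ01 _)) hgi
      M (√q) hM (Real.sqrt_pos.2 hq) (t * ξ) y hl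
    have hrew : ∀ μ, Φ (ξ, μ) =
        (Complex.exp (Complex.I * ((t * (ξ * q) + x * ξ : ℝ) : ℂ)) *
          ((χ (ξ / N) - χ (2 * ξ / N) : ℝ) : ℂ)) *
        (Complex.exp (Complex.I * ((t * ξ * μ ^ 2 + y * μ : ℝ) : ℂ))
        * ((χ (μ / M) * g (μ / √q) : ℝ) : ℂ)) := by
      intro μ
      have e : ((t * (ξ * (q + μ ^ 2)) + x * ξ + y * μ : ℝ) : ℂ)
        = ((t * (ξ * q) + x * ξ : ℝ) : ℂ) + ((t * ξ * μ ^ 2 + y * μ : ℝ) : ℂ) := by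
        push_cast; ring
      have e2 : (μ / √q) ^ 2 = μ ^ 2 / q := by rw [div_pow, Real.sq_sqrt hq.le]
      have e3 : Complex.exp (Complex.I * ((t * (ξ * (q + μ ^ 2)) + x * ξ + y * μ : ℝ) : ℂ))
        = Complex.exp (Complex.I * ((t * (ξ * q) + x * ξ : ℝ) : ℂ)) *
          Complex.exp (Complex.I * ((t * ξ * μ ^ 2 + y * μ : ℝ) : ℂ)) := by
        rw [e, mul_add, Complex.exp_add]
      simp only [hΦ, hg, if_neg hξ0, ← hqd]
      rw [e3, e2, Complex.ofReal_mul (χ (μ / M))]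
      ring
    simp only [hrew]
    rw [integral_const_mul, norm_mul, norm_mul, fres_norm_one, one_mul, Complex.norm_real,
      Real.norm_eq_abs]
    have hφ : |χ (ξ / N) - χ (2 * ξ / N)| ≤ 1 := by
      have p := hχ01 (ξ / N)
      have p' := hχ01 (2 * ξ / N)
      exact abs_le.2 ⟨by linarith [p.1, p'.2], by linarith [p.2, p'.1]⟩
    refine (mul_le_of_le_one_left (norm_nonneg _) hφ).trans (key.trans ?_)
    rw [hD]
    refine mul_le_mul_of_nonneg_right ?_ hL0
    have hs : √|t| * √N / 2 ≤ √|t * ξ| := by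
      apply Real.le_sqrt_of_sq_le
      rw [div_pow, mul_pow, Real.sq_sqrt ht0.le, Real.sq_sqrt hN0.le, abs_mul]
      nlinarith
    calc 3 / √|t * ξ| ≤ 3 / (√|t| * √N / 2) := by gcongr
      _ = 6 / (√|t| * √N) := by field_simp; norm_num
  have hii : Integrable ((Icc (-(5 * N / 3)) (5 * N / 3)).indicator (fun _ => D)) :=
    (integrable_indicator_iff measurableSet_Icc).2 (integrableOn_const (by simp))
  refine (norm_integral_le_of_norm_le hii (Filter.Eventually.of_forall hin)).trans ?_
  rw [integral_indicator_const _ measurableSet_Icc, Real.volume_real_Icc_of_le (by linarith),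
    smul_eq_mul, hD]
  have hNN : N = √N * √N := (Real.mul_self_sqrt hN0.le).symm
  have : (5 * N / 3 - -(5 * N / 3)) * (6 / (√|t| * √N) * L) = 20 * L * √N / √|t| := by
    rw [show 5 * N / 3 - -(5 * N / 3) = 10 / 3 * (√N * √N) by rw [← hNN]; ring]
    field_simp
    ring
  rw [this]
  gcongr
  linarith
end
end

section
/- Let α ∈ [1,2]. There is a constant C = C(α) > 0 such that for every dyadic number N ≥ 2, every dyadic number M ≥ 1, every t ≠ 0 and every (x,y) ∈ ℝ², the oscillatory integral Ĩ_t^{N,M}(x,y) = ∫_{ℝ²} e^{i(tω(ξ,μ)+xξ+yμ)} φ_N(ξ) φ_{≤M}(μ) dξ dμ satisfies |Ĩ_t^{N,M}(x,y)| ≤ C N^{1/6 − α/3} |t|^{−5/6} (uniformly in M, x and y). -/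
open MeasureTheory Set

noncomputable section


lemma vdc_split (f : ℝ → ℂ) (g : ℝ → ℝ) (a b l d A : ℝ) (hab : a ≤ b) (hl : 0 < l) (hd : 0 < d)
    (hA : 0 ≤ A) (hf : ContinuousOn f (Icc a b)) (hf1 : ∀ x, ‖f x‖ ≤ 1)
    (hg : ContinuousOn g (Icc a b))
    (hgm : ∀ u ∈ Icc a b, ∀ v ∈ Icc a b, u ≤ v → l * (v - u) ≤ g v - g u)
    (h1 : ∀ u v, a ≤ u → u ≤ v → v ≤ b → (∀ x ∈ Icc u v, g x ≤ -(l * d)) →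
      ‖∫ x in u..v, f x‖ ≤ A)
    (h2 : ∀ u v, a ≤ u → u ≤ v → v ≤ b → (∀ x ∈ Icc u v, l * d ≤ g x) →
      ‖∫ x in u..v, f x‖ ≤ A) :
    ‖∫ x in a..b, f x‖ ≤ 2 * A + 2 * d := by
  have hp : ∃ p ∈ Icc a b, (p = a ∨ g p ≤ 0) ∧ (p = b ∨ 0 ≤ g p) := by
    by_cases ha : 0 ≤ g a
    · exact ⟨a, ⟨le_rfl, hab⟩, Or.inl rfl, Or.inr ha⟩
    by_cases hb : g b ≤ 0
    · exact ⟨b, ⟨hab, le_rfl⟩, Or.inr hb, Or.inl rfl⟩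
    push Not at ha hb
    obtain ⟨p, hp, h0⟩ := intermediate_value_Icc hab hg ⟨ha.le, hb.le⟩
    exact ⟨p, hp, Or.inr h0.le, Or.inr h0.ge⟩
  obtain ⟨p, ⟨hpa, hpb⟩, hp1, hp2⟩ := hp
  have hc1 : a ≤ max a (p - d) := le_max_left _ _
  have hc2 : max a (p - d) ≤ p := max_le hpa (by linarith)
  have hd1 : p ≤ min b (p + d) := le_min hpb (by linarith)
  have hd2 : min b (p + d) ≤ b := min_le_left _ _
  have hc3 : p - d ≤ max a (p - d) := le_max_right _ _
  have hd3 : min b (p + d) ≤ p + d := min_le_right _ _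
  have hi : ∀ u v, a ≤ u → u ≤ v → v ≤ b → IntervalIntegrable f volume u v := by
    intro u v hu huv hv
    apply ContinuousOn.intervalIntegrable
    rw [uIcc_of_le huv]
    exact hf.mono (Icc_subset_Icc hu hv)
  have e1 : ‖∫ x in a..(max a (p - d)), f x‖ ≤ A := by
    rcases le_total (p - d) a with h | h
    · rw [max_eq_left h]; simpa using hA
    · rw [max_eq_right h]
      refine h1 _ _ le_rfl h (by linarith) ?_
      rintro x ⟨hx1, hx2⟩
      have := hgm x ⟨hx1, by linarith⟩ p ⟨hpa, hpb⟩ (by linarith)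
      rcases hp1 with h' | h'
      · linarith
      · nlinarith
  have e2 : ‖∫ x in (min b (p + d))..b, f x‖ ≤ A := by
    rcases le_total b (p + d) with h | h
    · rw [min_eq_left h]; simpa using hA
    · rw [min_eq_right h]
      refine h2 _ _ (by linarith) h le_rfl ?_
      rintro x ⟨hx1, hx2⟩
      have := hgm p ⟨hpa, hpb⟩ x ⟨by linarith, hx2⟩ (by linarith)
      rcases hp2 with h' | h'
      · linarith
      · nlinarith
  have e3 : ‖∫ x in (max a (p - d))..(min b (p + d)), f x‖ ≤ 2 * d := by
    refine (intervalIntegral.norm_integral_le_of_norm_le_const (C := 1) (fun x _ => hf1 x)).trans ?_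
    rw [one_mul, abs_of_nonneg (by linarith)]
    linarith
  have s1 := intervalIntegral.integral_add_adjacent_intervals
    (hi a (max a (p - d)) le_rfl hc1 (by linarith))
    (hi (max a (p - d)) (min b (p + d)) hc1 (by linarith) hd2)
  have s2 := intervalIntegral.integral_add_adjacent_intervals
    (hi a (min b (p + d)) le_rfl (by linarith) hd2)
    (hi (min b (p + d)) b (by linarith) hd2 le_rfl)
  rw [← s2, ← s1]
  refine (norm_add_le _ _).trans ?_
  have := norm_add_le (∫ x in a..(max a (p - d)), f x) (∫ x in (max a (p - d))..(min b (p + d)), f x)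
  linarith

lemma vdc_conj (p : ℝ → ℝ) (a b : ℝ) :
    ‖∫ x in a..b, Complex.exp (Complex.I * ((-p x : ℝ) : ℂ))‖ =
      ‖∫ x in a..b, Complex.exp (Complex.I * (p x : ℂ))‖ := by
  rw [← RCLike.norm_conj (∫ x in a..b, Complex.exp (Complex.I * (p x : ℂ)))]
  congr 1
  have h : ∀ x, Complex.exp (Complex.I * ((-p x : ℝ) : ℂ)) =
      (starRingEnd ℂ) (Complex.exp (Complex.I * (p x : ℂ))) := by
    intro x
    rw [← Complex.exp_conj]
    simp
  simp only [h, intervalIntegral, integral_conj, map_sub]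

lemma norm_expI (x : ℝ) : ‖Complex.exp (Complex.I * (x : ℂ))‖ = 1 := by
  rw [mul_comm]; exact Complex.norm_exp_ofReal_mul_I x

lemma vdc_one (p p1 p2 : ℝ → ℝ) (a b l : ℝ) (hab : a ≤ b) (hl : 0 < l)
    (hp : ∀ x ∈ Icc a b, HasDerivAt p (p1 x) x) (hp1 : ∀ x ∈ Icc a b, HasDerivAt p1 (p2 x) x)
    (hp2 : ContinuousOn p2 (Icc a b)) (hpos : ∀ x ∈ Icc a b, 0 ≤ p2 x)
    (hlow : (∀ x ∈ Icc a b, l ≤ p1 x) ∨ (∀ x ∈ Icc a b, p1 x ≤ -l)) :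
    ‖∫ x in a..b, Complex.exp (Complex.I * (p x : ℂ))‖ ≤ 4 / l := by
  have habs : ∀ x ∈ Icc a b, l ≤ |p1 x| := by
    intro x hx
    rcases hlow with h | h
    · exact (h x hx).trans (le_abs_self _)
    · have := h x hx
      exact (by linarith : l ≤ - p1 x).trans (neg_le_abs _)
  have hne : ∀ x ∈ Icc a b, p1 x ≠ 0 := by
    intro x hx h
    have := habs x hx
    rw [h, abs_zero] at this
    linarith
  have hcp : ContinuousOn p (Icc a b) := fun x hx => (hp x hx).continuousAt.continuousWithinAt
  have hcp1 : ContinuousOn p1 (Icc a b) := fun x hx => (hp1 x hx).continuousAt.continuousWithinAt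
  have hE : ContinuousOn (fun x => Complex.exp (Complex.I * (p x : ℂ))) (Icc a b) := by
    fun_prop
  have hQ : ContinuousOn (fun x => p2 x / p1 x ^ 2) (Icc a b) :=
    hp2.div (hcp1.pow 2) (fun x hx => pow_ne_zero 2 (hne x hx))
  have hR : ContinuousOn (fun x => Complex.exp (Complex.I * (p x : ℂ)) *
      ((p2 x / p1 x ^ 2 : ℝ) : ℂ) * Complex.I) (Icc a b) := by
    fun_prop
  have hI : ∀ {E : Type} [NormedAddCommGroup E] (f : ℝ → E), ContinuousOn f (Icc a b) → IntervalIntegrable f volume a b := by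
    intro E _ f hf
    apply ContinuousOn.intervalIntegrable
    rwa [uIcc_of_le hab]
  have hF : ∀ x ∈ uIcc a b, HasDerivAt
      (fun x => -Complex.I * Complex.exp (Complex.I * (p x : ℂ)) * (((p1 x)⁻¹ : ℝ) : ℂ))
      (Complex.exp (Complex.I * (p x : ℂ)) +
        Complex.exp (Complex.I * (p x : ℂ)) * ((p2 x / p1 x ^ 2 : ℝ) : ℂ) * Complex.I) x := by
    intro x hx
    rw [uIcc_of_le hab] at hx
    have d1 : HasDerivAt (fun x => Complex.exp (Complex.I * (p x : ℂ)))
        (Complex.exp (Complex.I * (p x : ℂ)) * (Complex.I * (p1 x : ℂ))) x :=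
      (((hp x hx).ofReal_comp).const_mul Complex.I).cexp
    have d2 : HasDerivAt (fun x => (((p1 x)⁻¹ : ℝ) : ℂ)) ((-(p2 x) / p1 x ^ 2 : ℝ) : ℂ) x :=
      ((hp1 x hx).inv (hne x hx)).ofReal_comp
    refine ((d1.const_mul (-Complex.I)).mul d2).congr_deriv ?_
    have h0 : (p1 x : ℂ) ≠ 0 := by exact_mod_cast hne x hx
    push_cast
    field_simp
    linear_combination (-(p1 x : ℂ) ^ 2) * Complex.I_mul_I
  have key := intervalIntegral.integral_eq_sub_of_hasDerivAt hF
    ((hI _ hE).add (hI _ hR))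
  rw [intervalIntegral.integral_add (hI _ hE) (hI _ hR)] at key
  have hG : ∀ x ∈ uIcc a b, HasDerivAt (fun x => -(p1 x)⁻¹) (p2 x / p1 x ^ 2) x := by
    intro x hx
    rw [uIcc_of_le hab] at hx
    refine ((hp1 x hx).inv (hne x hx)).neg.congr_deriv ?_
    ring
  have key2 := intervalIntegral.integral_eq_sub_of_hasDerivAt hG (hI _ hQ)
  have hrest : ‖∫ x in a..b, Complex.exp (Complex.I * (p x : ℂ)) *
      ((p2 x / p1 x ^ 2 : ℝ) : ℂ) * Complex.I‖ ≤ ∫ x in a..b, p2 x / p1 x ^ 2 := by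
    refine intervalIntegral.norm_integral_le_of_norm_le hab ?_ (hI _ hQ)
    refine Filter.Eventually.of_forall fun x hx => ?_
    have hx' : x ∈ Icc a b := Ioc_subset_Icc_self hx
    rw [norm_mul, norm_mul, norm_expI, Complex.norm_I, Complex.norm_real, Real.norm_eq_abs,
      abs_of_nonneg (div_nonneg (hpos x hx') (sq_nonneg _))]
    simp
  have hinv : ∀ x ∈ Icc a b, |(p1 x)⁻¹| ≤ 1 / l := by
    intro x hx
    rw [abs_inv, one_div]
    exact inv_anti₀ hl (habs x hx)
  have hFn : ∀ x ∈ Icc a b,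
      ‖-Complex.I * Complex.exp (Complex.I * (p x : ℂ)) * (((p1 x)⁻¹ : ℝ) : ℂ)‖ ≤ 1 / l := by
    intro x hx
    rw [norm_mul, norm_mul, norm_expI, norm_neg, Complex.norm_I, Complex.norm_real, Real.norm_eq_abs]
    simpa using hinv x hx
  have ha : a ∈ Icc a b := ⟨le_rfl, hab⟩
  have hb : b ∈ Icc a b := ⟨hab, le_rfl⟩
  rw [eq_sub_of_add_eq key]
  refine (norm_sub_le _ _).trans ?_
  have h3 := norm_sub_le (-Complex.I * Complex.exp (Complex.I * (p b : ℂ)) * (((p1 b)⁻¹ : ℝ) : ℂ))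
    (-Complex.I * Complex.exp (Complex.I * (p a : ℂ)) * (((p1 a)⁻¹ : ℝ) : ℂ))
  have h4 := hFn a ha
  have h5 := hFn b hb
  have h6 := abs_le.1 (hinv a ha)
  have h7 := abs_le.1 (hinv b hb)
  have : 4 / l = 4 * (1 / l) := by ring
  linarith

lemma vdc_two (p p1 p2 : ℝ → ℝ) (a b l : ℝ) (hab : a ≤ b) (hl : 0 < l)
    (hp : ∀ x ∈ Icc a b, HasDerivAt p (p1 x) x) (hp1 : ∀ x ∈ Icc a b, HasDerivAt p1 (p2 x) x)
    (hp2 : ContinuousOn p2 (Icc a b)) (hpos : ∀ x ∈ Icc a b, l ^ 2 ≤ p2 x) :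
    ‖∫ x in a..b, Complex.exp (Complex.I * (p x : ℂ))‖ ≤ 10 / l := by
  have hcp : ContinuousOn p (Icc a b) := fun x hx => (hp x hx).continuousAt.continuousWithinAt
  have hcp1 : ContinuousOn p1 (Icc a b) := fun x hx => (hp1 x hx).continuousAt.continuousWithinAt
  have hll : l ^ 2 * (1 / l) = l := by field_simp
  have := vdc_split (fun x => Complex.exp (Complex.I * (p x : ℂ))) p1 a b (l ^ 2) (1 / l) (4 / l)
    hab (by positivity) (by positivity) (by positivity) (by fun_prop)
    (fun x => (norm_expI _).le) hcp1 ?_ ?_ ?_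
  · refine this.trans (le_of_eq ?_); ring
  · intro u hu v hv huv
    refine (convex_Icc a b).mul_sub_le_image_sub_of_le_deriv hcp1 ?_ ?_ u hu v hv huv
    · intro x hx
      exact (hp1 x (interior_subset hx)).differentiableAt.differentiableWithinAt
    · intro x hx
      rw [(hp1 x (interior_subset hx)).deriv]
      exact hpos x (interior_subset hx)
  · intro u v hu huv hv h
    rw [hll] at h
    have hs := Icc_subset_Icc hu hv
    exact vdc_one p p1 p2 u v l huv hl (fun x hx => hp x (hs hx)) (fun x hx => hp1 x (hs hx))
      (hp2.mono hs) (fun x hx => (sq_nonneg l).trans (hpos x (hs hx))) (Or.inr h)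
  · intro u v hu huv hv h
    rw [hll] at h
    have hs := Icc_subset_Icc hu hv
    exact vdc_one p p1 p2 u v l huv hl (fun x hx => hp x (hs hx)) (fun x hx => hp1 x (hs hx))
      (hp2.mono hs) (fun x hx => (sq_nonneg l).trans (hpos x (hs hx))) (Or.inl h)

lemma phase_pos (α : ℝ) (hα : α ∈ Icc (1:ℝ) 2) (s X B : ℝ) (hs : 0 < s) (w : ℝ) (hw : w ∈ Icc (1/2:ℝ) 2) :
    ‖∫ x in (1/2:ℝ)..w, Complex.exp (Complex.I * ((s ^ 3 * x ^ (α + 1) + X * x - B / x : ℝ) : ℂ))‖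
      ≤ 82 / s := by
  obtain ⟨hα1, hα2⟩ := hα
  obtain ⟨hw1, hw2⟩ := hw
  set p : ℝ → ℝ := fun x => s ^ 3 * x ^ (α + 1) + X * x - B / x with hp
  set p1 : ℝ → ℝ := fun x => s ^ 3 * (α + 1) * x ^ α + X + B / x ^ 2 with hp1
  set g : ℝ → ℝ := fun x => s ^ 3 * (α * (α + 1)) * x ^ (α + 2) - 2 * B with hg
  set p2 : ℝ → ℝ := fun x => g x / x ^ 3 with hp2
  have hpos : ∀ x ∈ Icc (1/2:ℝ) w, 0 < x := fun x hx => by linarith [hx.1]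
  have dp : ∀ x ∈ Icc (1/2:ℝ) w, HasDerivAt p (p1 x) x := by
    intro x hx
    have h0 := hpos x hx
    have d1 : HasDerivAt (fun x : ℝ => x ^ (α + 1)) ((α + 1) * x ^ (α + 1 - 1)) x :=
      Real.hasDerivAt_rpow_const (Or.inl h0.ne')
    have d2 := (hasDerivAt_inv h0.ne').const_mul B
    have d3 := (hasDerivAt_id x).const_mul X
    refine (((d1.const_mul (s ^ 3)).add d3).sub d2).congr_deriv ?_
    rw [add_sub_cancel_right]
    simp only [hp1]
    ring
  have dp1 : ∀ x ∈ Icc (1/2:ℝ) w, HasDerivAt p1 (p2 x) x := by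
    intro x hx
    have h0 := hpos x hx
    have d1 : HasDerivAt (fun x : ℝ => x ^ α) (α * x ^ (α - 1)) x :=
      Real.hasDerivAt_rpow_const (Or.inl h0.ne')
    have d2 := ((hasDerivAt_pow 2 x).inv (pow_ne_zero 2 h0.ne')).const_mul B
    refine (((d1.const_mul (s ^ 3 * (α + 1))).add_const X).add d2).congr_deriv ?_
    have e : x ^ (α + 2) = x ^ (α - 1) * x ^ 3 := by
      rw [← Real.rpow_natCast x 3, ← Real.rpow_add h0]; congr 1; push_cast; ring
    simp only [hp2, hg, e]
    field_simp
    push_cast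
    ring
  have dg : ∀ x ∈ Icc (1/2:ℝ) w, HasDerivAt g (s ^ 3 * (α * (α + 1)) * ((α + 2) * x ^ (α + 1))) x := by
    intro x hx
    have h0 := hpos x hx
    have d1 : HasDerivAt (fun x : ℝ => x ^ (α + 2)) ((α + 2) * x ^ (α + 2 - 1)) x :=
      Real.hasDerivAt_rpow_const (Or.inl h0.ne')
    rw [show α + 2 - 1 = α + 1 by ring] at d1
    exact (d1.const_mul _).sub_const _
  have cg : ContinuousOn g (Icc (1/2:ℝ) w) := fun x hx => (dg x hx).continuousAt.continuousWithinAt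
  have cp : ContinuousOn p (Icc (1/2:ℝ) w) := fun x hx => (dp x hx).continuousAt.continuousWithinAt
  have cp2 : ContinuousOn p2 (Icc (1/2:ℝ) w) :=
    cg.div (by fun_prop) (fun x hx => pow_ne_zero 3 (hpos x hx).ne')
  have hgd : ∀ x ∈ Icc (1/2:ℝ) w, s ^ 3 / 2 ≤ s ^ 3 * (α * (α + 1)) * ((α + 2) * x ^ (α + 1)) := by
    intro x hx
    have h1 : (1/8 : ℝ) ≤ x ^ (α + 1) := by
      calc (1/8 : ℝ) = (1/2) ^ (3:ℝ) := by norm_num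
        _ ≤ (1/2) ^ (α + 1) :=
          Real.rpow_le_rpow_of_exponent_ge (by norm_num) (by norm_num) (by linarith)
        _ ≤ x ^ (α + 1) := Real.rpow_le_rpow (by norm_num) hx.1 (by linarith)
    have h2 : 2 ≤ α * (α + 1) := by nlinarith
    have h3 : (3/8:ℝ) ≤ (α + 2) * x ^ (α + 1) := by nlinarith
    have h4 : (1/2 : ℝ) ≤ (α * (α + 1)) * ((α + 2) * x ^ (α + 1)) := by nlinarith
    have := mul_le_mul_of_nonneg_left h4 (pow_pos hs 3).le
    linarith
  have hld : s ^ 3 / 2 * (1 / s) = s ^ 2 / 2 := by field_simp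
  have hx3 : ∀ x ∈ Icc (1/2:ℝ) w, x ^ 3 ≤ 8 := by
    intro x hx
    calc x ^ 3 ≤ 2 ^ 3 := pow_le_pow_left₀ (hpos x hx).le (hx.2.trans hw2) 3
      _ = 8 := by norm_num
  have := vdc_split (fun x => Complex.exp (Complex.I * (p x : ℂ))) g (1/2) w (s ^ 3 / 2) (1 / s) (40 / s)
    hw1 (by positivity) (by positivity) (by positivity) (by fun_prop)
    (fun x => (norm_expI _).le) cg ?_ ?_ ?_
  · refine this.trans (le_of_eq ?_); ring
  · intro u hu v hv huv
    refine (convex_Icc (1/2:ℝ) w).mul_sub_le_image_sub_of_le_deriv cg ?_ ?_ u hu v hv huv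
    · intro x hx
      exact (dg x (interior_subset hx)).differentiableAt.differentiableWithinAt
    · intro x hx
      rw [(dg x (interior_subset hx)).deriv]
      exact hgd x (interior_subset hx)
  · intro u v hu huv hv h
    rw [hld] at h
    have hs' := Icc_subset_Icc hu hv
    rw [← vdc_conj]
    refine (vdc_two (fun x => -p x) (fun x => -p1 x) (fun x => -p2 x) u v (s / 4) huv (by positivity)
      (fun x hx => (dp x (hs' hx)).neg) (fun x hx => (dp1 x (hs' hx)).neg)
      (cp2.mono hs').neg ?_).trans (le_of_eq (by field_simp; norm_num))
    intro x hx
    have h0 := hpos x (hs' hx)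
    simp only [hp2]
    rw [← neg_div, le_div_iff₀ (by positivity)]
    nlinarith [h x hx, hx3 x (hs' hx), sq_nonneg s]
  · intro u v hu huv hv h
    rw [hld] at h
    have hs' := Icc_subset_Icc hu hv
    refine (vdc_two p p1 p2 u v (s / 4) huv (by positivity)
      (fun x hx => (dp x (hs' hx))) (fun x hx => (dp1 x (hs' hx)))
      (cp2.mono hs') ?_).trans (le_of_eq (by field_simp; norm_num))
    intro x hx
    have h0 := hpos x (hs' hx)
    simp only [hp2]
    rw [le_div_iff₀ (by positivity)]
    nlinarith [h x hx, hx3 x (hs' hx), sq_nonneg s]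

lemma phase_all (α : ℝ) (hα : α ∈ Icc (1:ℝ) 2) (T X B : ℝ) (hT : T ≠ 0) (w : ℝ) (hw : w ∈ Icc (1/2:ℝ) 2) :
    ‖∫ x in (1/2:ℝ)..w, Complex.exp (Complex.I * ((T * x ^ (α + 1) + X * x - B / x : ℝ) : ℂ))‖
      ≤ 82 * |T| ^ (-(1:ℝ)/3) := by
  have hT' : 0 < |T| := abs_pos.2 hT
  have hs : 0 < |T| ^ ((1:ℝ)/3) := by positivity
  have hs3 : (|T| ^ ((1:ℝ)/3)) ^ 3 = |T| := by
    rw [← Real.rpow_natCast, ← Real.rpow_mul hT'.le]; norm_num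
  have e : 82 * |T| ^ (-(1:ℝ)/3) = 82 / (|T| ^ ((1:ℝ)/3)) := by
    rw [neg_div, Real.rpow_neg hT'.le]; rfl
  rw [e]
  rcases lt_or_gt_of_ne hT with h | h
  · have := phase_pos α hα _ (-X) (-B) hs w hw
    rw [hs3, abs_of_neg h] at this
    rw [abs_of_neg h]
    rw [← vdc_conj]
    refine le_trans (le_of_eq ?_) this
    congr 1
    apply intervalIntegral.integral_congr
    intro x _
    dsimp only
    congr 3
    ring
  · have := phase_pos α hα _ X B hs w hw
    rw [hs3, abs_of_pos h] at this
    rw [abs_of_pos h]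
    exact this

lemma amp_bound (α : ℝ) (hα : α ∈ Icc (1:ℝ) 2) (b b' : ℝ → ℝ)
    (hb : ∀ x ∈ Icc (1/2:ℝ) 2, HasDerivAt b (b' x) x) (hb' : ContinuousOn b' (Icc (1/2:ℝ) 2)) :
    ∃ C ≥ (0:ℝ), ∀ T X B : ℝ, T ≠ 0 →
    ‖∫ x in (1/2:ℝ)..2, (b x : ℂ) *
      Complex.exp (Complex.I * ((T * x ^ (α + 1) + X * x - B / x : ℝ) : ℂ))‖
      ≤ C * |T| ^ (-(1:ℝ)/3) := by
  have hle : (1/2:ℝ) ≤ 2 := by norm_num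
  refine ⟨(|b 2| + ∫ x in (1/2:ℝ)..2, |b' x|) * 82, ?_, ?_⟩
  · have : 0 ≤ ∫ x in (1/2:ℝ)..2, |b' x| :=
      intervalIntegral.integral_nonneg hle (fun x _ => abs_nonneg _)
    positivity
  intro T X B hT
  set E : ℝ → ℂ := fun x => Complex.exp (Complex.I * ((T * x ^ (α + 1) + X * x - B / x : ℝ) : ℂ)) with hE
  have cE : ContinuousOn E (Ioi 0) := by
    have : ContinuousOn (fun x : ℝ => T * x ^ (α + 1) + X * x - B / x) (Ioi 0) := by
      refine ((ContinuousOn.const_smul ?_ T).add (by fun_prop)).sub ?_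
      · exact continuousOn_id.rpow_const (fun x hx => Or.inl (ne_of_gt hx))
      · exact continuousOn_const.div continuousOn_id (fun x hx => ne_of_gt hx)
    fun_prop
  have iE : ∀ w ∈ Icc (1/2:ℝ) 2, IntervalIntegrable E volume (1/2) w := by
    intro w hw
    apply ContinuousOn.intervalIntegrable
    rw [uIcc_of_le hw.1]
    exact cE.mono (fun x hx => lt_of_lt_of_le (by norm_num) hx.1)
  have dv : ∀ w ∈ uIcc (1/2:ℝ) 2, HasDerivAt (fun w => ∫ x in (1/2:ℝ)..w, E x) (E w) w := by
    intro w hw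
    rw [uIcc_of_le hle] at hw
    have hw0 : w ∈ Ioi (0:ℝ) := lt_of_lt_of_le (by norm_num) hw.1
    exact intervalIntegral.integral_hasDerivAt_right (iE w hw)
      (cE.stronglyMeasurableAtFilter isOpen_Ioi w hw0) (cE.continuousAt (isOpen_Ioi.mem_nhds hw0))
  have ib' : IntervalIntegrable b' volume (1/2) 2 := by
    apply ContinuousOn.intervalIntegrable
    rwa [uIcc_of_le hle]
  have icb' : IntervalIntegrable (fun x => (b' x : ℂ)) volume (1/2) 2 := by
    apply ContinuousOn.intervalIntegrable
    rw [uIcc_of_le hle]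
    fun_prop
  have key := intervalIntegral.integral_mul_deriv_eq_deriv_mul (a := (1/2:ℝ)) (b := 2)
    (u := fun x => (b x : ℂ)) (u' := fun x => (b' x : ℂ)) (v := fun w => ∫ x in (1/2:ℝ)..w, E x)
    (v' := E) (fun x hx => (hb x (by rwa [uIcc_of_le hle] at hx)).ofReal_comp) dv icb'
    (iE 2 ⟨hle, le_rfl⟩)
  rw [key, intervalIntegral.integral_same, mul_zero, sub_zero]
  have hv : ∀ w ∈ Icc (1/2:ℝ) 2, ‖∫ x in (1/2:ℝ)..w, E x‖ ≤ 82 * |T| ^ (-(1:ℝ)/3) :=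
    fun w hw => phase_all α hα T X B hT w hw
  refine (norm_sub_le _ _).trans ?_
  have h1 : ‖(b 2 : ℂ) * ∫ x in (1/2:ℝ)..2, E x‖ ≤ |b 2| * (82 * |T| ^ (-(1:ℝ)/3)) := by
    rw [norm_mul, Complex.norm_real, Real.norm_eq_abs]
    exact mul_le_mul_of_nonneg_left (hv 2 ⟨hle, le_rfl⟩) (abs_nonneg _)
  have h2 : ‖∫ x in (1/2:ℝ)..2, (b' x : ℂ) * ∫ y in (1/2:ℝ)..x, E y‖ ≤
      ∫ x in (1/2:ℝ)..2, |b' x| * (82 * |T| ^ (-(1:ℝ)/3)) := by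
    refine intervalIntegral.norm_integral_le_of_norm_le hle ?_ (ib'.abs.mul_const _)
    refine Filter.Eventually.of_forall fun x hx => ?_
    rw [norm_mul, Complex.norm_real, Real.norm_eq_abs]
    exact mul_le_mul_of_nonneg_left (hv x (Ioc_subset_Icc_self hx)) (abs_nonneg _)
  rw [intervalIntegral.integral_mul_const] at h2
  linarith

lemma exists_kernel (χ : ℝ → ℝ) (hχs : ContDiff ℝ (⊤ : ℕ∞) χ) (hc : HasCompactSupport χ) :
    ∃ h : ℝ → ℂ, Integrable h ∧ Continuous h ∧ ∀ v : ℝ,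
      (χ v : ℂ) = ∫ η : ℝ, Complex.exp (Complex.I * ((2 * Real.pi * η * v : ℝ) : ℂ)) * h η := by
  have hc' : HasCompactSupport (fun x => (χ x : ℂ)) := hc.comp_left (g := Complex.ofReal) rfl
  have hs' : ContDiff ℝ (⊤ : ℕ∞) (fun x => (χ x : ℂ)) := Complex.ofRealCLM.contDiff.comp hχs
  let f : SchwartzMap ℝ ℂ := hc'.toSchwartzMap hs'
  refine ⟨FourierTransform.fourier f, SchwartzMap.integrable _, SchwartzMap.continuous _, fun v => ?_⟩
  have h1 : FourierTransformInv.fourierInv (FourierTransform.fourier f) = f :=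
    FourierTransform.fourierInv_fourier_eq f
  have h2 : f v = (χ v : ℂ) := rfl
  rw [← h2]
  conv_lhs => rw [← h1]
  rw [SchwartzMap.fourierInv_coe, Real.fourierInv_eq']
  congr 1
  ext η
  rw [smul_eq_mul, mul_comm Complex.I]
  congr 4
  simp
  ring

lemma fresnel (χ : ℝ → ℝ) (hχc : Continuous χ) (hc : HasCompactSupport χ) (h : ℝ → ℂ)
    (hi : Integrable h) (hcont : Continuous h)
    (hrep : ∀ v : ℝ,
      (χ v : ℂ) = ∫ η : ℝ, Complex.exp (Complex.I * ((2 * Real.pi * η * v : ℝ) : ℂ)) * h η)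
    (A y M : ℝ) (hA : A ≠ 0) (hM : 0 < M) :
    ∫ v : ℝ, Complex.exp (Complex.I * ((A * v ^ 2 + y * v : ℝ) : ℂ)) * (χ (v / M) : ℂ) =
      (Real.pi / (-(Complex.I * A)) : ℂ) ^ (1/2 : ℂ) *
        ∫ η : ℝ, h η * Complex.exp (Complex.I * ((-(y + 2 * Real.pi * η / M) ^ 2 / (4 * A) : ℝ) : ℂ)) := by
  have hAc : (A : ℂ) ≠ 0 := by exact_mod_cast hA
  have damped : ∀ ε : ℝ, 0 < ε →
      ∫ v : ℝ, Complex.exp (Complex.I * ((A * v ^ 2 + y * v : ℝ) : ℂ)) * (χ (v / M) : ℂ)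
        * ((Real.exp (-ε * v ^ 2) : ℝ) : ℂ) =
      (Real.pi / (ε - Complex.I * A) : ℂ) ^ (1/2 : ℂ) *
        ∫ η : ℝ, h η * Complex.exp (-((y + 2 * Real.pi * η / M : ℝ) : ℂ) ^ 2 / (4 * (ε - Complex.I * A))) := by
    intro ε hε
    have hint : Integrable (Function.uncurry fun v η : ℝ =>
        Complex.exp (Complex.I * ((A * v ^ 2 + y * v + 2 * Real.pi * η * (v / M) : ℝ) : ℂ)) *
          (((Real.exp (-ε * v ^ 2) : ℝ) : ℂ) * h η)) (volume.prod volume) := by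
      have h0 : Integrable (fun z : ℝ × ℝ => ((Real.exp (-ε * z.1 ^ 2) : ℝ) : ℂ) * h z.2)
          (volume.prod volume) :=
        Integrable.mul_prod (integrable_exp_neg_mul_sq hε).ofReal hi
      refine Integrable.bdd_mul (c := 1) h0 ?_ ?_
      · apply Continuous.aestronglyMeasurable
        fun_prop
      · exact Filter.Eventually.of_forall fun z => (norm_expI _).le
    have sw := integral_integral_swap hint
    calc _ = ∫ v : ℝ, ∫ η : ℝ, Complex.exp (Complex.I * ((A * v ^ 2 + y * v + 2 * Real.pi * η * (v / M) : ℝ) : ℂ)) *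
          (((Real.exp (-ε * v ^ 2) : ℝ) : ℂ) * h η) := by
          congr 1
          ext v
          rw [hrep (v / M), ← integral_const_mul, ← integral_mul_const]
          congr 1
          ext η
          rw [Complex.ofReal_add (A * v ^ 2 + y * v), mul_add, Complex.exp_add]
          ring
      _ = _ := by
          rw [sw, ← integral_const_mul]
          congr 1
          ext η
          have g := fourierIntegral_gaussian (b := ε - Complex.I * A) (by simpa using hε)
            ((y + 2 * Real.pi * η / M : ℝ) : ℂ)
          rw [mul_left_comm, ← g, ← integral_const_mul]
          congr 1
          ext v
          rw [mul_comm _ (h η), mul_left_comm]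
          congr 1
          rw [Complex.ofReal_exp, ← Complex.exp_add, ← Complex.exp_add]
          congr 1
          push_cast
          ring
  have limL : Filter.Tendsto (fun ε : ℝ => ∫ v : ℝ, Complex.exp (Complex.I * ((A * v ^ 2 + y * v : ℝ) : ℂ)) * (χ (v / M) : ℂ)
        * ((Real.exp (-ε * v ^ 2) : ℝ) : ℂ)) (nhdsWithin 0 (Ioi 0))
      (nhds (∫ v : ℝ, Complex.exp (Complex.I * ((A * v ^ 2 + y * v : ℝ) : ℂ)) * (χ (v / M) : ℂ))) := by
    have hχi : Integrable (fun v => ‖χ (v / M)‖) := by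
      have : Integrable χ := hχc.integrable_of_hasCompactSupport hc
      exact (this.comp_div hM.ne').norm
    refine tendsto_integral_filter_of_dominated_convergence (fun v => ‖χ (v / M)‖) ?_ ?_ hχi ?_
    · refine Filter.Eventually.of_forall fun ε => Continuous.aestronglyMeasurable ?_
      fun_prop
    · filter_upwards [self_mem_nhdsWithin] with ε hε
      refine Filter.Eventually.of_forall fun v => ?_
      rw [norm_mul, norm_mul, norm_expI, one_mul, Complex.norm_real, Complex.norm_real]
      refine mul_le_of_le_one_right (norm_nonneg _) ?_
      rw [Real.norm_eq_abs, Real.abs_exp, Real.exp_le_one_iff]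
      have : 0 < ε := hε
      nlinarith [sq_nonneg v]
    · refine Filter.Eventually.of_forall fun v => ?_
      have : Continuous (fun ε : ℝ => Complex.exp (Complex.I * ((A * v ^ 2 + y * v : ℝ) : ℂ)) * (χ (v / M) : ℂ)
        * ((Real.exp (-ε * v ^ 2) : ℝ) : ℂ)) := by fun_prop
      have t := (this.tendsto 0).mono_left (nhdsWithin_le_nhds (s := Ioi 0))
      simpa using t
  have hne : ∀ ε : ℝ, (ε - Complex.I * A : ℂ) ≠ 0 := by
    intro ε h0
    have := congrArg Complex.im h0
    simp at this
    exact hA this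
  have limR : Filter.Tendsto (fun ε : ℝ => (Real.pi / (ε - Complex.I * A) : ℂ) ^ (1/2 : ℂ) *
        ∫ η : ℝ, h η * Complex.exp (-((y + 2 * Real.pi * η / M : ℝ) : ℂ) ^ 2 / (4 * (ε - Complex.I * A))))
      (nhdsWithin 0 (Ioi 0))
      (nhds ((Real.pi / (-(Complex.I * A)) : ℂ) ^ (1/2 : ℂ) *
        ∫ η : ℝ, h η * Complex.exp (Complex.I * ((-(y + 2 * Real.pi * η / M) ^ 2 / (4 * A) : ℝ) : ℂ)))) := by
    refine Filter.Tendsto.mul ?_ ?_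
    · have hc1 : ContinuousAt (fun ε : ℝ => (Real.pi / (ε - Complex.I * A) : ℂ)) 0 := by
        refine ContinuousAt.div (by fun_prop) (by fun_prop) (hne 0)
      have hslit : (Real.pi / (((0:ℝ):ℂ) - Complex.I * A) : ℂ) ∈ Complex.slitPlane := by
        right
        have : (Real.pi / (((0:ℝ):ℂ) - Complex.I * A) : ℂ) = ((Real.pi / A : ℝ) : ℂ) * Complex.I := by
          have := hne 0
          rw [div_eq_iff this]
          push_cast
          field_simp
          linear_combination (A : ℂ) * Complex.I_mul_I
        rw [this]
        simp [Real.pi_ne_zero, hA]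
      have hc2 := ContinuousAt.cpow hc1 (continuousAt_const (y := (1/2 : ℂ))) hslit
      have t := hc2.tendsto.mono_left (nhdsWithin_le_nhds (s := Ioi 0))
      simpa using t
    · refine tendsto_integral_filter_of_dominated_convergence (fun η => ‖h η‖) ?_ ?_ hi.norm ?_
      · refine Filter.Eventually.of_forall fun ε => Continuous.aestronglyMeasurable ?_
        fun_prop
      · filter_upwards [self_mem_nhdsWithin] with ε hε
        refine Filter.Eventually.of_forall fun η => ?_
        rw [norm_mul]
        refine mul_le_of_le_one_right (norm_nonneg _) ?_
        rw [Complex.norm_exp, Real.exp_le_one_iff]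
        have e : (-((y + 2 * Real.pi * η / M : ℝ) : ℂ) ^ 2 / (4 * (ε - Complex.I * A))) =
          ((-(y + 2 * Real.pi * η / M : ℝ) ^ 2 / 4 : ℝ) : ℂ) * (ε - Complex.I * A)⁻¹ := by
          have := hne ε
          push_cast
          field_simp
        rw [e, Complex.re_ofReal_mul, Complex.inv_re]
        have hε' : 0 < ε := hε
        refine mul_nonpos_of_nonpos_of_nonneg ?_ ?_
        · have := sq_nonneg (y + 2 * Real.pi * η / M); linarith
        · refine div_nonneg ?_ (Complex.normSq_nonneg _)
          simpa using hε'.le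
      · refine Filter.Eventually.of_forall fun η => ?_
        have hc1 : ContinuousAt (fun ε : ℝ => h η * Complex.exp (-((y + 2 * Real.pi * η / M : ℝ) : ℂ) ^ 2 / (4 * (ε - Complex.I * A)))) 0 := by
          refine continuousAt_const.mul (ContinuousAt.cexp ?_)
          refine ContinuousAt.div (by fun_prop) (by fun_prop) (mul_ne_zero (by norm_num) (hne 0))
        have t := hc1.tendsto.mono_left (nhdsWithin_le_nhds (s := Ioi 0))
        convert t using 4
        have := hne 0
        push_cast at this ⊢
        rw [zero_sub] at this ⊢
        rw [mul_div_assoc', div_eq_div_iff (by simpa using hA) (by simpa using hA)]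
        linear_combination (4 * A * ((y : ℂ) + 2 * Real.pi * η / M) ^ 2) * Complex.I_mul_I
  refine tendsto_nhds_unique limL (limR.congr' ?_)
  filter_upwards [self_mem_nhdsWithin] with ε hε
  exact (damped ε hε).symm

lemma half_bound (α : ℝ) (hα : α ∈ Icc (1:ℝ) 2) (χ : ℝ → ℝ)
    (hχs : ContDiff ℝ (⊤ : ℕ∞) χ) (hc : HasCompactSupport χ) (a : ℝ → ℝ) (ha : ContDiff ℝ 1 a) :
    ∃ C ≥ (0:ℝ), ∀ T κ X y M : ℝ, T ≠ 0 → κ ≠ 0 → 0 < M →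
    ‖∫ x in (1/2:ℝ)..2, Complex.exp (Complex.I * ((T * x ^ (α + 1) + X * x : ℝ) : ℂ)) * (a x : ℂ) *
      ∫ v : ℝ, Complex.exp (Complex.I * ((κ * x * v ^ 2 + y * v : ℝ) : ℂ)) * (χ (v / M) : ℂ)‖
      ≤ C * (|κ| ^ (-(1:ℝ)/2) * |T| ^ (-(1:ℝ)/3)) := by
  obtain ⟨h, hi, hcont, hrep⟩ := exists_kernel χ hχs hc
  have hle : (1/2:ℝ) ≤ 2 := by norm_num
  set b : ℝ → ℝ := fun x => a x * x ^ (-(1:ℝ)/2) with hb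
  have hr : ∀ r : ℝ, ContinuousOn (fun x : ℝ => x ^ r) (Icc (1/2:ℝ) 2) := fun r =>
    continuousOn_id.rpow_const (fun x hx => Or.inl (by have := hx.1; simp only [id]; linarith))
  obtain ⟨C0, hC0, hK⟩ := amp_bound α hα b
    (fun x => deriv a x * x ^ (-(1:ℝ)/2) + a x * ((-(1:ℝ)/2) * x ^ (-(1:ℝ)/2 - 1)))
    (by
      intro x hx
      have h0 : x ≠ 0 := by have := hx.1; intro h; linarith
      exact ((ha.differentiable (by norm_num)) x).hasDerivAt.mul
        (Real.hasDerivAt_rpow_const (Or.inl h0)))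
    (by
      have h1 := (ha.continuous_deriv (by norm_num)).continuousOn (s := Icc (1/2:ℝ) 2)
      have h2 := ha.continuous.continuousOn (s := Icc (1/2:ℝ) 2)
      exact (h1.mul (hr _)).add (h2.mul (continuousOn_const.mul (hr _))))
  have cb : ContinuousOn b (Icc (1/2:ℝ) 2) := ha.continuous.continuousOn.mul (hr _)
  refine ⟨C0 * Real.pi ^ ((1:ℝ)/2) * ∫ η, ‖h η‖, ?_, ?_⟩
  · have : 0 ≤ ∫ η, ‖h η‖ := integral_nonneg fun _ => norm_nonneg _
    positivity
  intro T κ X y M hT hκ hM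
  set c0 : ℂ := (Real.pi / (-(Complex.I * κ)) : ℂ) ^ (1/2 : ℂ) with hc0
  set B : ℝ → ℝ := fun η => (y + 2 * Real.pi * η / M) ^ 2 / (4 * κ) with hB
  have hκc : (κ : ℂ) ≠ 0 := by exact_mod_cast hκ
  have hnc0 : ‖c0‖ = Real.pi ^ ((1:ℝ)/2) * |κ| ^ (-(1:ℝ)/2) := by
    have hz : (Real.pi / (-(Complex.I * κ)) : ℂ) ≠ 0 :=
      div_ne_zero (by exact_mod_cast Real.pi_ne_zero) (neg_ne_zero.2 (mul_ne_zero Complex.I_ne_zero hκc))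
    have hn : ‖(Real.pi / (-(Complex.I * κ)) : ℂ)‖ = Real.pi * |κ|⁻¹ := by
      simp [abs_of_pos Real.pi_pos, div_eq_mul_inv]
    have e2 : (1/2 : ℂ) = (((1:ℝ)/2 : ℝ) : ℂ) := by push_cast; rfl
    rw [hc0, Complex.norm_cpow_of_ne_zero hz, e2, Complex.ofReal_re, Complex.ofReal_im, hn,
      Real.mul_rpow Real.pi_pos.le (by positivity), Real.inv_rpow (abs_nonneg _), neg_div,
      Real.rpow_neg (abs_nonneg _)]
    simp
  have hfac : ∀ x : ℝ, 0 < x → (Real.pi / (-(Complex.I * ((κ * x : ℝ) : ℂ))) : ℂ) ^ (1/2 : ℂ)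
      = c0 * ((x ^ (-(1:ℝ)/2) : ℝ) : ℂ) := by
    intro x hx
    have hz : (Real.pi / (-(Complex.I * κ)) : ℂ) ≠ 0 :=
      div_ne_zero (by exact_mod_cast Real.pi_ne_zero) (neg_ne_zero.2 (mul_ne_zero Complex.I_ne_zero hκc))
    have hxc : (x : ℂ) ≠ 0 := by exact_mod_cast hx.ne'
    have e1 : (Real.pi / (-(Complex.I * ((κ * x : ℝ) : ℂ))) : ℂ) =
        ((x⁻¹ : ℝ) : ℂ) * (Real.pi / (-(Complex.I * κ)) : ℂ) := by
      push_cast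
      field_simp
    have hxi : ((x⁻¹ : ℝ) : ℂ) ≠ 0 := by exact_mod_cast (inv_pos.2 hx).ne'
    rw [e1, Complex.cpow_def_of_ne_zero (mul_ne_zero hxi hz),
      Complex.log_ofReal_mul (inv_pos.2 hx) hz, add_mul, Complex.exp_add, mul_comm, hc0,
      Complex.cpow_def_of_ne_zero hz, Real.rpow_def_of_pos hx, Real.log_inv]
    congr 1
    push_cast
    congr 1
    ring
  have step1 : (∫ x in (1/2:ℝ)..2, Complex.exp (Complex.I * ((T * x ^ (α + 1) + X * x : ℝ) : ℂ)) * (a x : ℂ) *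
      ∫ v : ℝ, Complex.exp (Complex.I * ((κ * x * v ^ 2 + y * v : ℝ) : ℂ)) * (χ (v / M) : ℂ)) =
      c0 * ∫ x in (1/2:ℝ)..2, ∫ η : ℝ, Complex.exp (Complex.I * ((T * x ^ (α + 1) + X * x - B η / x : ℝ) : ℂ)) *
        ((b x : ℂ) * h η) := by
    rw [← intervalIntegral.integral_const_mul]
    apply intervalIntegral.integral_congr
    intro x hx
    rw [uIcc_of_le hle] at hx
    have hx0 : 0 < x := by linarith [hx.1]
    dsimp only
    rw [fresnel χ hχs.continuous hc h hi hcont hrep (κ * x) y M (mul_ne_zero hκ hx0.ne') hM, hfac x hx0,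
      ← integral_const_mul, ← integral_const_mul, ← integral_const_mul]
    congr 1
    ext η
    have e : T * x ^ (α + 1) + X * x - B η / x = (T * x ^ (α + 1) + X * x) +
        (-(y + 2 * Real.pi * η / M) ^ 2 / (4 * (κ * x))) := by
      simp only [hB]
      field_simp
      ring
    rw [e, Complex.ofReal_add (T * x ^ (α + 1) + X * x), mul_add, Complex.exp_add, hb, Complex.ofReal_mul]
    ring
  have hint : Integrable (Function.uncurry fun x η : ℝ =>
      Complex.exp (Complex.I * ((T * x ^ (α + 1) + X * x - B η / x : ℝ) : ℂ)) *
        ((b x : ℂ) * h η)) ((volume.restrict (Ioc (1/2:ℝ) 2)).prod volume) := by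
    have ib : Integrable (fun x => (b x : ℂ)) (volume.restrict (Ioc (1/2:ℝ) 2)) := by
      have : ContinuousOn (fun x => (b x : ℂ)) (Icc (1/2:ℝ) 2) := by fun_prop
      exact (this.integrableOn_Icc).mono_set Ioc_subset_Icc_self
    have h0 := Integrable.mul_prod ib hi
    refine Integrable.bdd_mul (c := 1) h0 ?_ ?_
    · apply Measurable.aestronglyMeasurable
      fun_prop
    · exact Filter.Eventually.of_forall fun z => (norm_expI _).le
  rw [step1, intervalIntegral.integral_of_le hle, integral_integral_swap hint, norm_mul, hnc0]
  have hfin : ‖∫ η : ℝ, ∫ x in Ioc (1/2:ℝ) 2, Complex.exp (Complex.I * ((T * x ^ (α + 1) + X * x - B η / x : ℝ) : ℂ)) *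
        ((b x : ℂ) * h η)‖ ≤ ∫ η : ℝ, ‖h η‖ * (C0 * |T| ^ (-(1:ℝ)/3)) := by
    refine norm_integral_le_of_norm_le (hi.norm.mul_const _) (Filter.Eventually.of_forall fun η => ?_)
    have e : (∫ x in Ioc (1/2:ℝ) 2, Complex.exp (Complex.I * ((T * x ^ (α + 1) + X * x - B η / x : ℝ) : ℂ)) *
        ((b x : ℂ) * h η)) = h η * ∫ x in (1/2:ℝ)..2, (b x : ℂ) *
          Complex.exp (Complex.I * ((T * x ^ (α + 1) + X * x - B η / x : ℝ) : ℂ)) := by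
      rw [intervalIntegral.integral_of_le hle, ← integral_const_mul]
      congr 1
      ext x
      ring
    rw [e, norm_mul]
    exact mul_le_mul_of_nonneg_left (hK T X (B η) hT) (norm_nonneg _)
  rw [integral_mul_const] at hfin
  refine (mul_le_mul_of_nonneg_left hfin (by positivity)).trans (le_of_eq ?_)
  ring

lemma pos_part (g : ℝ → ℂ) (h0 : ∀ x, 0 < x → x ∉ Ioc (1/2:ℝ) 2 → g x = 0) :
    ∫ x in Ioi (0:ℝ), g x = ∫ x in (1/2:ℝ)..2, g x := by
  rw [intervalIntegral.integral_of_le (by norm_num)]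
  refine setIntegral_eq_of_subset_of_forall_diff_eq_zero measurableSet_Ioi ?_ ?_
  · intro x hx
    exact lt_trans (by norm_num) hx.1
  · rintro x ⟨hx, hx'⟩
    exact h0 x hx hx'

theorem stmt4 (α : ℝ) (hα : α ∈ Icc (1:ℝ) 2)
    (χ : ℝ → ℝ)
    (hχs : ContDiff ℝ (⊤ : ℕ∞) χ)
    (hχ01 : ∀ x, χ x ∈ Icc (0:ℝ) 1)
    (hχ1 : ∀ x, |x| ≤ 4/3 → χ x = 1)
    (hχ0 : ∀ x, 5/3 < |x| → χ x = 0) :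
    ∃ C > (0:ℝ), ∀ N M : ℝ, (∃ k : ℕ, N = 2 ^ k) → 2 ≤ N → (∃ k : ℕ, M = 2 ^ k) →
      ∀ t : ℝ, t ≠ 0 → ∀ x y : ℝ,
      ‖∫ ζ : ℝ × ℝ,
          Complex.exp (Complex.I *
              ((t * (ζ.1 * (|ζ.1| ^ α + ζ.2 ^ 2)) + x * ζ.1 + y * ζ.2 : ℝ) : ℂ))
            * ((χ (ζ.1 / N) - χ (2 * ζ.1 / N) : ℝ) : ℂ)
            * ((χ (ζ.2 / M) : ℝ) : ℂ)‖
        ≤ C * N ^ ((1:ℝ)/6 - α/3) * |t| ^ (-(5:ℝ)/6) := by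
  have hc : HasCompactSupport χ := by
    refine HasCompactSupport.of_support_subset_isCompact (isCompact_Icc (a := (-2:ℝ)) (b := 2)) ?_
    intro x hx
    by_contra hx'
    refine hx (hχ0 x ?_)
    by_contra hle
    have := abs_le.1 (not_lt.1 hle)
    exact hx' ⟨by linarith [this.1], by linarith [this.2]⟩
  have hχ1s : ContDiff ℝ 1 χ := hχs.of_le (by exact_mod_cast le_top)
  have hχc := hχs.continuous
  obtain ⟨C1, hC1, H1⟩ := half_bound α hα χ hχs hc (fun x => χ (1 * x) - χ (2 * (1 * x)))
    (by fun_prop)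
  obtain ⟨C2, hC2, H2⟩ := half_bound α hα χ hχs hc (fun x => χ (-1 * x) - χ (2 * (-1 * x)))
    (by fun_prop)
  refine ⟨C1 + C2 + 1, by positivity, ?_⟩
  intro N M _ hN hMk t ht x y
  obtain ⟨k, rfl⟩ := hMk
  set M : ℝ := 2 ^ k
  have hM : 0 < M := by positivity
  have hN0 : 0 < N := by linarith
  have hχi : Integrable χ := hχc.integrable_of_hasCompactSupport hc
  have hα0 : 0 ≤ α := by linarith [hα.1]
  have hint : Integrable (fun ζ : ℝ × ℝ => Complex.exp (Complex.I *
              ((t * (ζ.1 * (|ζ.1| ^ α + ζ.2 ^ 2)) + x * ζ.1 + y * ζ.2 : ℝ) : ℂ))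
            * ((χ (ζ.1 / N) - χ (2 * ζ.1 / N) : ℝ) : ℂ)
            * ((χ (ζ.2 / M) : ℝ) : ℂ)) (volume.prod volume) := by
    have i1 : Integrable (fun ξ : ℝ => χ (ξ / N) - χ (2 * ξ / N)) := by
      refine (hχi.comp_div hN0.ne').sub ?_
      have := hχi.comp_div (R := N / 2) (by positivity)
      refine this.congr (Filter.Eventually.of_forall fun ξ => ?_)
      simp only
      congr 1
      field_simp
    have i2 : Integrable (fun v : ℝ => χ (v / M)) := hχi.comp_div hM.ne'
    have h0 := Integrable.mul_prod (i1.ofReal (𝕜 := ℂ)) (i2.ofReal (𝕜 := ℂ))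
    have h1 := Integrable.bdd_mul (c := 1) (f := fun ζ : ℝ × ℝ => Complex.exp (Complex.I *
              ((t * (ζ.1 * (|ζ.1| ^ α + ζ.2 ^ 2)) + x * ζ.1 + y * ζ.2 : ℝ) : ℂ))) h0 ?_ ?_
    · refine h1.congr (Filter.Eventually.of_forall fun ζ => ?_)
      simp only [mul_assoc]
      rfl
    · apply Measurable.aestronglyMeasurable
      fun_prop
    · exact Filter.Eventually.of_forall fun z => (norm_expI _).le
  set F : ℝ → ℂ := fun ξ => Complex.exp (Complex.I * ((t * (ξ * |ξ| ^ α) + x * ξ : ℝ) : ℂ)) *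
    ((χ (ξ / N) - χ (2 * ξ / N) : ℝ) : ℂ) *
    ∫ v : ℝ, Complex.exp (Complex.I * ((t * ξ * v ^ 2 + y * v : ℝ) : ℂ)) * (χ (v / M) : ℂ) with hF
  have hFeq : ∀ ξ : ℝ, (∫ v : ℝ, Complex.exp (Complex.I *
              ((t * (ξ * (|ξ| ^ α + v ^ 2)) + x * ξ + y * v : ℝ) : ℂ))
            * ((χ (ξ / N) - χ (2 * ξ / N) : ℝ) : ℂ)
            * ((χ (v / M) : ℝ) : ℂ)) = F ξ := by
    intro ξ
    rw [hF]
    dsimp only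
    rw [← integral_const_mul]
    congr 1
    ext v
    have e : t * (ξ * (|ξ| ^ α + v ^ 2)) + x * ξ + y * v =
      (t * (ξ * |ξ| ^ α) + x * ξ) + (t * ξ * v ^ 2 + y * v) := by ring
    rw [e, Complex.ofReal_add (t * (ξ * |ξ| ^ α) + x * ξ), mul_add, Complex.exp_add]
    ring
  have hFint : Integrable F := by
    have := hint.integral_prod_left
    exact this.congr (Filter.Eventually.of_forall hFeq)
  have hGint : Integrable (fun ξ => F (N * ξ)) := hFint.comp_mul_left' hN0.ne'
  have hJ : (∫ ζ : ℝ × ℝ, Complex.exp (Complex.I *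
              ((t * (ζ.1 * (|ζ.1| ^ α + ζ.2 ^ 2)) + x * ζ.1 + y * ζ.2 : ℝ) : ℂ))
            * ((χ (ζ.1 / N) - χ (2 * ζ.1 / N) : ℝ) : ℂ)
            * ((χ (ζ.2 / M) : ℝ) : ℂ)) = (N : ℂ) * ∫ ξ, F (N * ξ) := by
    rw [Measure.volume_eq_prod, integral_prod _ hint, Measure.integral_comp_mul_left]
    simp only [hFeq]
    rw [abs_of_pos (inv_pos.2 hN0), Complex.real_smul, ← mul_assoc]
    have : (N : ℂ) ≠ 0 := by exact_mod_cast hN0.ne'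
    push_cast
    rw [mul_inv_cancel₀ this, one_mul]
  have hhalf : ∀ s : ℝ, |s| = 1 → ∫ ξ in Ioi (0:ℝ), F (N * (s * ξ)) =
      ∫ ξ in (1/2:ℝ)..2, Complex.exp (Complex.I *
        (((t * s * N ^ (α + 1)) * ξ ^ (α + 1) + (x * N * s) * ξ : ℝ) : ℂ)) *
        ((χ (s * ξ) - χ (2 * (s * ξ)) : ℝ) : ℂ) *
      ∫ v : ℝ, Complex.exp (Complex.I * (((t * N * s) * ξ * v ^ 2 + y * v : ℝ) : ℂ)) * (χ (v / M) : ℂ) := by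
    intro s hs
    have e1 : ∀ ξ : ℝ, N * (s * ξ) / N = s * ξ := fun ξ => by field_simp
    have e2 : ∀ ξ : ℝ, 2 * (N * (s * ξ)) / N = 2 * (s * ξ) := fun ξ => by field_simp
    rw [pos_part]
    · apply intervalIntegral.integral_congr
      intro ξ hξ
      rw [uIcc_of_le (by norm_num)] at hξ
      have hξ0 : 0 < ξ := by linarith [hξ.1]
      simp only [hF, e1, e2]
      have e3 : t * (N * (s * ξ) * |N * (s * ξ)| ^ α) + x * (N * (s * ξ)) =
          (t * s * N ^ (α + 1)) * ξ ^ (α + 1) + (x * N * s) * ξ := by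
        rw [abs_mul, abs_mul, hs, one_mul, abs_of_pos hN0, abs_of_pos hξ0,
          Real.mul_rpow hN0.le hξ0.le, Real.rpow_add_one hN0.ne', Real.rpow_add_one hξ0.ne']
        ring
      have e4 : t * (N * (s * ξ)) = (t * N * s) * ξ := by ring
      rw [e3, e4]
    · intro ξ hξ hξ'
      have hsx : |s * ξ| = ξ := by rw [abs_mul, hs, one_mul, abs_of_pos hξ]
      have hsx2 : |2 * (s * ξ)| = 2 * ξ := by rw [abs_mul, hsx]; norm_num
      have hz : χ (s * ξ) - χ (2 * (s * ξ)) = 0 := by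
        by_cases h : ξ ≤ 1/2
        · rw [hχ1 _ (by rw [hsx]; linarith), hχ1 _ (by rw [hsx2]; linarith), sub_self]
        · have h2 : 2 < ξ := by
            by_contra h2
            exact hξ' ⟨not_le.1 h, not_lt.1 h2⟩
          rw [hχ0 _ (by rw [hsx]; linarith), hχ0 _ (by rw [hsx2]; linarith), sub_self]
      simp only [hF, e1, e2, hz]
      simp
  have hsplit : ∫ ξ, F (N * ξ) = (∫ ξ in Ioi (0:ℝ), F (N * (-1 * ξ))) + ∫ ξ in Ioi (0:ℝ), F (N * (1 * ξ)) := by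
    rw [← intervalIntegral.integral_Iic_add_Ioi (b := (0:ℝ)) hGint.integrableOn hGint.integrableOn]
    have := integral_comp_neg_Ioi (0:ℝ) (fun ξ => F (N * ξ))
    rw [neg_zero] at this
    rw [← this]
    simp only [one_mul, neg_mul]
  have hNp : 0 < N ^ (α + 1) := by positivity
  have B1 := H1 (t * 1 * N ^ (α + 1)) (t * N * 1) (x * N * 1) y M
    (mul_ne_zero (mul_ne_zero ht one_ne_zero) hNp.ne') (mul_ne_zero (mul_ne_zero ht hN0.ne') one_ne_zero) hM
  have B2 := H2 (t * (-1) * N ^ (α + 1)) (t * N * (-1)) (x * N * (-1)) y M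
    (mul_ne_zero (mul_ne_zero ht (by norm_num)) hNp.ne')
    (mul_ne_zero (mul_ne_zero ht hN0.ne') (by norm_num)) hM
  rw [← hhalf 1 (by simp)] at B1
  rw [← hhalf (-1) (by simp)] at B2
  have ht' : 0 < |t| := abs_pos.2 ht
  have hpow : N * ((|t| * N) ^ (-(1:ℝ)/2) * (|t| * N ^ (α + 1)) ^ (-(1:ℝ)/3)) =
      N ^ ((1:ℝ)/6 - α/3) * |t| ^ (-(5:ℝ)/6) := by
    rw [Real.mul_rpow ht'.le hN0.le, Real.mul_rpow ht'.le hNp.le, ← Real.rpow_mul hN0.le]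
    have e1 : |t| ^ (-(5:ℝ)/6) = |t| ^ (-(1:ℝ)/2) * |t| ^ (-(1:ℝ)/3) := by
      rw [← Real.rpow_add ht']; norm_num
    have e2 : N ^ ((1:ℝ)/6 - α/3) = N ^ (1:ℝ) * N ^ (-(1:ℝ)/2) * N ^ ((α + 1) * (-(1:ℝ)/3)) := by
      rw [← Real.rpow_add hN0, ← Real.rpow_add hN0]; congr 1; ring
    rw [e1, e2, Real.rpow_one]
    ring
  have a1 : |t * 1 * N ^ (α + 1)| = |t| * N ^ (α + 1) := by
    rw [mul_one, abs_mul, abs_of_pos hNp]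
  have a2 : |t * (-1) * N ^ (α + 1)| = |t| * N ^ (α + 1) := by
    rw [abs_mul, abs_mul, abs_of_pos hNp]; simp
  have a3 : |t * N * 1| = |t| * N := by
    rw [mul_one, abs_mul, abs_of_pos hN0]
  have a4 : |t * N * (-1)| = |t| * N := by
    rw [abs_mul, abs_mul, abs_of_pos hN0]; simp
  rw [a1, a3] at B1
  rw [a2, a4] at B2
  rw [hJ, hsplit, norm_mul, Complex.norm_real, Real.norm_eq_abs, abs_of_pos hN0, mul_assoc, ← hpow]
  set Q := (|t| * N) ^ (-(1:ℝ)/2) * (|t| * N ^ (α + 1)) ^ (-(1:ℝ)/3) with hQ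
  have hQ0 : 0 ≤ Q := by positivity
  calc N * _ ≤ N * (C2 * Q + C1 * Q) :=
        mul_le_mul_of_nonneg_left ((norm_add_le _ _).trans (add_le_add B2 B1)) hN0.le
    _ ≤ (C1 + C2 + 1) * (N * Q) := by
        have : 0 ≤ N * Q := by positivity
        nlinarith
end
end
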